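/- (Inverse counting lemma.) There exists a constant C > 0 such that for every integer k ≥ 3 and all orderons W and U the following holds: if |t(F,W) − t(F,U)| ≤ 2^{−k²} for every simple ordered graph F on k vertices, then d△(W,U) ≤ 2C·(log log k / log k)^{1/3}. -/

import Mathlib

open MeasureTheory Real Filter
open scoped ENNReal Classical

noncomputable section

/-- The unit interval `[0,1]` as a subtype of `ℝ`. -/
abbrev UI : Type := Set.Icc (0:ℝ) 1

/-- The unit square `[0,1]²`. -/
abbrev USq : Type := UI × UI

/-- An orderon: a symmetric measurable function `([0,1]²)² → [0,1]`. -/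
def IsOrderon (W : USq → USq → ℝ) : Prop :=
  Measurable (Function.uncurry W) ∧ (∀ u v, W u v ∈ Set.Icc (0:ℝ) 1) ∧
    ∀ u v, W u v = W v u

/-- The (unordered) cut norm: `sup_{S,T} |∫_{S×T} W|` over measurable `S,T ⊆ [0,1]²`. -/
def cutNorm (W : USq → USq → ℝ) : ℝ :=
  sSup {x | ∃ S T : Set USq, MeasurableSet S ∧ MeasurableSet T ∧
    x = |∫ p in S ×ˢ T, W p.1 p.2|}

/-- A measure-preserving bijection of `[0,1]²` with measure-preserving inverse. -/
def IsMPB (f : USq → USq) : Prop :=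
  MeasurePreserving f volume volume ∧
  ∃ g : USq → USq, MeasurePreserving g volume volume ∧
    Function.LeftInverse g f ∧ Function.RightInverse g f

/-- `Shift(f) = sup_{(x,a)} |x - π₁(f(x,a))|`. -/
def shiftOf (f : USq → USq) : ℝ := ⨆ u : USq, |(u.1 : ℝ) - ((f u).1 : ℝ)|

/-- The cut-shift distance `d△(W,U) = inf_f (Shift(f) + ‖W - U^f‖_□)`. -/
def csDist (W U : USq → USq → ℝ) : ℝ :=
  sInf {x | ∃ f : USq → USq, IsMPB f ∧
    x = shiftOf f + cutNorm (fun u v => W u v - U (f u) (f v))}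

/-- The (induced) homomorphism density `t(F,W)` of a simple ordered graph `F` on `[k]`
(encoded as a `SimpleGraph (Fin k)`, the vertex order being that of `Fin k`) in `W`. -/
def homDensity {k : ℕ} (F : SimpleGraph (Fin k)) (W : USq → USq → ℝ) : ℝ :=
  (k.factorial : ℝ) * ∫ v : Fin k → USq,
    ∏ p ∈ Finset.univ.filter (fun p : Fin k × Fin k => p.1 < p.2),
      ((if F.Adj p.1 p.2 then W (v p.1) (v p.2) else 1 - W (v p.1) (v p.2)) *
        (if ((v p.1).1 : ℝ) ≤ ((v p.2).1 : ℝ) then 1 else 0))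

/-- The sum over all closed walks of length six of the products of the entries of `M`. -/
def cyc6 {ι : Type*} [Fintype ι] (M : ι → ι → ℝ) : ℝ :=
  ∑ y : Fin 6 → ι, M (y 0) (y 1) * M (y 1) (y 2) * M (y 2) (y 3) * M (y 3) (y 4) *
    M (y 4) (y 5) * M (y 5) (y 0)

lemma sum_fin_succ_arrow {ι : Type*} [Fintype ι] {n : ℕ} (g : (Fin (n + 1) → ι) → ℝ) :
    ∑ y, g y = ∑ a : ι, ∑ y : Fin n → ι, g (Fin.cons a y) := by
  rw [← (Fin.consEquiv fun _ : Fin (n + 1) => ι).sum_comp, Fintype.sum_prod_type]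
  rfl

lemma cyc6_eq_sum {ι : Type*} [Fintype ι] (M : ι → ι → ℝ) :
    cyc6 M = ∑ a, ∑ b, ∑ c, ∑ d, ∑ e, ∑ f, M a b * M b c * M c d * M d e * M e f * M f a := by
  unfold cyc6
  rw [sum_fin_succ_arrow]
  refine Finset.sum_congr rfl fun a _ => ?_
  rw [sum_fin_succ_arrow]
  refine Finset.sum_congr rfl fun b _ => ?_
  rw [sum_fin_succ_arrow]
  refine Finset.sum_congr rfl fun c _ => ?_
  rw [sum_fin_succ_arrow]
  refine Finset.sum_congr rfl fun d _ => ?_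
  rw [sum_fin_succ_arrow]
  refine Finset.sum_congr rfl fun e _ => ?_
  rw [sum_fin_succ_arrow]
  refine Finset.sum_congr rfl fun f _ => ?_
  rw [Fintype.sum_unique]
  rfl

lemma cyc6_eq_trace {ι : Type*} [Fintype ι] (M : Matrix ι ι ℝ) :
    cyc6 (fun i j => M i j) = (M * (M * (M * (M * (M * M))))).trace := by
  rw [cyc6_eq_sum]
  simp only [Matrix.trace, Matrix.diag, Matrix.mul_apply, Finset.mul_sum, mul_assoc]

lemma cyc6_eq_sum_sq {ι : Type*} [Fintype ι] (M : Matrix ι ι ℝ) (hM : ∀ i j, M i j = M j i) :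
    cyc6 (fun i j => M i j) = ∑ i, ∑ j, ((M * (M * M)) i j) ^ 2 := by
  have hT : M.transpose = M := by ext i j; exact (hM i j).symm
  have h3 : ∀ i j, (M * (M * M)) i j = (M * (M * M)) j i := by
    intro i j
    have : (M * (M * M)).transpose = M * (M * M) := by
      rw [Matrix.transpose_mul, Matrix.transpose_mul, hT, Matrix.mul_assoc]
    rw [← Matrix.transpose_apply (M * (M * M)), this]
  have : (M * (M * (M * (M * (M * M))))) = (M * (M * M)) * (M * (M * M)) := by
    simp only [Matrix.mul_assoc]
  rw [cyc6_eq_trace, this]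
  simp only [Matrix.trace, Matrix.diag]
  refine Finset.sum_congr rfl fun i _ => ?_
  rw [Matrix.mul_apply]
  refine Finset.sum_congr rfl fun j _ => ?_
  rw [h3 j i, sq]

lemma cyc6_nonneg {ι : Type*} [Fintype ι] (M : ι → ι → ℝ) (hM : ∀ i j, M i j = M j i) :
    0 ≤ cyc6 M := by
  have := cyc6_eq_sum_sq (Matrix.of M) hM
  simp only [Matrix.of_apply] at this
  rw [this]
  positivity

/-- A symmetric matrix is bounded as a bilinear form by the sixth root of its closed walk sum. -/
lemma bilin_pow_six_le {ι : Type*} [Fintype ι] (M : Matrix ι ι ℝ) (hM : ∀ i j, M i j = M j i)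
    (a b : ι → ℝ) (ha : ∀ i, |a i| ≤ 1) (hb : ∀ i, |b i| ≤ 1) :
    (∑ i, ∑ j, a i * b j * M i j) ^ 6 ≤ (Fintype.card ι : ℝ) ^ 6 * cyc6 (fun i j => M i j) := by
  have hT : M.transpose = M := by ext i j; exact (hM i j).symm
  set y1 := M.mulVec b
  set y2 := M.mulVec y1
  set y3 := M.mulVec y2
  have cs : ∀ u v : ι → ℝ, (u ⬝ᵥ v) ^ 2 ≤ (u ⬝ᵥ u) * (v ⬝ᵥ v) := by
    intro u v
    have := Finset.sum_mul_sq_le_sq_mul_sq Finset.univ u v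
    simpa [dotProduct, sq] using this
  have adj : ∀ u v : ι → ℝ, (M.mulVec u) ⬝ᵥ v = u ⬝ᵥ (M.mulVec v) := by
    intro u v
    rw [dotProduct_comm, Matrix.dotProduct_mulVec, ← Matrix.mulVec_transpose, hT, dotProduct_comm]
  have nn : ∀ u : ι → ℝ, 0 ≤ u ⬝ᵥ u := by
    intro u
    exact Finset.sum_nonneg fun i _ => mul_self_nonneg _
  have card : ∀ u : ι → ℝ, (∀ i, |u i| ≤ 1) → u ⬝ᵥ u ≤ Fintype.card ι := by
    intro u hu
    calc u ⬝ᵥ u ≤ ∑ i : ι, (1:ℝ) := Finset.sum_le_sum fun i _ => by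
          rw [← sq, ← sq_abs]; exact pow_le_one₀ (abs_nonneg _) (hu i)
      _ = _ := by simp
  have e1 : (y1 ⬝ᵥ y1) ^ 2 ≤ (b ⬝ᵥ b) * (y2 ⬝ᵥ y2) := by
    have : y1 ⬝ᵥ y1 = b ⬝ᵥ y2 := adj b y1
    rw [this]; exact cs _ _
  have e2 : (y2 ⬝ᵥ y2) ^ 2 ≤ (y1 ⬝ᵥ y1) * (y3 ⬝ᵥ y3) := by
    have : y2 ⬝ᵥ y2 = y1 ⬝ᵥ y3 := adj y1 y2
    rw [this]; exact cs _ _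
  have e3 : y3 ⬝ᵥ y3 ≤ cyc6 (fun i j => M i j) * (b ⬝ᵥ b) := by
    have h3 : y3 = (M * (M * M)).mulVec b := by
      simp only [y3, y2, y1, Matrix.mulVec_mulVec, Matrix.mul_assoc]
    rw [h3, cyc6_eq_sum_sq M hM, Finset.sum_mul]
    refine Finset.sum_le_sum fun i _ => ?_
    have := cs ((M * (M * M)) i) b
    rw [← sq]
    refine this.trans_eq ?_
    simp only [dotProduct, sq]
  have e4 : (∑ i, ∑ j, a i * b j * M i j) ^ 2 ≤ (a ⬝ᵥ a) * (y1 ⬝ᵥ y1) := by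
    have : (∑ i, ∑ j, a i * b j * M i j) = a ⬝ᵥ y1 := by
      simp only [dotProduct, y1, Matrix.mulVec, Finset.mul_sum]
      refine Finset.sum_congr rfl fun i _ => Finset.sum_congr rfl fun j _ => by ring
    rw [this]; exact cs _ _
  have hc := cyc6_nonneg (fun i j => M i j) hM
  have p1 := nn y1
  have p2 := nn y2
  have p3 := nn y3
  have pb := nn b
  have pa := nn a
  have ca := card a ha
  have cb := card b hb
  generalize y1 ⬝ᵥ y1 = n1 at *
  generalize y2 ⬝ᵥ y2 = n2 at *
  generalize y3 ⬝ᵥ y3 = n3 at *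
  generalize b ⬝ᵥ b = n0 at *
  generalize a ⬝ᵥ a = m0 at *
  generalize (∑ i, ∑ j, a i * b j * M i j) = s at *
  generalize cyc6 (fun i j => M i j) = c at *
  generalize (Fintype.card ι : ℝ) = N at *
  have hN : 0 ≤ N := pb.trans cb
  have k1 : n1 ^ 3 ≤ n0 ^ 2 * n3 := by
    rcases p1.eq_or_lt with h | h
    · rw [← h]; simp; positivity
    · have : n1 * n1 ^ 3 ≤ n1 * (n0 ^ 2 * n3) := by
        calc n1 * n1 ^ 3 = (n1 ^ 2) ^ 2 := by ring
          _ ≤ (n0 * n2) ^ 2 := by gcongr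
          _ = n0 ^ 2 * n2 ^ 2 := by ring
          _ ≤ n0 ^ 2 * (n1 * n3) := by gcongr
          _ = _ := by ring
      exact le_of_mul_le_mul_left this h
  calc s ^ 6 = (s ^ 2) ^ 3 := by ring
    _ ≤ (m0 * n1) ^ 3 := by gcongr
    _ = m0 ^ 3 * n1 ^ 3 := by ring
    _ ≤ m0 ^ 3 * (n0 ^ 2 * (c * n0)) := by gcongr; exact k1.trans (by gcongr)
    _ = m0 ^ 3 * n0 ^ 3 * c := by ring
    _ ≤ N ^ 3 * N ^ 3 * c := by gcongr
    _ = N ^ 6 * c := by ring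

/-- **Spectral splitting**: a symmetric `[0,1]`-valued kernel on a finite set is the sum of a
spectrally small kernel and at most `L²` bounded rank-one kernels. -/
lemma exists_spectral_split {V : Type*} [Fintype V] [Nonempty V] (w : V → V → ℝ)
    (hs : ∀ x y, w x y = w y x) (h01 : ∀ x y, w x y ∈ Set.Icc (0:ℝ) 1) (L : ℕ) (hL : 1 ≤ L) :
    ∃ (I : Finset V) (e : V → ℝ) (f : V → V → ℝ),
      (I.card : ℝ) ≤ (L:ℝ) ^ 2 ∧ (∀ i, |e i| ≤ 1) ∧ (∀ i ∈ I, ∀ x, |f i x| ≤ L) ∧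
      cyc6 (fun x y => w x y - ∑ i ∈ I, e i * f i x * f i y) ≤
        (Fintype.card V : ℝ) ^ 6 * ((L:ℝ) ^ 4)⁻¹ := by
  set n : ℝ := (Fintype.card V : ℝ) with hn
  have hn0 : 0 < n := by rw [hn]; exact_mod_cast Fintype.card_pos
  let A : Matrix V V ℝ := Matrix.of fun x y => w x y / n
  have hA : A.IsHermitian := by
    ext x y
    simp [A, hs x y]
  let U : Matrix V V ℝ := hA.eigenvectorUnitary
  let e := hA.eigenvalues
  have hU : U.transpose * U = 1 := by
    have := Unitary.star_mul_self_of_mem hA.eigenvectorUnitary.2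
    simpa [Matrix.star_eq_conjTranspose] using this
  have hspec : A = U * Matrix.diagonal e * U.transpose := by
    have := hA.spectral_theorem
    rw [Unitary.conjStarAlgAut_apply] at this
    simpa [Matrix.star_eq_conjTranspose] using this
  have hconj : ∀ d d' : V → ℝ, (U * Matrix.diagonal d * U.transpose) *
      (U * Matrix.diagonal d' * U.transpose) =
      U * Matrix.diagonal (fun i => d i * d' i) * U.transpose := by
    intro d d'
    calc _ = U * Matrix.diagonal d * (U.transpose * U) * Matrix.diagonal d' * U.transpose := by
          simp only [Matrix.mul_assoc]
      _ = _ := by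
          rw [hU, Matrix.mul_one, Matrix.mul_assoc U, Matrix.diagonal_mul_diagonal]
  have htr : ∀ d : V → ℝ, (U * Matrix.diagonal d * U.transpose).trace = ∑ i, d i := by
    intro d
    rw [Matrix.trace_mul_comm, ← Matrix.mul_assoc, hU, Matrix.one_mul, Matrix.trace_diagonal]
  have happ : ∀ (d : V → ℝ) x y, (U * Matrix.diagonal d * U.transpose) x y =
      ∑ i, d i * U x i * U y i := by
    intro d x y
    rw [Matrix.mul_apply]
    refine Finset.sum_congr rfl fun i _ => ?_
    rw [Matrix.mul_diagonal, Matrix.transpose_apply]; ring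
  have hsum : ∑ i, e i ^ 2 ≤ 1 := by
    have h1 : ∑ i, e i ^ 2 = (A * A).trace := by
      rw [hspec, hconj, htr]; simp [sq]
    rw [h1]
    simp only [Matrix.trace, Matrix.diag, Matrix.mul_apply]
    calc ∑ x, ∑ y, A x y * A y x ≤ ∑ x : V, ∑ y : V, (1 / n) * (1 / n) := by
          refine Finset.sum_le_sum fun x _ => Finset.sum_le_sum fun y _ => ?_
          simp only [A, Matrix.of_apply]
          have := h01 x y; have h2 := h01 y x
          have q1 : w x y / n ≤ 1 / n := by gcongr; exact this.2
          have q2 : w y x / n ≤ 1 / n := by gcongr; exact h2.2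
          exact mul_le_mul q1 q2 (div_nonneg h2.1 hn0.le) (by positivity)
      _ = 1 := by simp [← hn]; field_simp
  have he1 : ∀ i, |e i| ≤ 1 := by
    intro i
    have : e i ^ 2 ≤ 1 := (Finset.single_le_sum (f := fun i => e i ^ 2)
      (fun j _ => sq_nonneg _) (Finset.mem_univ i)).trans hsum
    exact (sq_le_one_iff_abs_le_one _).1 this
  have hL0 : (0:ℝ) < L := by exact_mod_cast hL
  have hcol : ∀ i, ∑ y, U y i ^ 2 = 1 := by
    intro i
    have := congrFun (congrFun hU i) i
    rw [Matrix.mul_apply, Matrix.one_apply_eq] at this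
    rw [← this]
    refine Finset.sum_congr rfl fun y _ => ?_
    rw [Matrix.transpose_apply, sq]
  have hev : ∀ i x, e i * U x i = ∑ y, A x y * U y i := by
    intro i x
    have : A * U = U * Matrix.diagonal e := by
      rw [hspec, Matrix.mul_assoc, hU, Matrix.mul_one]
    have := congrFun (congrFun this x) i
    rw [Matrix.mul_apply, Matrix.mul_diagonal] at this
    rw [this, mul_comm]
  let I : Finset V := Finset.univ.filter fun i => 1 / (L:ℝ) ≤ |e i|
  have hdec : ∀ x y, w x y - ∑ i ∈ I, e i * (√n * U x i) * (√n * U y i) =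
      n * (U * Matrix.diagonal (fun i => if i ∈ I then 0 else e i) * U.transpose) x y := by
    intro x y
    have hw : w x y = n * A x y := by simp only [A, Matrix.of_apply]; field_simp
    have h1 : ∑ i ∈ I, e i * (√n * U x i) * (√n * U y i) =
        ∑ i, if i ∈ I then n * (e i * U x i * U y i) else 0 := by
      rw [Finset.sum_ite_mem, Finset.univ_inter]
      refine Finset.sum_congr rfl fun i _ => ?_
      have := Real.mul_self_sqrt hn0.le
      linear_combination (e i * U x i * U y i) * this
    rw [hw, h1, hspec, happ, happ, Finset.mul_sum, Finset.mul_sum, ← Finset.sum_sub_distrib]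
    refine Finset.sum_congr rfl fun i _ => ?_
    split_ifs <;> ring
  refine ⟨I, e, fun i x => √n * U x i, ?_, he1, ?_, ?_⟩
  · have : ∑ i ∈ I, (1 / (L:ℝ)) ^ 2 ≤ 1 := by
      refine (Finset.sum_le_sum fun i hi => ?_).trans
        ((Finset.sum_le_sum_of_subset_of_nonneg (Finset.subset_univ I)
          fun i _ _ => sq_nonneg (e i)).trans hsum)
      rw [← sq_abs (e i)]
      gcongr
      exact (Finset.mem_filter.1 hi).2
    rw [Finset.sum_const, nsmul_eq_mul, one_div, inv_pow] at this
    rwa [← div_eq_mul_inv, div_le_one (by positivity)] at this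
  · intro i hi x
    have hi' := (Finset.mem_filter.1 hi).2
    have hsq : (e i * U x i) ^ 2 ≤ 1 / n := by
      rw [hev]
      refine (Finset.sum_mul_sq_le_sq_mul_sq _ _ _).trans ?_
      rw [hcol, mul_one]
      calc ∑ y, A x y ^ 2 ≤ ∑ y : V, (1 / n) ^ 2 := by
            refine Finset.sum_le_sum fun y _ => ?_
            simp only [A, Matrix.of_apply]
            have := h01 x y
            have q0 : 0 ≤ w x y / n := div_nonneg this.1 hn0.le
            gcongr
            exact this.2
        _ = 1 / n := by simp [← hn]; field_simp
    have h2 : (|e i| * |√n * U x i|) ^ 2 ≤ 1 := by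
      rw [← abs_mul, sq_abs]
      calc (e i * (√n * U x i)) ^ 2 = (√n * √n) * (e i * U x i) ^ 2 := by ring
        _ ≤ n * (1 / n) := by rw [Real.mul_self_sqrt hn0.le]; gcongr
        _ = 1 := by field_simp
    have h3 : |e i| * |√n * U x i| ≤ 1 := by
      have := (sq_le_one_iff₀ (by positivity)).1 h2
      exact this
    have h4 : 1 / (L:ℝ) * |√n * U x i| ≤ 1 := le_trans (by gcongr) h3
    rw [one_div, inv_mul_le_iff₀ hL0, mul_one] at h4
    exact h4
  · simp only [hdec]
    let d : V → ℝ := fun i => if i ∈ I then 0 else e i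
    have hscale : cyc6 (fun x y => n * (U * Matrix.diagonal d * U.transpose) x y) =
        n ^ 6 * cyc6 (fun x y => (U * Matrix.diagonal d * U.transpose) x y) := by
      unfold cyc6
      rw [Finset.mul_sum]
      exact Finset.sum_congr rfl fun y _ => by ring
    rw [hscale, cyc6_eq_trace]
    simp only [hconj, htr]
    gcongr
    calc ∑ i, d i * (d i * (d i * (d i * (d i * d i)))) ≤ ∑ i, ((L:ℝ) ^ 4)⁻¹ * e i ^ 2 := by
          refine Finset.sum_le_sum fun i _ => ?_
          simp only [d]
          split_ifs with h
          · simp; positivity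
          · have h' : |e i| < 1 / L := by
              by_contra hc
              exact h (Finset.mem_filter.2 ⟨Finset.mem_univ _, not_lt.1 hc⟩)
            have h4 : (e i) ^ 4 ≤ ((L:ℝ) ^ 4)⁻¹ := by
              have : |e i| ^ 4 ≤ (1 / (L:ℝ)) ^ 4 := by gcongr
              rwa [Even.pow_abs (by decide), one_div, inv_pow] at this
            calc _ = e i ^ 4 * e i ^ 2 := by ring
              _ ≤ _ := by gcongr
      _ ≤ _ := by
          rw [← Finset.mul_sum]
          exact mul_le_of_le_one_right (by positivity) hsum

/-- Rounding a real number in `[-L, L]` to one of `8 L⁵` values, up to `1 / (3 L⁴)`. -/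
lemma exists_rounding (L : ℕ) (hL : 1 ≤ L) :
    ∃ (bin : ℝ → Fin (8 * L ^ 5)) (val : Fin (8 * L ^ 5) → ℝ),
      ∀ t : ℝ, |t| ≤ L → |t - val (bin t)| ≤ 1 / (3 * (L:ℝ) ^ 4) := by
  have hL0 : (0:ℝ) < L := by exact_mod_cast hL
  have hpos : 0 < 8 * L ^ 5 := by positivity
  let j : ℝ → ℕ := fun t => ⌊t * (3 * (L:ℝ) ^ 4) + 3 * (L:ℝ) ^ 5⌋₊
  refine ⟨fun t => ⟨min (j t) (8 * L ^ 5 - 1), by omega⟩,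
    fun i => ((i : ℕ) - 3 * (L:ℝ) ^ 5) / (3 * (L:ℝ) ^ 4), fun t ht => ?_⟩
  have ht' := abs_le.1 ht
  have h0 : 0 ≤ t * (3 * (L:ℝ) ^ 4) + 3 * (L:ℝ) ^ 5 := by
    have : -(L:ℝ) * (3 * (L:ℝ) ^ 4) ≤ t * (3 * (L:ℝ) ^ 4) := by gcongr; exact ht'.1
    nlinarith
  have h1 : t * (3 * (L:ℝ) ^ 4) + 3 * (L:ℝ) ^ 5 ≤ 6 * (L:ℝ) ^ 5 := by
    have : t * (3 * (L:ℝ) ^ 4) ≤ L * (3 * (L:ℝ) ^ 4) := by gcongr; exact ht'.2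
    nlinarith
  have hj : j t ≤ 8 * L ^ 5 - 1 := by
    have : j t ≤ 6 * L ^ 5 := by
      apply Nat.floor_le_of_le
      push_cast
      exact h1
    have : 1 ≤ L ^ 5 := Nat.one_le_pow _ _ hL
    omega
  simp only [min_eq_left hj]
  have f1 := Nat.floor_le h0
  have f2 := Nat.lt_floor_add_one (t * (3 * (L:ℝ) ^ 4) + 3 * (L:ℝ) ^ 5)
  have hd : t - ((j t : ℝ) - 3 * (L:ℝ) ^ 5) / (3 * (L:ℝ) ^ 4) =
      (t * (3 * (L:ℝ) ^ 4) + 3 * (L:ℝ) ^ 5 - j t) / (3 * (L:ℝ) ^ 4) := by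
    field_simp
    ring
  rw [hd, abs_div, abs_of_pos (show (0:ℝ) < 3 * (L:ℝ) ^ 4 by positivity)]
  gcongr
  rw [abs_le]
  constructor <;> simp only [j] <;> linarith

/-- **Regularity**: a symmetric `[0,1]`-valued kernel on a finite set is the sum of a step
kernel, a spectrally small kernel, and a uniformly small error. -/
lemma exists_regularity {V : Type} [Fintype V] [Nonempty V] (w : V → V → ℝ)
    (hs : ∀ x y, w x y = w y x) (h01 : ∀ x y, w x y ∈ Set.Icc (0:ℝ) 1) (L : ℕ) (hL : 1 ≤ L) :
    ∃ (β : Type) (_ : Fintype β) (h : V → β) (D : β → β → ℝ) (R : V → V → ℝ),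
      (Fintype.card β : ℝ) ≤ (8 * (L:ℝ) ^ 5) ^ (L ^ 2) ∧
      (∀ x y, R x y = R y x) ∧ (∀ x y, |R x y| ≤ 2 * (L:ℝ) ^ 4) ∧
      (∀ x y, |w x y - R x y - D (h x) (h y)| ≤ 1 / (L:ℝ)) ∧
      cyc6 R ≤ (Fintype.card V : ℝ) ^ 6 * ((L:ℝ) ^ 4)⁻¹ := by
  obtain ⟨I, e, f, hI, he, hf, hc⟩ := exists_spectral_split w hs h01 L hL
  obtain ⟨bin, val, hround⟩ := exists_rounding L hL
  have hL0 : (0:ℝ) < L := by exact_mod_cast hL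
  have hL1 : (1:ℝ) ≤ L := by exact_mod_cast hL
  refine ⟨I → Fin (8 * L ^ 5), inferInstance, fun x i => bin (f i x),
    fun a b => ∑ i : I, e i * val (a i) * val (b i),
    fun x y => w x y - ∑ i ∈ I, e i * f i x * f i y, ?_, ?_, ?_, ?_, hc⟩
  · rw [Fintype.card_fun, Fintype.card_fin, Fintype.card_coe]
    push_cast
    have hI' : I.card ≤ L ^ 2 := by exact_mod_cast hI
    refine pow_le_pow_right₀ ?_ hI'
    have : (1:ℝ) ≤ (L:ℝ) ^ 5 := one_le_pow₀ hL1
    linarith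
  · intro x y
    beta_reduce
    rw [hs x y]
    congr 1
    exact Finset.sum_congr rfl fun i _ => by ring
  · intro x y
    have h1 : |∑ i ∈ I, e i * f i x * f i y| ≤ (L:ℝ) ^ 4 := by
      calc _ ≤ ∑ i ∈ I, |e i * f i x * f i y| := Finset.abs_sum_le_sum_abs _ _
        _ ≤ ∑ i ∈ I, (1 * (L:ℝ) * L) := by
            refine Finset.sum_le_sum fun i hi => ?_
            rw [abs_mul, abs_mul]
            have := he i; have := hf i hi x; have := hf i hi y
            gcongr
        _ = I.card * (L:ℝ) ^ 2 := by rw [Finset.sum_const, nsmul_eq_mul]; ring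
        _ ≤ (L:ℝ) ^ 2 * (L:ℝ) ^ 2 := by gcongr
        _ = _ := by ring
    have h2 : |w x y| ≤ (L:ℝ) ^ 4 := by
      rw [abs_of_nonneg (h01 x y).1]
      exact (h01 x y).2.trans (one_le_pow₀ hL1)
    calc _ ≤ |w x y| + |∑ i ∈ I, e i * f i x * f i y| := abs_sub _ _
      _ ≤ _ := by linarith
  · intro x y
    have : w x y - (w x y - ∑ i ∈ I, e i * f i x * f i y) -
        ∑ i : I, e i * val (bin (f i x)) * val (bin (f i y)) =
        ∑ i : I, e i * (f i x * (f i y - val (bin (f i y))) +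
          val (bin (f i y)) * (f i x - val (bin (f i x)))) := by
      rw [sub_sub_cancel, ← Finset.sum_coe_sort I, ← Finset.sum_sub_distrib]
      exact Finset.sum_congr rfl fun i _ => by ring
    rw [this]
    set δ : ℝ := 1 / (3 * (L:ℝ) ^ 4) with hδ
    have hδ0 : 0 < δ := by positivity
    have hδL : δ ≤ L := by
      have h1 : (1:ℝ) ≤ (L:ℝ) ^ 4 := one_le_pow₀ hL1
      have : δ ≤ 1 := by rw [hδ, div_le_one (by positivity)]; linarith
      linarith
    calc _ ≤ ∑ i : I, |e i * (f i x * (f i y - val (bin (f i y))) +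
          val (bin (f i y)) * (f i x - val (bin (f i x))))| := Finset.abs_sum_le_sum_abs _ _
      _ ≤ ∑ i : I, 1 * (L * δ + (2 * L) * δ) := by
          refine Finset.sum_le_sum fun i _ => ?_
          have a1 := hround _ (hf i i.2 x)
          have a2 := hround _ (hf i i.2 y)
          have a3 := hf i i.2 x
          have a4 : |val (bin (f i y))| ≤ 2 * L := by
            have a5 := hf i i.2 y
            rw [abs_le] at a2 a5 ⊢
            constructor <;> linarith
          rw [abs_mul]
          refine mul_le_mul (he i) ((abs_add_le _ _).trans ?_) (abs_nonneg _) zero_le_one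
          rw [abs_mul, abs_mul]
          gcongr
      _ = I.card * (3 * L * δ) := by simp; ring
      _ ≤ (L:ℝ) ^ 2 * (3 * L * δ) := by gcongr
      _ = 1 / L := by rw [hδ]; field_simp

/-- The probability that the random graph with edge probabilities `p` equals `F`. -/
def graphProb {k : ℕ} (p : Fin k → Fin k → ℝ) (F : SimpleGraph (Fin k)) : ℝ :=
  ∏ e ∈ Finset.univ.filter (fun e : Fin k × Fin k => e.1 < e.2),
    (if F.Adj e.1 e.2 then p e.1 e.2 else 1 - p e.1 e.2)

lemma graphProb_nonneg {k : ℕ} {p : Fin k → Fin k → ℝ} (hp : ∀ i j, p i j ∈ Set.Icc (0:ℝ) 1)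
    (F : SimpleGraph (Fin k)) : 0 ≤ graphProb p F := by
  refine Finset.prod_nonneg fun e _ => ?_
  have := hp e.1 e.2
  split_ifs
  · exact this.1
  · linarith [this.2]

lemma graphProb_le_one {k : ℕ} {p : Fin k → Fin k → ℝ} (hp : ∀ i j, p i j ∈ Set.Icc (0:ℝ) 1)
    (F : SimpleGraph (Fin k)) : graphProb p F ≤ 1 := by
  refine Finset.prod_le_one (fun e _ => ?_) fun e _ => ?_ <;>
  · have := hp e.1 e.2
    split_ifs
    · linarith [this.1, this.2]
    · linarith [this.1, this.2]

/-- Graphs on `Fin k` correspond to sets of increasing pairs. -/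
def graphOfPairs {k : ℕ} (s : Finset (Fin k × Fin k)) : SimpleGraph (Fin k) :=
  SimpleGraph.fromRel fun i j => i < j ∧ (i, j) ∈ s

lemma graphOfPairs_adj {k : ℕ} (s : Finset (Fin k × Fin k)) {i j : Fin k} (h : i < j) :
    (graphOfPairs s).Adj i j ↔ (i, j) ∈ s := by
  simp [graphOfPairs, SimpleGraph.fromRel_adj, h, h.ne, h.not_gt]

lemma sum_graphProb {k : ℕ} (p : Fin k → Fin k → ℝ) : ∑ F, graphProb p F = 1 := by
  set E := Finset.univ.filter (fun e : Fin k × Fin k => e.1 < e.2) with hE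
  have h1 : ∏ e ∈ E, (p e.1 e.2 + (1 - p e.1 e.2)) = 1 := by simp
  rw [Finset.prod_add] at h1
  rw [← h1]
  symm
  refine Finset.sum_bij (fun s _ => graphOfPairs s) (fun _ _ => Finset.mem_univ _) ?_ ?_ ?_
  · intro s hs t ht hst
    ext ⟨i, j⟩
    by_cases hij : i < j
    · rw [← graphOfPairs_adj s hij, ← graphOfPairs_adj t hij]
      exact iff_of_eq (congrArg (fun G : SimpleGraph (Fin k) => G.Adj i j) hst)
    · have h : (i, j) ∉ E := by simp [hE, hij]
      exact iff_of_false (fun hh => h (Finset.mem_powerset.1 hs hh))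
        (fun hh => h (Finset.mem_powerset.1 ht hh))
  · intro F _
    refine ⟨E.filter fun e => F.Adj e.1 e.2, Finset.mem_powerset.2 (Finset.filter_subset _ _), ?_⟩
    ext i j
    rcases lt_trichotomy i j with h | h | h
    · rw [graphOfPairs_adj _ h]; simp [hE, h]
    · subst h; simp
    · rw [SimpleGraph.adj_comm, graphOfPairs_adj _ h, F.adj_comm]; simp [hE, h]
  · intro s hs
    have hsE := Finset.mem_powerset.1 hs
    unfold graphProb
    rw [← hE, ← Finset.prod_sdiff hsE, mul_comm]
    congr 1
    · refine Finset.prod_congr rfl fun e he => ?_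
      have hlt : e.1 < e.2 := (Finset.mem_filter.1 (Finset.mem_sdiff.1 he).1).2
      rw [if_neg]
      rw [graphOfPairs_adj _ hlt]
      exact (Finset.mem_sdiff.1 he).2
    · refine Finset.prod_congr rfl fun e he => ?_
      have hlt : e.1 < e.2 := (Finset.mem_filter.1 (hsE he)).2
      rw [if_pos]
      rw [graphOfPairs_adj _ hlt]
      exact he

/-- The deviation of the adjacency matrix from the edge probabilities. -/
def edgeDev {k : ℕ} (p : Fin k → Fin k → ℝ) (F : SimpleGraph (Fin k)) (i j : Fin k) : ℝ :=
  if i = j then 0 else (if F.Adj i j then 1 else 0) - p i j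

lemma edgeDev_self {k : ℕ} (p : Fin k → Fin k → ℝ) (F : SimpleGraph (Fin k)) (i : Fin k) :
    edgeDev p F i i = 0 := by simp [edgeDev]

lemma edgeDev_symm {k : ℕ} {p : Fin k → Fin k → ℝ} (hs : ∀ i j, p i j = p j i)
    (F : SimpleGraph (Fin k)) (i j : Fin k) : edgeDev p F i j = edgeDev p F j i := by
  unfold edgeDev
  rw [F.adj_comm, hs i j]
  simp only [eq_comm]

lemma abs_edgeDev_le {k : ℕ} {p : Fin k → Fin k → ℝ} (hp : ∀ i j, p i j ∈ Set.Icc (0:ℝ) 1)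
    (F : SimpleGraph (Fin k)) (i j : Fin k) : |edgeDev p F i j| ≤ 1 := by
  have := hp i j
  unfold edgeDev
  rw [abs_le]
  split_ifs <;> constructor <;> linarith [this.1, this.2]

/-- Flip the adjacency of a single pair of vertices. -/
def toggle {k : ℕ} (a b : Fin k) (F : SimpleGraph (Fin k)) : SimpleGraph (Fin k) :=
  symmDiff F (SimpleGraph.edge a b)

lemma toggle_adj {k : ℕ} {a b : Fin k} (hab : a ≠ b) (F : SimpleGraph (Fin k)) (i j : Fin k) :
    (toggle a b F).Adj i j ↔ if s(i, j) = s(a, b) then ¬ F.Adj i j else F.Adj i j := by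
  have hedge : (SimpleGraph.edge a b).Adj i j ↔ s(i, j) = s(a, b) := by
    rw [SimpleGraph.edge_adj, Sym2.eq_iff]
    constructor
    · rintro ⟨h, _⟩; exact h
    · intro h
      refine ⟨h, ?_⟩
      rcases h with ⟨rfl, rfl⟩ | ⟨rfl, rfl⟩
      · exact hab
      · exact hab.symm
  rw [toggle, symmDiff_def, SimpleGraph.sup_adj, SimpleGraph.sdiff_adj, SimpleGraph.sdiff_adj,
    hedge]
  split_ifs with h <;> tauto

/-- A deviation has conditional mean zero given the rest of the graph. -/
lemma sum_graphProb_mul_edgeDev {k : ℕ} {p : Fin k → Fin k → ℝ} (hs : ∀ i j, p i j = p j i)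
    {a b : Fin k} (hab : a ≠ b) (Y : SimpleGraph (Fin k) → ℝ)
    (hY : ∀ F, Y (toggle a b F) = Y F) :
    ∑ F, graphProb p F * (edgeDev p F a b * Y F) = 0 := by
  wlog hlt : a < b generalizing a b
  · have hsw : ∀ F, toggle b a F = toggle a b F := by
      intro F
      ext i j
      rw [toggle_adj hab, toggle_adj hab.symm, Sym2.eq_swap (a := a)]
    have := this hab.symm (fun F => by rw [hsw, hY]) (lt_of_le_of_ne (not_lt.1 hlt) hab.symm)
    simpa only [edgeDev_symm hs _ b a] using this
  refine Finset.sum_involution (fun F _ => toggle a b F) ?_ ?_ (fun _ _ => Finset.mem_univ _) ?_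
  · intro F _
    rw [hY F]
    set E := Finset.univ.filter (fun e : Fin k × Fin k => e.1 < e.2) with hE
    have hmem : (a, b) ∈ E := by simp [hE, hlt]
    have hfac : ∀ G : SimpleGraph (Fin k), graphProb p G =
        (if G.Adj a b then p a b else 1 - p a b) *
        ∏ e ∈ E.erase (a, b), (if G.Adj e.1 e.2 then p e.1 e.2 else 1 - p e.1 e.2) := by
      intro G
      rw [Finset.mul_prod_erase E (fun e => if G.Adj e.1 e.2 then p e.1 e.2 else 1 - p e.1 e.2)
        hmem]
      rfl
    have hrest : ∏ e ∈ E.erase (a, b),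
          (if (toggle a b F).Adj e.1 e.2 then p e.1 e.2 else 1 - p e.1 e.2) =
        ∏ e ∈ E.erase (a, b), (if F.Adj e.1 e.2 then p e.1 e.2 else 1 - p e.1 e.2) := by
      refine Finset.prod_congr rfl fun e he => ?_
      have hne : s(e.1, e.2) ≠ s(a, b) := by
        intro h
        have hlt' : e.1 < e.2 := (Finset.mem_filter.1 (Finset.mem_erase.1 he).2).2
        rcases Sym2.eq_iff.1 h with ⟨h1, h2⟩ | ⟨h1, h2⟩
        · exact (Finset.mem_erase.1 he).1 (Prod.ext h1 h2)
        · rw [h1, h2] at hlt'; exact absurd hlt hlt'.not_gt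
      have := toggle_adj hab F e.1 e.2
      rw [if_neg hne] at this
      simp only [this]
    have hadj : (toggle a b F).Adj a b ↔ ¬ F.Adj a b := by
      have := toggle_adj hab F a b
      rwa [if_pos rfl] at this
    rw [hfac F, hfac (toggle a b F), hrest]
    unfold edgeDev
    simp only [hadj, if_neg hab]
    by_cases h : F.Adj a b
    · simp only [h, not_true, if_true, if_false]; ring
    · simp only [h, not_false_iff, if_true, if_false]; ring
  · intro F _ _ h
    have hadj : (toggle a b F).Adj a b ↔ ¬ F.Adj a b := by
      have := toggle_adj hab F a b
      rwa [if_pos rfl] at this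
    rw [h] at hadj
    tauto
  · intro F _
    exact symmDiff_symmDiff_cancel_right _ _

lemma edgeDev_toggle {k : ℕ} (p : Fin k → Fin k → ℝ) {a b i j : Fin k} (hab : a ≠ b)
    (h : s(i, j) ≠ s(a, b)) (F : SimpleGraph (Fin k)) :
    edgeDev p (toggle a b F) i j = edgeDev p F i j := by
  have := toggle_adj hab F i j
  rw [if_neg h] at this
  simp only [edgeDev, this]

/-- The sum over four-cycles of the products of the deviations. -/
def c4 {k : ℕ} (p : Fin k → Fin k → ℝ) (F : SimpleGraph (Fin k)) : ℝ :=
  ∑ j, ∑ j', (∑ i, edgeDev p F i j * edgeDev p F i j') ^ 2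

lemma c4_nonneg {k : ℕ} (p : Fin k → Fin k → ℝ) (F : SimpleGraph (Fin k)) : 0 ≤ c4 p F := by
  unfold c4
  positivity

lemma sum_graphProb_mul_c4_le {k : ℕ} {p : Fin k → Fin k → ℝ} (hs : ∀ i j, p i j = p j i)
    (hp : ∀ i j, p i j ∈ Set.Icc (0:ℝ) 1) : ∑ F, graphProb p F * c4 p F ≤ 2 * (k:ℝ) ^ 3 := by
  have hexp : ∑ F, graphProb p F * c4 p F = ∑ j, ∑ j', ∑ i, ∑ i', ∑ F, graphProb p F *
      (edgeDev p F i j * (edgeDev p F i j' * edgeDev p F i' j * edgeDev p F i' j')) := by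
    have : ∀ F, graphProb p F * c4 p F = ∑ j, ∑ j', ∑ i, ∑ i', graphProb p F *
      (edgeDev p F i j * (edgeDev p F i j' * edgeDev p F i' j * edgeDev p F i' j')) := by
      intro F
      unfold c4
      simp only [sq, Finset.sum_mul_sum]
      simp only [Finset.mul_sum]
      refine Finset.sum_congr rfl fun j _ => Finset.sum_congr rfl fun j' _ =>
        Finset.sum_congr rfl fun i _ => Finset.sum_congr rfl fun i' _ => by ring
    simp only [this]
    rw [Finset.sum_comm]
    refine Finset.sum_congr rfl fun j _ => ?_
    rw [Finset.sum_comm]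
    refine Finset.sum_congr rfl fun j' _ => ?_
    rw [Finset.sum_comm]
    refine Finset.sum_congr rfl fun i _ => ?_
    rw [Finset.sum_comm]
  have hterm : ∀ j j' i i' : Fin k, ∑ F, graphProb p F *
      (edgeDev p F i j * (edgeDev p F i j' * edgeDev p F i' j * edgeDev p F i' j')) ≤
      (if i = i' then (1:ℝ) else 0) + (if j = j' then (1:ℝ) else 0) := by
    intro j j' i i'
    by_cases hd : i = i' ∨ j = j'
    · have h1 : (1:ℝ) ≤ (if i = i' then (1:ℝ) else 0) + (if j = j' then (1:ℝ) else 0) := by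
        rcases hd with h | h <;> simp only [h, if_true] <;> split_ifs <;> norm_num
      refine le_trans ?_ h1
      rw [← sum_graphProb p]
      refine Finset.sum_le_sum fun F _ => mul_le_of_le_one_right (graphProb_nonneg hp F) ?_
      refine (le_abs_self _).trans ?_
      simp only [abs_mul]
      have := abs_edgeDev_le hp F
      exact mul_le_one₀ (this _ _) (by positivity) (mul_le_one₀ (mul_le_one₀ (this _ _)
        (abs_nonneg _) (this _ _)) (abs_nonneg _) (this _ _))
    · push Not at hd
      obtain ⟨hii, hjj⟩ := hd
      rw [if_neg hii, if_neg hjj, add_zero]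
      apply le_of_eq
      by_cases h1 : i = j
      · subst h1; simp [edgeDev_self]
      by_cases h2 : i = j'
      · subst h2; simp [edgeDev_self]
      by_cases h3 : i' = j
      · subst h3; simp [edgeDev_self]
      refine sum_graphProb_mul_edgeDev hs h1 _ fun F => ?_
      rw [edgeDev_toggle p h1, edgeDev_toggle p h1, edgeDev_toggle p h1]
      all_goals
        rw [Ne, Sym2.eq_iff]
        grind
  rw [hexp]
  calc _ ≤ ∑ j : Fin k, ∑ j' : Fin k, ∑ i : Fin k, ∑ i' : Fin k,
        ((if i = i' then (1:ℝ) else 0) + (if j = j' then (1:ℝ) else 0)) :=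
        Finset.sum_le_sum fun j _ => Finset.sum_le_sum fun j' _ => Finset.sum_le_sum fun i _ =>
          Finset.sum_le_sum fun i' _ => hterm j j' i i'
    _ = 2 * (k:ℝ) ^ 3 := by
        simp [Finset.sum_add_distrib]
        ring

lemma bilin_edgeDev_pow_four_le {k : ℕ} (p : Fin k → Fin k → ℝ) (F : SimpleGraph (Fin k))
    (a b : Fin k → ℝ) (ha : ∀ i, |a i| ≤ 1) (hb : ∀ i, |b i| ≤ 1) :
    (∑ i, ∑ j, a i * b j * edgeDev p F i j) ^ 4 ≤ (k:ℝ) ^ 4 * c4 p F := by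
  set X := edgeDev p F
  have hsq : ∀ u : Fin k → ℝ, (∀ i, |u i| ≤ 1) → ∀ i, u i ^ 2 ≤ 1 := fun u hu i =>
    (sq_le_one_iff_abs_le_one _).2 (hu i)
  have h1 : (∑ i, ∑ j, a i * b j * X i j) ^ 2 ≤ k * ∑ i, (∑ j, b j * X i j) ^ 2 := by
    have e : ∑ i, ∑ j, a i * b j * X i j = ∑ i, a i * ∑ j, b j * X i j := by
      simp only [Finset.mul_sum, mul_assoc]
    rw [e]
    refine (Finset.sum_mul_sq_le_sq_mul_sq _ _ _).trans ?_
    gcongr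
    calc ∑ i, a i ^ 2 ≤ ∑ i : Fin k, (1:ℝ) := Finset.sum_le_sum fun i _ => hsq a ha i
      _ = k := by simp
  have h2 : ∑ i, (∑ j, b j * X i j) ^ 2 = ∑ q : Fin k × Fin k,
      (b q.1 * b q.2) * ∑ i, X i q.1 * X i q.2 := by
    rw [Fintype.sum_prod_type]
    simp only [sq, Finset.sum_mul_sum]
    simp only [Finset.mul_sum]
    rw [Finset.sum_comm]
    refine Finset.sum_congr rfl fun j _ => ?_
    rw [Finset.sum_comm]
    refine Finset.sum_congr rfl fun j' _ => Finset.sum_congr rfl fun i _ => by ring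
  have h3 : (∑ i, (∑ j, b j * X i j) ^ 2) ^ 2 ≤ (k:ℝ) ^ 2 * c4 p F := by
    rw [h2]
    refine (Finset.sum_mul_sq_le_sq_mul_sq _ _ _).trans ?_
    have : ∑ q : Fin k × Fin k, (∑ i, X i q.1 * X i q.2) ^ 2 = c4 p F := by
      rw [Fintype.sum_prod_type]; rfl
    rw [this]
    gcongr
    · exact c4_nonneg p F
    calc ∑ q : Fin k × Fin k, (b q.1 * b q.2) ^ 2 ≤ ∑ q : Fin k × Fin k, (1:ℝ) := by
          refine Finset.sum_le_sum fun q _ => ?_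
          rw [mul_pow]
          exact mul_le_one₀ (hsq b hb _) (sq_nonneg _) (hsq b hb _)
      _ = (k:ℝ) ^ 2 := by simp [sq]
  calc _ = ((∑ i, ∑ j, a i * b j * X i j) ^ 2) ^ 2 := by ring
    _ ≤ (k * ∑ i, (∑ j, b j * X i j) ^ 2) ^ 2 := by gcongr
    _ = (k:ℝ) ^ 2 * (∑ i, (∑ j, b j * X i j) ^ 2) ^ 2 := by ring
    _ ≤ (k:ℝ) ^ 2 * ((k:ℝ) ^ 2 * c4 p F) := by gcongr
    _ = _ := by ring

/-- A bijection between two finite sets of equal size that respects the ranks of two functions. -/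
lemma exists_monotone_matching {X Y : Type} [Fintype X] [Fintype Y] (f : X → ℕ) (g : Y → ℕ)
    (h : Fintype.card X = Fintype.card Y) :
    ∃ e : X ≃ Y, ∀ x,
      (Finset.univ.filter fun x' => f x' < f x).card <
        (Finset.univ.filter fun y' => g y' ≤ g (e x)).card ∧
      (Finset.univ.filter fun y' => g y' < g (e x)).card <
        (Finset.univ.filter fun x' => f x' ≤ f x).card := by
  let eX := Fintype.equivFin X
  let eY := (Fintype.equivFin Y).trans (finCongr h.symm)
  let a := (Tuple.sort (f ∘ eX.symm)).trans eX.symm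
  let b := (Tuple.sort (g ∘ eY.symm)).trans eY.symm
  have ha : Monotone (f ∘ a) := Tuple.monotone_sort (f ∘ eX.symm)
  have hb : Monotone (g ∘ b) := Tuple.monotone_sort (g ∘ eY.symm)
  have key : ∀ {X Y : Type} [Fintype X] [Fintype Y] {N : ℕ} (f : X → ℕ) (g : Y → ℕ)
      (a : Fin N ≃ X) (b : Fin N ≃ Y), Monotone (f ∘ a) → Monotone (g ∘ b) → ∀ j,
      (Finset.univ.filter fun x' => f x' < f (a j)).card <
        (Finset.univ.filter fun y' => g y' ≤ g (b j)).card := by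
    intro X Y _ _ N f g a b ha hb j
    have h1 : (Finset.univ.filter fun x' => f x' < f (a j)) ⊆ (Finset.Iio j).map a.toEmbedding := by
      intro x hx
      rw [Finset.mem_map]
      refine ⟨a.symm x, ?_, by simp⟩
      rw [Finset.mem_Iio]
      by_contra hc
      have := ha (not_lt.1 hc)
      simp only [Function.comp, Equiv.apply_symm_apply] at this
      exact absurd (Finset.mem_filter.1 hx).2 (not_lt.2 this)
    have h2 : (Finset.Iic j).map b.toEmbedding ⊆
        (Finset.univ.filter fun y' => g y' ≤ g (b j)) := by
      intro y hy
      obtain ⟨i, hi, rfl⟩ := Finset.mem_map.1 hy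
      exact Finset.mem_filter.2 ⟨Finset.mem_univ _, hb (Finset.mem_Iic.1 hi)⟩
    have h3 := Finset.card_le_card h1
    have h4 := Finset.card_le_card h2
    simp only [Finset.card_map, Fin.card_Iio, Fin.card_Iic] at h3 h4
    omega
  refine ⟨a.symm.trans b, fun x => ?_⟩
  obtain ⟨j, rfl⟩ := a.surjective x
  simp only [Equiv.trans_apply, Equiv.symm_apply_apply]
  exact ⟨key f g a b ha hb j, key g f b a hb ha j⟩

/-- Slots `(r, t)` can be placed injectively on points of the same class, with few slots lost. -/
lemma exists_slot_placement {V α : Type} [Fintype V] [Nonempty V] [Fintype α] (P : V → α)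
    {k : ℕ} (p : Fin k → α) (m : ℕ) (hk : 0 < k) (hmk : m * k ≤ Fintype.card V) (κ : ℝ)
    (hκ : ∑ i, |((Finset.univ.filter fun r => p r = i).card : ℝ) -
      k * (Finset.univ.filter fun x => P x = i).card / Fintype.card V| ≤ κ * k) :
    ∃ (S : Finset (Fin k × Fin m)) (φ : Fin k × Fin m → V), Set.InjOn φ S ∧
      (∀ s ∈ S, P (φ s) = p s.1) ∧ (Sᶜ.card : ℝ) ≤ κ * Fintype.card V := by
  set n : ℝ := (Fintype.card V : ℝ) with hn
  have hn0 : 0 < n := by rw [hn]; exact_mod_cast Fintype.card_pos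
  let X : α → Finset (Fin k × Fin m) := fun i => Finset.univ.filter fun s => p s.1 = i
  let Y : α → Finset V := fun i => Finset.univ.filter fun x => P x = i
  have hX : ∀ i, (X i).card = (Finset.univ.filter fun r => p r = i).card * m := by
    intro i
    have : X i = (Finset.univ.filter fun r => p r = i) ×ˢ (Finset.univ : Finset (Fin m)) := by
      ext ⟨r, t⟩; simp [X]
    rw [this, Finset.card_product, Finset.card_univ, Fintype.card_fin]
  have hex : ∀ i, ∃ (T : Finset (Fin k × Fin m)) (g : Fin k × Fin m → V), T ⊆ X i ∧
      T.card = min (X i).card (Y i).card ∧ Set.InjOn g T ∧ ∀ s ∈ T, g s ∈ Y i := by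
    intro i
    obtain ⟨T, hT, hTc⟩ := Finset.exists_subset_card_eq (min_le_left (X i).card (Y i).card)
    obtain ⟨T', hT', hTc'⟩ := Finset.exists_subset_card_eq (min_le_right (X i).card (Y i).card)
    let e := Finset.equivOfCardEq (hTc.trans hTc'.symm)
    refine ⟨T, fun s => if h : s ∈ T then (e ⟨s, h⟩ : V) else Classical.arbitrary V, hT, hTc,
      ?_, ?_⟩
    · intro s hs t ht hst
      have hs' : s ∈ T := hs
      have ht' : t ∈ T := ht
      simp only [dif_pos hs', dif_pos ht'] at hst
      have := e.injective (Subtype.ext hst)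
      exact congrArg Subtype.val this
    · intro s hs
      simp only [dif_pos hs]
      exact hT' (e ⟨s, hs⟩).2
  choose T g hTX hTc hg hgY using hex
  refine ⟨Finset.univ.filter fun s => s ∈ T (p s.1), fun s => g (p s.1) s, ?_, ?_, ?_⟩
  · intro s hs t ht hst
    have hs' : s ∈ T (p s.1) := (Finset.mem_filter.1 hs).2
    have ht' : t ∈ T (p t.1) := (Finset.mem_filter.1 ht).2
    have h1 := (Finset.mem_filter.1 (hgY _ _ hs')).2
    have h2 := (Finset.mem_filter.1 (hgY _ _ ht')).2
    simp only at hst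
    have h3 : p s.1 = p t.1 := by rw [← h1, ← h2, hst]
    rw [← h3] at ht' hst
    exact hg _ hs' ht' hst
  · intro s hs
    exact (Finset.mem_filter.1 (hgY _ _ (Finset.mem_filter.1 hs).2)).2
  · have hcomp : (Finset.univ.filter fun s => s ∈ T (p s.1))ᶜ ⊆
        Finset.univ.biUnion fun i => X i \ T i := by
      intro s hs
      simp only [Finset.mem_compl, Finset.mem_filter, Finset.mem_univ, true_and] at hs
      simp only [Finset.mem_biUnion, Finset.mem_univ, true_and, Finset.mem_sdiff]
      exact ⟨p s.1, by simp [X], hs⟩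
    have h1 : ((Finset.univ.filter fun s => s ∈ T (p s.1))ᶜ.card : ℝ) ≤
        ∑ i, ((X i \ T i).card : ℝ) := by
      exact_mod_cast (Finset.card_le_card hcomp).trans Finset.card_biUnion_le
    refine h1.trans ?_
    have h2 : ∀ i, ((X i \ T i).card : ℝ) ≤
        m * |((Finset.univ.filter fun r => p r = i).card : ℝ) -
          k * (Finset.univ.filter fun x => P x = i).card / n| := by
      intro i
      have hc := Finset.card_sdiff_add_card_eq_card (hTX i)
      rw [hTc] at hc
      rcases le_total (X i).card (Y i).card with h | h
      · rw [min_eq_left h] at hc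
        have : (X i \ T i).card = 0 := by omega
        rw [this]
        simp only [Nat.cast_zero]
        positivity
      · rw [min_eq_right h] at hc
        have hc' : ((X i \ T i).card : ℝ) + (Y i).card = (X i).card := by exact_mod_cast hc
        rw [hX] at hc'
        push_cast at hc'
        set d : ℝ := ((Finset.univ.filter fun r => p r = i).card : ℝ)
        have hmk' : (m:ℝ) * k ≤ n := by rw [hn]; exact_mod_cast hmk
        have hy : (m:ℝ) * (k * (Y i).card / n) ≤ (Y i).card := by
          have : (m:ℝ) * (k * (Y i).card / n) = (m * k) / n * (Y i).card := by ring
          rw [this]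
          exact mul_le_of_le_one_left (by positivity) ((div_le_one hn0).2 hmk')
        calc ((X i \ T i).card : ℝ) ≤ m * (d - k * (Y i).card / n) := by linarith
          _ ≤ _ := by gcongr; exact le_abs_self _
    calc _ ≤ ∑ i, m * |((Finset.univ.filter fun r => p r = i).card : ℝ) -
          k * (Finset.univ.filter fun x => P x = i).card / n| := Finset.sum_le_sum fun i _ => h2 i
      _ ≤ m * (κ * k) := by rw [← Finset.mul_sum]; gcongr
      _ = κ * (m * k) := by ring
      _ ≤ κ * n := by
        have hκ0 : 0 ≤ κ * k := le_trans (Finset.sum_nonneg fun i _ => abs_nonneg _) hκ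
        have hk' : (0:ℝ) < k := by exact_mod_cast hk
        have hκ0 : 0 ≤ κ := nonneg_of_mul_nonneg_left hκ0 hk'
        gcongr
        rw [hn]; exact_mod_cast hmk

/-- The number of indices in an initial segment of the position intervals is close to its
expected value. -/
lemma abs_card_lt_sub_le {V α : Type} [Fintype V] [Fintype α] (P : V → α) (iA : α → ℕ)
    {k : ℕ} (p : Fin k → α) (κ : ℝ)
    (hκ : ∑ i, |((Finset.univ.filter fun r => p r = i).card : ℝ) -
      k * (Finset.univ.filter fun x => P x = i).card / Fintype.card V| ≤ κ * k) (a : ℕ) :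
    |((Finset.univ.filter fun r => iA (p r) < a).card : ℝ) -
      k * (Finset.univ.filter fun x => iA (P x) < a).card / Fintype.card V| ≤ κ * k := by
  have h1 : ∀ {X : Type} [Fintype X] (f : X → α),
      ((Finset.univ.filter fun r => iA (f r) < a).card : ℝ) =
      ∑ i ∈ Finset.univ.filter (fun i => iA i < a),
        ((Finset.univ.filter fun r => f r = i).card : ℝ) := by
    intro X _ f
    rw [Finset.card_eq_sum_card_fiberwise (f := f) (t := Finset.univ.filter (fun i => iA i < a))
      (fun r hr => by simpa using hr)]
    push_cast
    refine Finset.sum_congr rfl fun i hi => ?_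
    congr 2
    ext r
    simp only [Finset.mem_filter, Finset.mem_univ, true_and] at hi ⊢
    constructor
    · rintro ⟨_, h⟩; exact h
    · rintro rfl; exact ⟨hi, rfl⟩
  rw [h1 p, h1 P, Finset.mul_sum, Finset.sum_div, ← Finset.sum_sub_distrib]
  refine (Finset.abs_sum_le_sum_abs _ _).trans (le_trans ?_ hκ)
  exact Finset.sum_le_sum_of_subset_of_nonneg (Finset.subset_univ _) fun i _ _ => abs_nonneg _

/-- The number of points of an initial segment of the position intervals that are not covered by
a slot placement. -/
lemma card_uncovered_bounds {V α : Type} [Fintype V] [Nonempty V] [Fintype α] (P : V → α)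
    (iA : α → ℕ) {k m L : ℕ} (p : Fin k → α) (hmk : m * k ≤ Fintype.card V) (hk : 0 < k) (κ : ℝ)
    (hκ : ∑ i, |((Finset.univ.filter fun r => p r = i).card : ℝ) -
      k * (Finset.univ.filter fun x => P x = i).card / Fintype.card V| ≤ κ * k)
    (S : Finset (Fin k × Fin m)) (φ : Fin k × Fin m → V) (hφ : Set.InjOn φ S)
    (hP : ∀ s ∈ S, P (φ s) = p s.1) (hS : (Sᶜ.card : ℝ) ≤ 2 * κ * Fintype.card V) (a : ℕ)
    (ha : ((Finset.univ.filter fun x => iA (P x) < a).card : ℝ) = Fintype.card V * (a / L)) :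
    (Fintype.card V - m * k) * (a / L) - κ * Fintype.card V ≤
      ((Finset.univ.filter fun x => x ∉ S.image φ ∧ iA (P x) < a).card : ℝ) ∧
    ((Finset.univ.filter fun x => x ∉ S.image φ ∧ iA (P x) < a).card : ℝ) ≤
      (Fintype.card V - m * k) * (a / L) + 3 * κ * Fintype.card V := by
  have hc := abs_card_lt_sub_le P iA p κ hκ a
  set n : ℝ := (Fintype.card V : ℝ) with hn
  have hn0 : 0 < n := by rw [hn]; exact_mod_cast Fintype.card_pos
  have hmk' : (m:ℝ) * k ≤ n := by rw [hn]; exact_mod_cast hmk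
  have hk' : (0:ℝ) < k := by exact_mod_cast hk
  have hκ0 : 0 ≤ κ := nonneg_of_mul_nonneg_left ((abs_nonneg _).trans hc) hk'
  have e1 : (Finset.univ.filter fun x => x ∉ S.image φ ∧ iA (P x) < a).card +
      (S.filter fun s => iA (p s.1) < a).card =
      (Finset.univ.filter fun x => iA (P x) < a).card := by
    have himg : (Finset.univ.filter fun x => x ∈ S.image φ ∧ iA (P x) < a) =
        (S.filter fun s => iA (p s.1) < a).image φ := by
      ext x
      simp only [Finset.mem_filter, Finset.mem_univ, true_and, Finset.mem_image]
      constructor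
      · rintro ⟨⟨s, hs, rfl⟩, h⟩
        exact ⟨s, ⟨hs, by rwa [← hP s hs]⟩, rfl⟩
      · rintro ⟨s, ⟨hs, h⟩, rfl⟩
        exact ⟨⟨s, hs, rfl⟩, by rwa [hP s hs]⟩
    rw [← Finset.card_image_of_injOn (s := S.filter fun s => iA (p s.1) < a)
      (hφ.mono (Finset.filter_subset _ _)), ← himg, ← Finset.card_union_of_disjoint]
    · congr 1
      ext x
      simp only [Finset.mem_union, Finset.mem_filter, Finset.mem_univ, true_and]
      tauto
    · rw [Finset.disjoint_filter]
      tauto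
  have e2 : (S.filter fun s => iA (p s.1) < a).card +
      (Sᶜ.filter fun s => iA (p s.1) < a).card =
      (Finset.univ.filter fun r => iA (p r) < a).card * m := by
    rw [← Finset.card_union_of_disjoint, ← Finset.filter_union, Finset.union_compl]
    · have : (Finset.univ.filter fun s : Fin k × Fin m => iA (p s.1) < a) =
          (Finset.univ.filter fun r => iA (p r) < a) ×ˢ (Finset.univ : Finset (Fin m)) := by
        ext ⟨r, t⟩; simp
      rw [this, Finset.card_product, Finset.card_univ, Fintype.card_fin]
    · exact Finset.disjoint_filter_filter disjoint_compl_right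
  have e3 : (Sᶜ.filter fun s => iA (p s.1) < a).card ≤ Sᶜ.card :=
    Finset.card_le_card (Finset.filter_subset _ _)
  have e1' : ((Finset.univ.filter fun x => x ∉ S.image φ ∧ iA (P x) < a).card : ℝ) +
      (S.filter fun s => iA (p s.1) < a).card = n * (a / L) := by
    rw [← ha]; exact_mod_cast e1
  have e2' : ((S.filter fun s => iA (p s.1) < a).card : ℝ) +
      (Sᶜ.filter fun s => iA (p s.1) < a).card =
      (Finset.univ.filter fun r => iA (p r) < a).card * m := by exact_mod_cast e2
  have e3' : ((Sᶜ.filter fun s => iA (p s.1) < a).card : ℝ) ≤ 2 * κ * n :=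
    le_trans (by exact_mod_cast e3) hS
  have e4 : (0:ℝ) ≤ ((Sᶜ.filter fun s => iA (p s.1) < a).card : ℝ) := by positivity
  rw [ha] at hc
  have hc' : |((Finset.univ.filter fun r => iA (p r) < a).card : ℝ) * m - m * k * (a / L)| ≤
      κ * n := by
    have : ((Finset.univ.filter fun r => iA (p r) < a).card : ℝ) * m - m * k * (a / L) =
        m * (((Finset.univ.filter fun r => iA (p r) < a).card : ℝ) - k * (n * (a / L)) / n) := by
      field_simp
    rw [this, abs_mul, abs_of_nonneg (show (0:ℝ) ≤ m by positivity)]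
    calc _ ≤ (m:ℝ) * (κ * k) := by gcongr
      _ = κ * (m * k) := by ring
      _ ≤ _ := by gcongr
  rw [abs_le] at hc'
  constructor <;> nlinarith [hc'.1, hc'.2]

/-- The `r`-th sampled positions of two samplings nearly agree. -/
lemma sampled_position_le {V α β : Type} [Fintype V] [Nonempty V] [Fintype α] [Fintype β]
    (P : V → α) (Q : V → β) (iA : α → ℕ) (iB : β → ℕ) {k L : ℕ} (hL : 0 < L) (hk : 0 < k)
    (hA : ∀ a ≤ L, ((Finset.univ.filter fun x => iA (P x) < a).card : ℝ) =
      Fintype.card V * (a / L))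
    (hB : ∀ a ≤ L, ((Finset.univ.filter fun x => iB (Q x) < a).card : ℝ) =
      Fintype.card V * (a / L))
    (p : Fin k → α) (q : Fin k → β)
    (hp : ∀ r s, r ≤ s → iA (p r) ≤ iA (p s)) (hq : ∀ r s, r ≤ s → iB (q r) ≤ iB (q s))
    (hpr : ∀ r, iA (p r) < L) (hqr : ∀ r, iB (q r) < L) (κ : ℝ)
    (hκp : ∑ i, |((Finset.univ.filter fun r => p r = i).card : ℝ) -
      k * (Finset.univ.filter fun x => P x = i).card / Fintype.card V| ≤ κ * k)
    (hκq : ∑ i, |((Finset.univ.filter fun r => q r = i).card : ℝ) -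
      k * (Finset.univ.filter fun x => Q x = i).card / Fintype.card V| ≤ κ * k)
    (hsmall : 2 * κ * L ≤ 1) (r : Fin k) : iA (p r) ≤ iB (q r) + 1 := by
  have h1 := abs_card_lt_sub_le P iA p κ hκp (iA (p r))
  have h2 := abs_card_lt_sub_le Q iB q κ hκq (iB (q r) + 1)
  rw [hA _ (hpr r).le] at h1
  rw [hB _ (hqr r)] at h2
  have hn0 : (0:ℝ) < Fintype.card V := by exact_mod_cast Fintype.card_pos
  have hk' : (0:ℝ) < k := by exact_mod_cast hk
  have hL' : (0:ℝ) < L := by exact_mod_cast hL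
  have c1 : (Finset.univ.filter fun s => iA (p s) < iA (p r)).card ≤ r := by
    rw [← Fin.card_Iio]
    refine Finset.card_le_card fun s hs => ?_
    rw [Finset.mem_Iio]
    by_contra hc
    exact absurd (hp _ _ (not_lt.1 hc)) (not_le.2 (Finset.mem_filter.1 hs).2)
  have c2 : (r : ℕ) + 1 ≤ (Finset.univ.filter fun s => iB (q s) < iB (q r) + 1).card := by
    rw [← Fin.card_Iic]
    refine Finset.card_le_card fun s hs => ?_
    exact Finset.mem_filter.2 ⟨Finset.mem_univ _, Nat.lt_succ_of_le (hq _ _ (Finset.mem_Iic.1 hs))⟩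
  have c1' : ((Finset.univ.filter fun s => iA (p s) < iA (p r)).card : ℝ) ≤ (r : ℕ) := by
    exact_mod_cast c1
  have c2' : ((r : ℕ) : ℝ) + 1 ≤ (Finset.univ.filter fun s => iB (q s) < iB (q r) + 1).card := by
    exact_mod_cast c2
  rw [mul_left_comm, mul_div_cancel_left₀ _ hn0.ne', abs_le] at h1 h2
  by_contra hc
  have hc' : (iB (q r) : ℝ) + 2 ≤ iA (p r) := by exact_mod_cast not_le.1 hc
  have h3 : (k:ℝ) * (iA (p r) / L) - κ * k < k * ((iB (q r) + 1 : ℕ) / L) + κ * k := by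
    linarith [h1.1, h2.2]
  have h4 : (iA (p r) : ℝ) / L < ((iB (q r) + 1 : ℕ) : ℝ) / L + 2 * κ := by
    by_contra hh
    nlinarith [not_lt.1 hh]
  rw [div_add' _ _ _ hL'.ne', div_lt_div_iff_of_pos_right hL'] at h4
  push_cast at h4
  linarith

/-- Uncovered points of comparable ranks have nearly the same position. -/
lemma uncovered_position_le {V α β : Type} [Fintype V] [Nonempty V] [Fintype α] [Fintype β]
    (P : V → α) (Q : V → β) (iA : α → ℕ) (iB : β → ℕ) {k m L : ℕ} (hL : 0 < L) (hk : 0 < k)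
    (hA : ∀ a ≤ L, ((Finset.univ.filter fun x => iA (P x) < a).card : ℝ) =
      Fintype.card V * (a / L))
    (hB : ∀ a ≤ L, ((Finset.univ.filter fun x => iB (Q x) < a).card : ℝ) =
      Fintype.card V * (a / L))
    (p : Fin k → α) (q : Fin k → β) (hmk : m * k ≤ Fintype.card V) (κ : ℝ)
    (hκp : ∑ i, |((Finset.univ.filter fun r => p r = i).card : ℝ) -
      k * (Finset.univ.filter fun x => P x = i).card / Fintype.card V| ≤ κ * k)
    (hκq : ∑ i, |((Finset.univ.filter fun r => q r = i).card : ℝ) -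
      k * (Finset.univ.filter fun x => Q x = i).card / Fintype.card V| ≤ κ * k)
    (hsmall : 6 * κ * L * Fintype.card V ≤ Fintype.card V - m * k)
    (S : Finset (Fin k × Fin m)) (φ ψ : Fin k × Fin m → V) (hφ : Set.InjOn φ S)
    (hψ : Set.InjOn ψ S) (hP : ∀ s ∈ S, P (φ s) = p s.1) (hQ : ∀ s ∈ S, Q (ψ s) = q s.1)
    (hS : (Sᶜ.card : ℝ) ≤ 2 * κ * Fintype.card V) (x y : V) (hx : iA (P x) < L)
    (hy : iB (Q y) < L)
    (hxy : (Finset.univ.filter fun x' => x' ∉ S.image φ ∧ iA (P x') < iA (P x)).card <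
      (Finset.univ.filter fun y' => y' ∉ S.image ψ ∧ iB (Q y') < iB (Q y) + 1).card) :
    iA (P x) ≤ iB (Q y) + 1 := by
  have h1 := (card_uncovered_bounds P iA p hmk hk κ hκp S φ hφ hP hS _ (hA _ hx.le)).1
  have h2 := (card_uncovered_bounds Q iB q hmk hk κ hκq S ψ hψ hQ hS _ (hB _ hy)).2
  have hn0 : (0:ℝ) < Fintype.card V := by exact_mod_cast Fintype.card_pos
  have hL' : (0:ℝ) < L := by exact_mod_cast hL
  have hk' : (0:ℝ) < k := by exact_mod_cast hk
  have hκ0 : 0 ≤ κ :=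
    nonneg_of_mul_nonneg_left ((Finset.sum_nonneg fun i _ => abs_nonneg _).trans hκp) hk'
  have h3 : ((Finset.univ.filter fun x' => x' ∉ S.image φ ∧ iA (P x') < iA (P x)).card : ℝ) <
      (Finset.univ.filter fun y' => y' ∉ S.image ψ ∧ iB (Q y') < iB (Q y) + 1).card := by
    exact_mod_cast hxy
  set n : ℝ := (Fintype.card V : ℝ)
  by_contra hc
  have hc' : (iB (Q y) : ℝ) + 2 ≤ iA (P x) := by exact_mod_cast not_le.1 hc
  have h4 : (n - m * k) * (iA (P x) / L) - κ * n <
      (n - m * k) * ((iB (Q y) + 1 : ℕ) / L) + 3 * κ * n := by linarith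
  have h5 : (n - m * k) * (iA (P x) - (iB (Q y) + 1)) < 4 * κ * n * L := by
    have : (n - m * k) * (iA (P x) / L) - (n - m * k) * ((iB (Q y) + 1 : ℕ) / L) =
      (n - m * k) * (iA (P x) - (iB (Q y) + 1)) / L := by push_cast; field_simp
    rw [← div_lt_iff₀ hL', ← this]
    linarith
  have h6 : 0 ≤ κ * L * n := by positivity
  nlinarith

/-- Two samplings of the same size induce a rearrangement of the points that respects the classes
of most points and nearly respects the position of every point. -/
lemma exists_class_matching {V α β : Type} [Fintype V] [Nonempty V] [Fintype α] [Fintype β]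
    (P : V → α) (Q : V → β) (iA : α → ℕ) (iB : β → ℕ) (pos : V → ℕ)
    (hiA : ∀ x, iA (P x) = pos x) (hiB : ∀ x, iB (Q x) = pos x)
    {k m L : ℕ} (hL : 0 < L) (hk : 0 < k) (hpos : ∀ x, pos x < L)
    (hunif : ∀ a ≤ L, ((Finset.univ.filter fun x => pos x < a).card : ℝ) =
      Fintype.card V * (a / L))
    (p : Fin k → α) (q : Fin k → β)
    (hp : ∀ r s, r ≤ s → iA (p r) ≤ iA (p s)) (hq : ∀ r s, r ≤ s → iB (q r) ≤ iB (q s))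
    (hpr : ∀ r, iA (p r) < L) (hqr : ∀ r, iB (q r) < L)
    (hmk : m * k ≤ Fintype.card V) (κ : ℝ)
    (hκp : ∑ i, |((Finset.univ.filter fun r => p r = i).card : ℝ) -
      k * (Finset.univ.filter fun x => P x = i).card / Fintype.card V| ≤ κ * k)
    (hκq : ∑ i, |((Finset.univ.filter fun r => q r = i).card : ℝ) -
      k * (Finset.univ.filter fun x => Q x = i).card / Fintype.card V| ≤ κ * k)
    (hsmall : 6 * κ * L * Fintype.card V ≤ Fintype.card V - m * k) :
    ∃ (σ : Equiv.Perm V) (ρ : V → Option (Fin k)),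
      (∀ x r, ρ x = some r → P x = p r ∧ Q (σ x) = q r) ∧
      (∀ r, (Finset.univ.filter fun x => ρ x = some r).card ≤ m) ∧
      ((Finset.univ.filter fun x => ρ x = none).card : ℝ) ≤
        Fintype.card V - m * k + 2 * κ * Fintype.card V ∧
      (∀ x, pos x ≤ pos (σ x) + 1 ∧ pos (σ x) ≤ pos x + 1) := by
  obtain ⟨S₁, φ, hφ, hφP, hS₁⟩ := exists_slot_placement P p m hk hmk κ hκp
  obtain ⟨S₂, ψ, hψ, hψQ, hS₂⟩ := exists_slot_placement Q q m hk hmk κ hκq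
  set n : ℝ := (Fintype.card V : ℝ) with hn
  have hn0 : 0 < n := by rw [hn]; exact_mod_cast Fintype.card_pos
  have hk' : (0:ℝ) < k := by exact_mod_cast hk
  have hL' : (0:ℝ) < L := by exact_mod_cast hL
  have hκ0 : 0 ≤ κ :=
    nonneg_of_mul_nonneg_left ((Finset.sum_nonneg fun i _ => abs_nonneg _).trans hκp) hk'
  set S := S₁ ∩ S₂ with hSdef
  replace hφ : Set.InjOn φ S := hφ.mono (by simp [hSdef])
  replace hψ : Set.InjOn ψ S := hψ.mono (by simp [hSdef])
  replace hφP : ∀ s ∈ S, P (φ s) = p s.1 := fun s hs => hφP s (Finset.mem_inter.1 hs).1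
  replace hψQ : ∀ s ∈ S, Q (ψ s) = q s.1 := fun s hs => hψQ s (Finset.mem_inter.1 hs).2
  have hS : (Sᶜ.card : ℝ) ≤ 2 * κ * n := by
    have : Sᶜ.card ≤ S₁ᶜ.card + S₂ᶜ.card := by
      rw [hSdef, Finset.compl_inter]; exact Finset.card_union_le _ _
    have : (Sᶜ.card : ℝ) ≤ S₁ᶜ.card + S₂ᶜ.card := by exact_mod_cast this
    linarith
  have hAc : (S.image φ).card = S.card := Finset.card_image_of_injOn hφ
  have hBc : (S.image ψ).card = S.card := Finset.card_image_of_injOn hψ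
  have hcard : Fintype.card {x // x ∉ S.image φ} = Fintype.card {x // x ∉ S.image ψ} := by
    rw [Fintype.card_subtype_compl, Fintype.card_subtype_compl]
    simp only [Fintype.card_coe]
    rw [hAc, hBc]
  obtain ⟨e, he⟩ := exists_monotone_matching (fun x : {x // x ∉ S.image φ} => pos x)
    (fun x : {x // x ∉ S.image ψ} => pos x) hcard
  have hfilt : ∀ (A : Finset V) (T : ℕ → Prop) [DecidablePred T],
      (Finset.univ.filter fun x : {x // x ∉ A} => T (pos x)).card =
      (Finset.univ.filter fun x => x ∉ A ∧ T (pos x)).card := by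
    intro A T _
    rw [← Finset.card_map (Function.Embedding.subtype _)]
    congr 1
    ext x
    simp [and_comm]
  have hA : ∀ a ≤ L, ((Finset.univ.filter fun x => iA (P x) < a).card : ℝ) = n * (a / L) := by
    simpa only [hiA] using hunif
  have hB : ∀ a ≤ L, ((Finset.univ.filter fun x => iB (Q x) < a).card : ℝ) = n * (a / L) := by
    simpa only [hiB] using hunif
  let eφ : {s // s ∈ S} ≃ {x // x ∈ S.image φ} := Equiv.ofBijective
    (fun s => ⟨φ s, Finset.mem_image_of_mem _ s.2⟩)
    ⟨fun s t hst => Subtype.ext (hφ s.2 t.2 (congrArg Subtype.val hst)), fun x => by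
      obtain ⟨s, hs, hsx⟩ := Finset.mem_image.1 x.2
      exact ⟨⟨s, hs⟩, Subtype.ext hsx⟩⟩
  let eψ : {s // s ∈ S} ≃ {x // x ∈ S.image ψ} := Equiv.ofBijective
    (fun s => ⟨ψ s, Finset.mem_image_of_mem _ s.2⟩)
    ⟨fun s t hst => Subtype.ext (hψ s.2 t.2 (congrArg Subtype.val hst)), fun x => by
      obtain ⟨s, hs, hsx⟩ := Finset.mem_image.1 x.2
      exact ⟨⟨s, hs⟩, Subtype.ext hsx⟩⟩
  let σ : Equiv.Perm V := Equiv.subtypeCongr (eφ.symm.trans eψ) e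
  let ρ : V → Option (Fin k) := fun x =>
    if h : x ∈ S.image φ then some (eφ.symm ⟨x, h⟩).1.1 else none
  have hσ1 : ∀ s (hs : s ∈ S), σ (φ s) = ψ s := by
    intro s hs
    have h1 : φ s ∈ S.image φ := Finset.mem_image_of_mem _ hs
    have h2 : eφ.symm ⟨φ s, h1⟩ = ⟨s, hs⟩ := by
      rw [Equiv.symm_apply_eq]; rfl
    simp only [σ, Equiv.subtypeCongr, Equiv.trans_apply, Equiv.sumCompl_symm_apply_of_pos h1]
    simp only [h2, Equiv.sumCongr_apply, Sum.map_inl, Equiv.trans_apply, Equiv.sumCompl_apply_inl]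
    rfl
  have hσ2 : ∀ x (hx : x ∉ S.image φ), σ x = e ⟨x, hx⟩ := by
    intro x hx
    simp only [σ, Equiv.subtypeCongr, Equiv.trans_apply, Equiv.sumCompl_symm_apply_of_neg hx]
    simp
  have hρ1 : ∀ s (hs : s ∈ S), ρ (φ s) = some s.1 := by
    intro s hs
    have h1 : φ s ∈ S.image φ := Finset.mem_image_of_mem _ hs
    have h2 : eφ.symm ⟨φ s, h1⟩ = ⟨s, hs⟩ := by
      rw [Equiv.symm_apply_eq]; rfl
    simp only [ρ, dif_pos h1, h2]
  have hρ2 : ∀ x, x ∉ S.image φ → ρ x = none := fun x hx => by simp only [ρ, dif_neg hx]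
  have hρ3 : ∀ x r, ρ x = some r → ∃ s ∈ S, φ s = x ∧ s.1 = r := by
    intro x r hxr
    by_cases hx : x ∈ S.image φ
    · obtain ⟨s, hs, rfl⟩ := Finset.mem_image.1 hx
      rw [hρ1 s hs] at hxr
      exact ⟨s, hs, rfl, Option.some_injective _ hxr⟩
    · rw [hρ2 x hx] at hxr
      cases hxr
  have hmk' : (m:ℝ) * k ≤ n := by rw [hn]; exact_mod_cast hmk
  refine ⟨σ, ρ, ?_, ?_, ?_, ?_⟩
  · intro x r hxr
    obtain ⟨s, hs, rfl, rfl⟩ := hρ3 x r hxr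
    rw [hσ1 s hs]
    exact ⟨hφP s hs, hψQ s hs⟩
  · intro r
    have : (Finset.univ.filter fun x => ρ x = some r) ⊆
        (Finset.univ : Finset (Fin m)).image fun t => φ (r, t) := by
      intro x hx
      obtain ⟨s, hs, rfl, rfl⟩ := hρ3 x r (Finset.mem_filter.1 hx).2
      exact Finset.mem_image.2 ⟨s.2, Finset.mem_univ _, rfl⟩
    exact (Finset.card_le_card this).trans (Finset.card_image_le.trans (by simp))
  · have h1 : (Finset.univ.filter fun x => ρ x = none) ⊆ (S.image φ)ᶜ := by
      intro x hx
      rw [Finset.mem_compl]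
      intro hx'
      obtain ⟨s, hs, rfl⟩ := Finset.mem_image.1 hx'
      have := (Finset.mem_filter.1 hx).2
      rw [hρ1 s hs] at this
      cases this
    have h2 : ((Finset.univ.filter fun x => ρ x = none).card : ℝ) ≤ ((S.image φ)ᶜ.card : ℝ) := by
      exact_mod_cast Finset.card_le_card h1
    have h3 : ((S.image φ)ᶜ.card : ℝ) + S.card = n := by
      rw [← hAc, hn]
      exact_mod_cast Finset.card_compl_add_card _
    have h4 : (Sᶜ.card : ℝ) + S.card = m * k := by
      have := Finset.card_compl_add_card S
      rw [Fintype.card_prod, Fintype.card_fin, Fintype.card_fin, mul_comm] at this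
      exact_mod_cast this
    linarith
  · have hsm : 2 * κ * L ≤ 1 := by
      have h1 : 6 * κ * L * n ≤ 1 * n := by
        have : (0:ℝ) ≤ m * k := by positivity
        linarith
      have h2 := le_of_mul_le_mul_right h1 hn0
      have h3 : 0 ≤ κ * L := by positivity
      linarith
    intro x
    by_cases hx : x ∈ S.image φ
    · obtain ⟨s, hs, rfl⟩ := Finset.mem_image.1 hx
      rw [hσ1 s hs, ← hiA (φ s), ← hiB (ψ s), hφP s hs, hψQ s hs]
      exact ⟨sampled_position_le P Q iA iB hL hk hA hB p q hp hq hpr hqr κ hκp hκq hsm s.1,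
        sampled_position_le Q P iB iA hL hk hB hA q p hq hp hqr hpr κ hκq hκp hsm s.1⟩
    · rw [hσ2 x hx]
      obtain ⟨h1, h2⟩ := he ⟨x, hx⟩
      set y : V := (e ⟨x, hx⟩ : V)
      simp only at h1 h2
      rw [hfilt _ (fun a => a < pos x), hfilt _ (fun a => a ≤ pos y)] at h1
      rw [hfilt _ (fun a => a < pos y), hfilt _ (fun a => a ≤ pos x)] at h2
      have hxy := uncovered_position_le P Q iA iB hL hk hA hB p q hmk κ hκp hκq hsmall S φ ψ
        hφ hψ hφP hψQ hS x y (by rw [hiA]; exact hpos x) (by rw [hiB]; exact hpos y)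
        (by simpa only [hiA, hiB, Nat.lt_succ_iff] using h1)
      have hyx := uncovered_position_le Q P iB iA hL hk hB hA q p hmk κ hκq hκp hsmall S ψ φ
        hψ hφ hψQ hφP hS y x (by rw [hiB]; exact hpos y) (by rw [hiA]; exact hpos x)
        (by simpa only [hiA, hiB, Nat.lt_succ_iff] using h2)
      rw [hiA, hiB] at hxy hyx
      exact ⟨hxy, hyx⟩

/-- The affine map of the unit interval onto its `i`-th subinterval of length `1 / N`. -/
def subMap {N : ℕ} (i : Fin N) (s : UI) : UI :=
  ⟨((i : ℕ) + s) / N, by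
    have hN : (0:ℝ) < N := by exact_mod_cast i.pos
    have hi : ((i : ℕ) : ℝ) + 1 ≤ N := by exact_mod_cast i.2
    have h0 := s.2.1
    have h1 := s.2.2
    exact ⟨by positivity, by rw [div_le_one hN]; linarith⟩⟩

/-- The index of the subinterval of length `1 / N` that contains a point. -/
def subIdx (N : ℕ) [NeZero N] (x : UI) : Fin N :=
  ⟨min ⌊(N:ℝ) * x⌋₊ (N - 1), by have := NeZero.pos N; omega⟩

lemma subIdx_le (N : ℕ) [NeZero N] (x : UI) : ((subIdx N x : ℕ) : ℝ) ≤ N * x := by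
  have h0 := x.2.1
  calc ((subIdx N x : ℕ) : ℝ) ≤ (⌊(N:ℝ) * x⌋₊ : ℝ) := by
        exact_mod_cast min_le_left _ _
    _ ≤ _ := Nat.floor_le (by positivity)

lemma le_subIdx_add_one (N : ℕ) [NeZero N] (x : UI) : (N:ℝ) * x ≤ (subIdx N x : ℕ) + 1 := by
  have hN := NeZero.pos N
  rcases le_total ⌊(N:ℝ) * x⌋₊ (N - 1) with h | h
  · have : (subIdx N x : ℕ) = ⌊(N:ℝ) * x⌋₊ := min_eq_left h
    rw [this]
    exact (Nat.lt_floor_add_one _).le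
  · have : (subIdx N x : ℕ) = N - 1 := min_eq_right h
    rw [this, Nat.cast_sub hN]
    have := x.2.2
    have hN' : (0:ℝ) < N := by exact_mod_cast hN
    push_cast
    nlinarith

lemma lt_subIdx_add_one (N : ℕ) [NeZero N] (x : UI) (hx : (x:ℝ) < 1) :
    (N:ℝ) * x < (subIdx N x : ℕ) + 1 := by
  have hN := NeZero.pos N
  have hN' : (0:ℝ) < N := by exact_mod_cast hN
  have h0 := x.2.1
  have hlt : ⌊(N:ℝ) * x⌋₊ < N := by
    rw [Nat.floor_lt (by positivity)]
    nlinarith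
  have : (subIdx N x : ℕ) = ⌊(N:ℝ) * x⌋₊ := min_eq_left (by omega)
  rw [this]
  exact Nat.lt_floor_add_one _

lemma subIdx_eq (N : ℕ) [NeZero N] (x : UI) (i : Fin N) (h1 : ((i : ℕ) : ℝ) ≤ N * x)
    (h2 : (N:ℝ) * x < (i : ℕ) + 1) : subIdx N x = i := by
  have hN := NeZero.pos N
  have h0 := x.2.1
  have hfl : ⌊(N:ℝ) * x⌋₊ = (i : ℕ) := by
    rw [Nat.floor_eq_iff (by positivity)]
    exact ⟨h1, h2⟩
  apply Fin.ext
  show min _ _ = _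
  rw [hfl]
  have := i.2
  omega

lemma subIdx_subMap (N : ℕ) [NeZero N] (i : Fin N) (s : UI) (hs : (s:ℝ) < 1) :
    subIdx N (subMap i s) = i := by
  have hN' : (0:ℝ) < N := by exact_mod_cast NeZero.pos N
  have h0 := s.2.1
  have : (N:ℝ) * (subMap i s : UI) = (i:ℕ) + s := by
    show (N:ℝ) * (((i:ℕ) + s) / N) = _
    field_simp
  exact subIdx_eq N _ i (by rw [this]; linarith) (by rw [this]; linarith)

lemma measurable_subIdx (N : ℕ) [NeZero N] : Measurable (subIdx N) := by
  refine measurable_to_countable' fun i => ?_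
  have : subIdx N ⁻¹' {i} = (fun x : UI => min ⌊(N:ℝ) * x⌋₊ (N - 1)) ⁻¹' {(i:ℕ)} := by
    ext x
    simp [Fin.ext_iff, subIdx]
  rw [this]
  have h : Measurable (fun x : UI => min ⌊(N:ℝ) * x⌋₊ (N - 1)) :=
    (Nat.measurable_floor.comp (measurable_subtype_coe.const_mul _)).min measurable_const
  exact h (measurableSet_singleton _)

lemma measurable_subMap {N : ℕ} (i : Fin N) : Measurable (subMap i) := by
  refine Measurable.subtype_mk ?_
  fun_prop

lemma volume_eq_sum_map_subMap (N : ℕ) [NeZero N] :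
    (volume : Measure UI) = ∑ i : Fin N, (N:ℝ≥0∞)⁻¹ • (volume : Measure UI).map (subMap i) := by
  have hN := NeZero.pos N
  have hN' : (0:ℝ) < N := by exact_mod_cast hN
  ext A hA
  let B : Set ℝ := Subtype.val '' A
  have hB : MeasurableSet B :=
    (MeasurableEmbedding.subtype_coe measurableSet_Icc).measurableSet_image.2
    hA
  have hAB : A = Subtype.val ⁻¹' B := (Set.preimage_image_eq _ Subtype.val_injective).symm
  have hInt : ∀ C : Set ℝ, MeasurableSet C →
      ((volume : Measure UI) (Subtype.val ⁻¹' C)).toReal = ∫ x in (0:ℝ)..1, C.indicator 1 x := by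
    intro C hC
    rw [intervalIntegral.integral_of_le zero_le_one, integral_indicator_one hC,
      Measure.real, restrict_Ioc_eq_restrict_Icc, Measure.restrict_apply hC,
      volume_preimage_coe nullMeasurableSet_Icc hC]
  have hpre : ∀ i : Fin N, subMap i ⁻¹' A =
      Subtype.val ⁻¹' ((fun s : ℝ => ((i:ℕ) + s) / N) ⁻¹' B) := by
    intro i
    rw [hAB]
    rfl
  simp only [Measure.coe_finsetSum, Finset.sum_apply, Measure.smul_apply, smul_eq_mul]
  rw [← ENNReal.toReal_eq_toReal_iff' (measure_ne_top _ _) ?_, ENNReal.toReal_sum ?_]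
  · rw [hAB, hInt B hB]
    have hii : ∀ a b : ℝ, IntervalIntegrable (B.indicator (1 : ℝ → ℝ)) volume a b := by
      intro a b
      rw [intervalIntegrable_iff]
      have : IsFiniteMeasure (volume.restrict (Set.uIoc a b)) :=
        ⟨by simp [Set.uIoc, Real.volume_Ioc]⟩
      exact (integrable_const (1:ℝ)).indicator hB
    have h1 := intervalIntegral.sum_integral_adjacent_intervals (f := B.indicator (1 : ℝ → ℝ))
      (μ := volume) (a := fun i : ℕ => (i:ℝ) / N) (n := N) (fun i _ => hii _ _)
    simp only [Nat.cast_zero, zero_div, div_self hN'.ne'] at h1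
    rw [← h1, Finset.sum_range]
    refine Finset.sum_congr rfl fun i _ => ?_
    rw [← hAB, Measure.map_apply (measurable_subMap i) hA, hpre, ENNReal.toReal_mul,
      hInt _ (by exact (by fun_prop : Measurable (fun s : ℝ => ((i:ℕ) + s) / N)) hB)]
    have h2 := intervalIntegral.integral_comp_add_div (a := 0) (b := 1)
      (B.indicator (1 : ℝ → ℝ)) hN'.ne' ((i:ℕ) / N : ℝ)
    rw [zero_div, add_zero, smul_eq_mul, ← add_div, eq_comm, ← eq_inv_mul_iff_mul_eq₀ hN'.ne'] at h2
    push_cast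
    rw [h2, ENNReal.toReal_inv, ENNReal.toReal_natCast]
    congr 1
    refine intervalIntegral.integral_congr fun x _ => ?_
    simp only [Set.indicator, Set.mem_preimage, add_div]
    rfl
  · intro i _
    exact ENNReal.mul_ne_top (by simp [hN.ne']) (measure_ne_top _ _)
  · refine ENNReal.sum_ne_top.2 fun i _ => ?_
    exact ENNReal.mul_ne_top (by simp [hN.ne']) (measure_ne_top _ _)

lemma lintegral_eq_sum_subMap (N : ℕ) [NeZero N] (g : UI → ℝ≥0∞) (hg : Measurable g) :
    ∫⁻ x, g x = ∑ i : Fin N, (N:ℝ≥0∞)⁻¹ * ∫⁻ s, g (subMap i s) := by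
  conv_lhs => rw [volume_eq_sum_map_subMap N]
  rw [lintegral_finsetSum_measure]
  refine Finset.sum_congr rfl fun i _ => ?_
  rw [lintegral_smul_measure, lintegral_map hg (measurable_subMap i), smul_eq_mul]

/-- The affine map of the unit square onto a grid cell of side `1 / N`. -/
def cellMap {N : ℕ} (x : Fin N × Fin N) (s : USq) : USq := (subMap x.1 s.1, subMap x.2 s.2)

/-- The grid cell of side `1 / N` that contains a point. -/
def cellIdx (N : ℕ) [NeZero N] (u : USq) : Fin N × Fin N := (subIdx N u.1, subIdx N u.2)

lemma measurable_cellMap {N : ℕ} (x : Fin N × Fin N) : Measurable (cellMap x) :=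
  ((measurable_subMap x.1).comp measurable_fst).prodMk
    ((measurable_subMap x.2).comp measurable_snd)

lemma measurable_cellIdx (N : ℕ) [NeZero N] : Measurable (cellIdx N) :=
  ((measurable_subIdx N).comp measurable_fst).prodMk ((measurable_subIdx N).comp measurable_snd)

lemma lintegral_eq_sum_cellMap (N : ℕ) [NeZero N] (g : USq → ℝ≥0∞) (hg : Measurable g) :
    ∫⁻ u, g u = ((N:ℝ≥0∞)⁻¹) ^ 2 * ∑ x : Fin N × Fin N, ∫⁻ s, g (cellMap x s) := by
  rw [Measure.volume_eq_prod, lintegral_prod _ hg.aemeasurable,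
    lintegral_eq_sum_subMap N _ hg.lintegral_prod_right', ← Finset.mul_sum, sq, mul_assoc,
    Fintype.sum_prod_type]
  congr 1
  rw [Finset.mul_sum]
  refine Finset.sum_congr rfl fun i _ => ?_
  have h1 : ∀ s : UI, ∫⁻ y, g (subMap i s, y) =
      ∑ j : Fin N, (N:ℝ≥0∞)⁻¹ * ∫⁻ t, g (subMap i s, subMap j t) := fun s =>
    lintegral_eq_sum_subMap N _ (hg.comp measurable_prodMk_left)
  simp only [h1]
  have hm : ∀ j : Fin N, Measurable fun p : UI × UI => g (subMap i p.1, subMap j p.2) :=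
    fun j => hg.comp (measurable_cellMap (i, j))
  rw [lintegral_finsetSum _ fun j _ => (hm j).lintegral_prod_right'.const_mul _, Finset.mul_sum]
  refine Finset.sum_congr rfl fun j _ => ?_
  rw [lintegral_const_mul _ (hm j).lintegral_prod_right']
  congr 1
  exact (lintegral_prod _ (hm j).aemeasurable).symm

lemma cellIdx_cellMap (N : ℕ) [NeZero N] (x : Fin N × Fin N) (s : USq)
    (hs : (s.1 : ℝ) < 1 ∧ (s.2 : ℝ) < 1) : cellIdx N (cellMap x s) = x :=
  Prod.ext (subIdx_subMap N x.1 s.1 hs.1) (subIdx_subMap N x.2 s.2 hs.2)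

lemma ae_lt_one : ∀ᵐ s : USq, (s.1 : ℝ) < 1 ∧ (s.2 : ℝ) < 1 := by
  have h : ∀ᵐ x : UI, (x : ℝ) < 1 := by
    have h1 : ({(1 : UI)} : Set UI)ᶜ ∈ ae (volume : Measure UI) := by
      rw [mem_ae_iff, compl_compl]
      exact measure_singleton _
    filter_upwards [h1] with x hx
    exact lt_of_le_of_ne x.2.2 fun h => hx (Subtype.ext h)
  have h1 : ∀ᵐ s : USq, (s.1 : ℝ) < 1 := Measure.quasiMeasurePreserving_fst.ae h
  have h2 : ∀ᵐ s : USq, (s.2 : ℝ) < 1 := Measure.quasiMeasurePreserving_snd.ae h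
  filter_upwards [h1, h2] with s hs1 hs2 using ⟨hs1, hs2⟩

lemma lintegral_comp_cellIdx (N : ℕ) [NeZero N] (g : Fin N × Fin N → ℝ≥0∞) :
    ∫⁻ u, g (cellIdx N u) = ((N:ℝ≥0∞)⁻¹) ^ 2 * ∑ x, g x := by
  rw [lintegral_eq_sum_cellMap N (fun u => g (cellIdx N u))
    ((measurable_of_countable g).comp (measurable_cellIdx N))]
  congr 1
  refine Finset.sum_congr rfl fun x _ => ?_
  have : ∫⁻ s : USq, g (cellIdx N (cellMap x s)) = ∫⁻ _ : USq, g x := by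
    refine lintegral_congr_ae ?_
    filter_upwards [ae_lt_one] with s hs
    rw [cellIdx_cellMap N x s hs]
  rw [this, lintegral_const, measure_univ, mul_one]

lemma volume_cellIdx_preimage (N : ℕ) [NeZero N] (x : Fin N × Fin N) :
    volume (cellIdx N ⁻¹' {x}) = ((N:ℝ≥0∞)⁻¹) ^ 2 := by
  have h := lintegral_comp_cellIdx N (Set.indicator {x} 1)
  have h1 : (fun u => Set.indicator {x} (1 : Fin N × Fin N → ℝ≥0∞) (cellIdx N u)) =
      (cellIdx N ⁻¹' {x}).indicator 1 := rfl
  rw [h1, lintegral_indicator_one (measurable_cellIdx N (measurableSet_singleton x))] at h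
  rw [h]
  simp [Set.indicator_apply]

/-- The relative position of a point in its subinterval. -/
def subFrac (N : ℕ) [NeZero N] (x : UI) : UI :=
  ⟨N * x - (subIdx N x : ℕ), by
    have := subIdx_le N x
    have := le_subIdx_add_one N x
    constructor <;> linarith⟩

lemma subMap_subFrac (N : ℕ) [NeZero N] (x : UI) : subMap (subIdx N x) (subFrac N x) = x := by
  have hN' : (0:ℝ) < N := by exact_mod_cast NeZero.pos N
  apply Subtype.ext
  show (((subIdx N x : ℕ) : ℝ) + (N * x - (subIdx N x : ℕ))) / N = x
  field_simp
  ring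

lemma subFrac_subMap (N : ℕ) [NeZero N] (i : Fin N) (s : UI) (hs : (s:ℝ) < 1) :
    subFrac N (subMap i s) = s := by
  have hN' : (0:ℝ) < N := by exact_mod_cast NeZero.pos N
  apply Subtype.ext
  show (N:ℝ) * (((i:ℕ) + s) / N) - (subIdx N (subMap i s) : ℕ) = s
  rw [subIdx_subMap N i s hs]
  field_simp
  ring

lemma measurable_subFrac (N : ℕ) [NeZero N] : Measurable (subFrac N) := by
  refine Measurable.subtype_mk ?_
  refine (measurable_subtype_coe.const_mul _).sub ?_
  exact (measurable_of_countable fun i : Fin N => ((i:ℕ) : ℝ)).comp (measurable_subIdx N)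

/-- The bijection of the unit square that permutes the grid cells by translations. -/
def gridPerm {N : ℕ} [NeZero N] (σ : Equiv.Perm (Fin N × Fin N)) (u : USq) : USq :=
  if (u.1 : ℝ) < 1 ∧ (u.2 : ℝ) < 1 then
    cellMap (σ (cellIdx N u)) (subFrac N u.1, subFrac N u.2) else u

lemma subMap_lt_one {N : ℕ} (i : Fin N) (s : UI) (hs : (s:ℝ) < 1) : (subMap i s : ℝ) < 1 := by
  have hN : (0:ℝ) < N := by exact_mod_cast i.pos
  have hi : ((i : ℕ) : ℝ) + 1 ≤ N := by exact_mod_cast i.2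
  show (((i : ℕ) : ℝ) + s) / N < 1
  rw [div_lt_one hN]
  linarith

lemma subFrac_lt_one (N : ℕ) [NeZero N] (x : UI) (hx : (x:ℝ) < 1) : (subFrac N x : ℝ) < 1 := by
  have := lt_subIdx_add_one N x hx
  show (N:ℝ) * x - (subIdx N x : ℕ) < 1
  linarith

lemma gridPerm_cellMap {N : ℕ} [NeZero N] (σ : Equiv.Perm (Fin N × Fin N)) (x : Fin N × Fin N)
    (s : USq) (hs : (s.1 : ℝ) < 1 ∧ (s.2 : ℝ) < 1) :
    gridPerm σ (cellMap x s) = cellMap (σ x) s := by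
  have h : ((cellMap x s).1 : ℝ) < 1 ∧ ((cellMap x s).2 : ℝ) < 1 :=
    ⟨subMap_lt_one _ _ hs.1, subMap_lt_one _ _ hs.2⟩
  rw [gridPerm, if_pos h, cellIdx_cellMap N x s hs]
  congr 1
  exact Prod.ext (subFrac_subMap N _ _ hs.1) (subFrac_subMap N _ _ hs.2)

lemma cellIdx_gridPerm {N : ℕ} [NeZero N] (σ : Equiv.Perm (Fin N × Fin N)) (u : USq)
    (hu : (u.1 : ℝ) < 1 ∧ (u.2 : ℝ) < 1) : cellIdx N (gridPerm σ u) = σ (cellIdx N u) := by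
  rw [gridPerm, if_pos hu, cellIdx_cellMap]
  exact ⟨subFrac_lt_one N _ hu.1, subFrac_lt_one N _ hu.2⟩

lemma gridPerm_symm_gridPerm {N : ℕ} [NeZero N] (σ : Equiv.Perm (Fin N × Fin N)) (u : USq) :
    gridPerm σ.symm (gridPerm σ u) = u := by
  by_cases hu : (u.1 : ℝ) < 1 ∧ (u.2 : ℝ) < 1
  · rw [show gridPerm σ u = cellMap (σ (cellIdx N u)) (subFrac N u.1, subFrac N u.2) from
      if_pos hu, gridPerm_cellMap _ _ _ ⟨subFrac_lt_one N _ hu.1, subFrac_lt_one N _ hu.2⟩,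
      Equiv.symm_apply_apply]
    exact Prod.ext (subMap_subFrac N u.1) (subMap_subFrac N u.2)
  · rw [show gridPerm σ u = u from if_neg hu]
    exact if_neg hu

lemma measurableSet_lt_one : MeasurableSet {u : USq | (u.1 : ℝ) < 1 ∧ (u.2 : ℝ) < 1} := by
  have m1 : Measurable fun u : USq => (u.1 : ℝ) := measurable_subtype_coe.comp measurable_fst
  have m2 : Measurable fun u : USq => (u.2 : ℝ) := measurable_subtype_coe.comp measurable_snd
  exact (m1 measurableSet_Iio).inter (m2 measurableSet_Iio)

lemma Measurable.subMap {N : ℕ} {X : Type} [MeasurableSpace X] {i : X → Fin N} {s : X → UI}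
    (hi : Measurable i) (hs : Measurable s) : Measurable fun u => subMap (i u) (s u) := by
  have h : Measurable fun p : Fin N × UI => _root_.subMap p.1 p.2 :=
    measurable_from_prod_countable_right fun x => measurable_subMap x
  exact h.comp (hi.prodMk hs)

lemma measurable_gridPerm {N : ℕ} [NeZero N] (σ : Equiv.Perm (Fin N × Fin N)) :
    Measurable (gridPerm σ) := by
  have h3 : Measurable fun u : USq => σ (cellIdx N u) :=
    (measurable_of_countable σ).comp (measurable_cellIdx N)
  exact Measurable.ite measurableSet_lt_one
    ((Measurable.subMap (measurable_fst.comp h3)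
      ((measurable_subFrac N).comp measurable_fst)).prodMk
    (Measurable.subMap (measurable_snd.comp h3)
      ((measurable_subFrac N).comp measurable_snd))) measurable_id

lemma measurePreserving_gridPerm {N : ℕ} [NeZero N] (σ : Equiv.Perm (Fin N × Fin N)) :
    MeasurePreserving (gridPerm σ) volume volume := by
  refine ⟨measurable_gridPerm σ, ?_⟩
  ext A hA
  rw [Measure.map_apply (measurable_gridPerm σ) hA,
    ← lintegral_indicator_one (measurable_gridPerm σ hA), ← lintegral_indicator_one hA,
    lintegral_eq_sum_cellMap N _ (measurable_one.indicator (measurable_gridPerm σ hA)),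
    lintegral_eq_sum_cellMap N _ (measurable_one.indicator hA),
    ← Equiv.sum_comp σ (fun x => ∫⁻ s, A.indicator 1 (cellMap x s))]
  congr 1
  refine Finset.sum_congr rfl fun x _ => lintegral_congr_ae ?_
  filter_upwards [ae_lt_one] with s hs
  rw [← gridPerm_cellMap σ x s hs]
  rfl

lemma isMPB_gridPerm {N : ℕ} [NeZero N] (σ : Equiv.Perm (Fin N × Fin N)) :
    IsMPB (gridPerm σ) :=
  ⟨measurePreserving_gridPerm σ, gridPerm σ.symm, measurePreserving_gridPerm σ.symm,
    gridPerm_symm_gridPerm σ, gridPerm_symm_gridPerm σ.symm⟩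

lemma shiftOf_gridPerm_le {N : ℕ} [NeZero N] (σ : Equiv.Perm (Fin N × Fin N)) (D : ℝ)
    (hD : ∀ x, |((x.1 : ℕ) : ℝ) - ((σ x).1 : ℕ)| ≤ D * N) : shiftOf (gridPerm σ) ≤ D := by
  have hN' : (0:ℝ) < N := by exact_mod_cast NeZero.pos N
  have hD0 : 0 ≤ D :=
    nonneg_of_mul_nonneg_left ((abs_nonneg _).trans (hD (Classical.arbitrary _))) hN'
  refine ciSup_le fun u => ?_
  by_cases hu : (u.1 : ℝ) < 1 ∧ (u.2 : ℝ) < 1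
  · rw [gridPerm, if_pos hu]
    have h1 : (u.1 : ℝ) = (((cellIdx N u).1 : ℕ) + subFrac N u.1) / N := by
      conv_lhs => rw [← subMap_subFrac N u.1]
      rfl
    have h2 : ((cellMap (σ (cellIdx N u)) (subFrac N u.1, subFrac N u.2)).1 : ℝ) =
      (((σ (cellIdx N u)).1 : ℕ) + subFrac N u.1) / N := rfl
    rw [h2, h1, ← sub_div, add_sub_add_right_eq_sub, abs_div, abs_of_pos hN', div_le_iff₀ hN']
    exact hD _
  · rw [gridPerm, if_neg hu, sub_self, abs_zero]
    exact hD0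

lemma dist_cellMap_cellIdx_le (N : ℕ) [NeZero N] (u : USq) :
    dist u (cellMap (cellIdx N u) (0, 0)) ≤ 1 / N := by
  have hN' : (0:ℝ) < N := by exact_mod_cast NeZero.pos N
  have h : ∀ x : UI, dist x (subMap (subIdx N x) 0) ≤ 1 / N := by
    intro x
    rw [Subtype.dist_eq, Real.dist_eq]
    have h1 : ((subMap (subIdx N x) 0 : UI) : ℝ) = (subIdx N x : ℕ) / N := by
      show (((subIdx N x : ℕ) : ℝ) + 0) / N = _
      rw [add_zero]
    have h2 := subIdx_le N x
    have h3 := le_subIdx_add_one N x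
    have h4 : (x : ℝ) - (subIdx N x : ℕ) / N = (N * x - (subIdx N x : ℕ)) / N := by field_simp
    rw [h1, h4, abs_of_nonneg (div_nonneg (by linarith) hN'.le)]
    gcongr
    linarith
  exact max_le (h u.1) (h u.2)

lemma abs_clamp_sub_clamp_le (a b : ℝ) : |max 0 (min 1 a) - max 0 (min 1 b)| ≤ |a - b| := by
  refine (abs_max_sub_max_le_max _ _ _ _).trans ?_
  refine max_le (by simp) ?_
  refine (abs_min_sub_min_le_max _ _ _ _).trans ?_
  exact max_le (by simp) le_rfl

/-- A measurable symmetric kernel is approximated in `L¹` by grid kernels. -/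
lemma exists_grid_approx (W : USq → USq → ℝ) (hW : IsOrderon W) (η : ℝ) (hη : 0 < η) :
    ∃ N₀ : ℕ, ∀ N : ℕ, ∀ _ : NeZero N, N₀ ≤ N →
      ∃ w : Fin N × Fin N → Fin N × Fin N → ℝ, (∀ x y, w x y = w y x) ∧
        (∀ x y, 0 ≤ w x y ∧ w x y ≤ 1) ∧
        ∫ p : USq × USq, |W p.1 p.2 - w (cellIdx N p.1) (cellIdx N p.2)| ≤ η := by
  obtain ⟨hm, h01, hs⟩ := hW
  have hInt : Integrable (fun p : USq × USq => W p.1 p.2) volume := by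
    refine Integrable.of_bound hm.aestronglyMeasurable 1 (ae_of_all _ fun p => ?_)
    rw [Real.norm_eq_abs, abs_of_nonneg (h01 _ _).1]
    exact (h01 _ _).2
  obtain ⟨g, hg, hgi⟩ := hInt.exists_boundedContinuous_integral_sub_le (half_pos hη)
  have huc := CompactSpace.uniformContinuous_of_continuous g.continuous
  obtain ⟨δ, hδ, hgδ⟩ := Metric.uniformContinuous_iff.1 huc (η / 2) (half_pos hη)
  obtain ⟨N₀, hN₀⟩ := exists_nat_gt (1 / δ)
  refine ⟨N₀, fun N _ hN => ?_⟩
  have hN' : (0:ℝ) < N := by exact_mod_cast NeZero.pos N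
  have hNδ : 1 / (N:ℝ) < δ := by
    rw [div_lt_comm₀ hN' hδ]
    exact hN₀.trans_le (by exact_mod_cast hN)
  let q : Fin N × Fin N → USq := fun x => cellMap x (0, 0)
  have hq : ∀ u v, |g (u, v) - g (q (cellIdx N u), q (cellIdx N v))| ≤ η / 2 := by
    intro u v
    rw [← Real.dist_eq]
    refine (hgδ ?_).le
    exact max_lt ((dist_cellMap_cellIdx_le N u).trans_lt hNδ)
      ((dist_cellMap_cellIdx_le N v).trans_lt hNδ)
  let w : Fin N × Fin N → Fin N × Fin N → ℝ := fun x y =>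
    max 0 (min 1 ((g (q x, q y) + g (q y, q x)) / 2))
  refine ⟨w, fun x y => by simp only [w, add_comm], fun x y => ⟨le_max_left _ _,
    max_le zero_le_one (min_le_left _ _)⟩, ?_⟩
  have hpt : ∀ p : USq × USq, |W p.1 p.2 - w (cellIdx N p.1) (cellIdx N p.2)| ≤
      (‖W p.1 p.2 - g p‖ + ‖W p.swap.1 p.swap.2 - g p.swap‖) / 2 + η / 2 := by
    rintro ⟨u, v⟩
    have h1 : W u v = max 0 (min 1 ((W u v + W v u) / 2)) := by
      rw [← hs u v, add_self_div_two, min_eq_right (h01 u v).2, max_eq_right (h01 u v).1]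
    simp only [Prod.swap_prod_mk]
    conv_lhs => rw [h1]
    refine (abs_clamp_sub_clamp_le _ _).trans ?_
    have h2 := hq u v
    have h3 := hq v u
    rw [Real.norm_eq_abs, Real.norm_eq_abs]
    have e : (W u v + W v u) / 2 - (g (q (cellIdx N u), q (cellIdx N v)) +
        g (q (cellIdx N v), q (cellIdx N u))) / 2 =
        ((W u v - g (u, v)) + (W v u - g (v, u)) +
        (g (u, v) - g (q (cellIdx N u), q (cellIdx N v))) +
        (g (v, u) - g (q (cellIdx N v), q (cellIdx N u)))) / 2 := by ring
    rw [e, abs_div, abs_two]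
    have h4 := abs_add_le ((W u v - g (u, v)) + (W v u - g (v, u)) +
        (g (u, v) - g (q (cellIdx N u), q (cellIdx N v))))
        (g (v, u) - g (q (cellIdx N v), q (cellIdx N u)))
    have h5 := abs_add_le ((W u v - g (u, v)) + (W v u - g (v, u)))
        (g (u, v) - g (q (cellIdx N u), q (cellIdx N v)))
    have h6 := abs_add_le (W u v - g (u, v)) (W v u - g (v, u))
    linarith
  have hi : Integrable (fun p : USq × USq => ‖W p.1 p.2 - g p‖) volume := (hInt.sub hgi).norm
  have hsw : MeasurePreserving (Prod.swap : USq × USq → USq × USq) volume volume :=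
    Measure.measurePreserving_swap
  have hi' : Integrable (fun p : USq × USq => ‖W p.swap.1 p.swap.2 - g p.swap‖) volume :=
    hsw.integrable_comp_of_integrable hi
  have hie : ∫ p : USq × USq, ‖W p.swap.1 p.swap.2 - g p.swap‖ =
      ∫ p : USq × USq, ‖W p.1 p.2 - g p‖ :=
    hsw.integral_comp MeasurableEquiv.prodComm.measurableEmbedding
      (fun p : USq × USq => ‖W p.1 p.2 - g p‖)
  calc _ ≤ ∫ p : USq × USq,
        ((‖W p.1 p.2 - g p‖ + ‖W p.swap.1 p.swap.2 - g p.swap‖) / 2 + η / 2) := by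
        refine integral_mono_of_nonneg (ae_of_all _ fun p => abs_nonneg _) ?_ (ae_of_all _ hpt)
        exact ((hi.add hi').div_const 2).add (integrable_const _)
    _ = (∫ p : USq × USq, ‖W p.1 p.2 - g p‖) + η / 2 := by
        have hi2 : Integrable (fun p : USq × USq =>
          (‖W p.1 p.2 - g p‖ + ‖W p.swap.1 p.swap.2 - g p.swap‖) / 2) volume :=
          (hi.add hi').div_const 2
        rw [integral_add hi2 (integrable_const _), integral_div,
          integral_add hi hi', hie, integral_const]
        simp
    _ ≤ η := by linarith

lemma measurePreserving_precomp {k m : ℕ} (ι : Fin m → Fin k) (hι : Function.Injective ι) :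
    MeasurePreserving (fun (v : Fin k → USq) j => v (ι j)) volume volume := by
  refine ⟨by fun_prop, ?_⟩
  have h1 : ProbabilityTheory.iIndepFun (fun (i : Fin k) (v : Fin k → USq) => v i) volume :=
    ProbabilityTheory.iIndepFun_pi (μ := fun _ => (volume : Measure USq)) (X := fun _ => id)
      (fun i => measurable_id.aemeasurable)
  have h2 := (ProbabilityTheory.iIndepFun_iff_map_fun_eq_pi_map
    (fun j => (measurable_pi_apply _).aemeasurable)).1 (h1.precomp hι)
  rw [h2, volume_pi]
  congr 1
  ext1 j
  exact (measurePreserving_eval (fun _ : Fin k => (volume : Measure USq)) (ι j)).map_eq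

lemma volume_real_cellIdx_preimage (N : ℕ) [NeZero N] (x : Fin N × Fin N) :
    (volume : Measure USq).real (cellIdx N ⁻¹' {x}) = ((N:ℝ) ^ 2)⁻¹ := by
  rw [Measure.real, volume_cellIdx_preimage]
  simp

/-- Averages over distinct sample points of a function of their cells. -/
lemma integral_comp_cells {k m : ℕ} (N : ℕ) [NeZero N] (ι : Fin m → Fin k)
    (hι : Function.Injective ι) (g : (Fin m → Fin N × Fin N) → ℝ) :
    ∫ v : Fin k → USq, g (fun j => cellIdx N (v (ι j))) =
      (((N:ℝ) ^ 2) ^ m)⁻¹ * ∑ y, g y := by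
  have h1 : Measurable fun (v : Fin m → USq) j => cellIdx N (v j) :=
    measurable_pi_lambda _ fun j => (measurable_cellIdx N).comp (measurable_pi_apply j)
  have h2 : ∫ v : Fin k → USq, g (fun j => cellIdx N (v (ι j))) =
      ∫ v : Fin m → USq, g (fun j => cellIdx N (v j)) := by
    rw [← (measurePreserving_precomp ι hι).map_eq, integral_map
      (measurePreserving_precomp ι hι).measurable.aemeasurable]
    exact ((measurable_of_finite g).comp h1).aestronglyMeasurable
  have h3 : ∫ v : Fin m → USq, g (fun j => cellIdx N (v j)) =
      ∫ y, g y ∂(Measure.map (fun (v : Fin m → USq) j => cellIdx N (v j)) volume) := by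
    rw [integral_map h1.aemeasurable (measurable_of_finite g).aestronglyMeasurable]
  have : IsProbabilityMeasure (Measure.map (fun (v : Fin m → USq) j => cellIdx N (v j)) volume) :=
    Measure.isProbabilityMeasure_map h1.aemeasurable
  rw [h2, h3, integral_fintype Integrable.of_finite, Finset.mul_sum]
  refine Finset.sum_congr rfl fun y _ => ?_
  rw [smul_eq_mul, map_measureReal_apply h1 (measurableSet_singleton y)]
  congr 1
  have h4 : (fun (v : Fin m → USq) j => cellIdx N (v j)) ⁻¹' {y} =
      Set.univ.pi fun j => cellIdx N ⁻¹' {y j} := by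
    ext v
    simp [funext_iff]
  rw [h4, Measure.real, volume_pi_pi, ENNReal.toReal_prod]
  have h5 := volume_real_cellIdx_preimage N
  simp only [Measure.real] at h5
  simp [h5]

/-- Averages over two distinct sample points. -/
lemma measurePreserving_pair {k : ℕ} {i j : Fin k} (hij : i ≠ j) :
    MeasurePreserving (fun v : Fin k → USq => (v i, v j)) volume volume := by
  have hι : Function.Injective ![i, j] := by
    intro a b hab
    fin_cases a <;> fin_cases b <;> simp_all [eq_comm]
  exact (volume_preserving_finTwoArrow USq).comp (measurePreserving_precomp ![i, j] hι)

lemma ae_injective_fst {k : ℕ} :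
    ∀ᵐ v : Fin k → USq, ∀ i j, i ≠ j → (v i).1 ≠ (v j).1 := by
  rw [ae_all_iff]; intro i
  rw [ae_all_iff]; intro j
  by_cases hij : i = j
  · exact ae_of_all _ fun v h => absurd hij h
  have h : ∀ᵐ p : USq × USq, p.1.1 ≠ p.2.1 := by
    rw [ae_iff]
    simp only [not_not]
    have hm : MeasurableSet {p : USq × USq | p.1.1 = p.2.1} :=
      measurableSet_eq_fun (by fun_prop) (by fun_prop)
    rw [Measure.volume_eq_prod, Measure.measure_prod_null hm]
    refine ae_of_all _ fun u => ?_
    have h1 : Prod.mk u ⁻¹' {p : USq × USq | p.1.1 = p.2.1} = Prod.fst ⁻¹' {u.1} := by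
      ext v
      simp [eq_comm]
    show volume (Prod.mk u ⁻¹' {p : USq × USq | p.1.1 = p.2.1}) = 0
    rw [h1]
    exact Measure.quasiMeasurePreserving_fst.preimage_null (measure_singleton _)
  filter_upwards [(measurePreserving_pair hij).quasiMeasurePreserving.ae h] with v hv _ using hv

/-- The tuples of points with increasing first coordinates. -/
def sortedTuples (k : ℕ) : Set (Fin k → USq) := {v | Monotone fun i => (v i).1}

lemma measurableSet_sortedTuples (k : ℕ) : MeasurableSet (sortedTuples k) := by
  have : sortedTuples k = ⋂ (i : Fin k) (j : Fin k) (_ : i ≤ j), {v | (v i).1 ≤ (v j).1} := by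
    ext v
    simp only [sortedTuples, Monotone, Set.mem_ofPred_eq, Set.mem_iInter]
  rw [this]
  refine MeasurableSet.iInter fun i => MeasurableSet.iInter fun j => MeasurableSet.iInter fun _ =>
    measurableSet_le (by fun_prop) (by fun_prop)

/-- Integrals of symmetric functions reduce to sorted tuples. -/
lemma factorial_mul_setIntegral_sortedTuples {k : ℕ} (H : (Fin k → USq) → ℝ)
    (hH : Integrable H volume) (hsymm : ∀ (σ : Equiv.Perm (Fin k)) v, H (v ∘ σ) = H v) :
    (k.factorial : ℝ) * ∫ v in sortedTuples k, H v = ∫ v, H v := by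
  have hS := measurableSet_sortedTuples k
  have hmp : ∀ σ : Equiv.Perm (Fin k),
      MeasurePreserving (fun v : Fin k → USq => v ∘ σ) volume volume :=
    fun σ => measurePreserving_precomp σ σ.injective
  have hi : Integrable ((sortedTuples k).indicator H) volume := hH.indicator hS
  have h1 : ∀ σ : Equiv.Perm (Fin k),
      ∫ v : Fin k → USq, (sortedTuples k).indicator H (v ∘ σ) = ∫ v in sortedTuples k, H v := by
    intro σ
    rw [← integral_indicator hS]
    conv_rhs => rw [← (hmp σ).map_eq]
    rw [integral_map (hmp σ).measurable.aemeasurable]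
    rw [(hmp σ).map_eq]
    exact hi.aestronglyMeasurable
  calc _ = ∑ σ : Equiv.Perm (Fin k), ∫ v : Fin k → USq, (sortedTuples k).indicator H (v ∘ σ) := by
        simp only [h1, Finset.sum_const, Finset.card_univ, Fintype.card_perm, Fintype.card_fin,
          nsmul_eq_mul]
    _ = ∫ v : Fin k → USq, ∑ σ : Equiv.Perm (Fin k), (sortedTuples k).indicator H (v ∘ σ) := by
        rw [integral_finsetSum]
        intro σ _
        exact (hmp σ).integrable_comp_of_integrable hi
    _ = ∫ v, H v := by
        refine integral_congr_ae ?_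
        filter_upwards [ae_injective_fst] with v hv
        have hinj : Function.Injective fun i => (v i).1 := by
          intro i j hij
          by_contra hne
          exact hv i j hne hij
        rw [Finset.sum_eq_single (Tuple.sort fun i => (v i).1)]
        · rw [Set.indicator_of_mem, hsymm]
          exact Tuple.monotone_sort fun i => (v i).1
        · intro σ _ hσ
          refine Set.indicator_of_notMem (fun hmem => hσ ?_) _
          have h2 := Tuple.unique_monotone (f := fun i => (v i).1) (σ := σ)
            (τ := Tuple.sort fun i => (v i).1) hmem (Tuple.monotone_sort _)
          ext1 i
          exact hinj (congrFun h2 i)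
        · intro h
          exact absurd (Finset.mem_univ _) h

lemma homDensity_eq {k : ℕ} (F : SimpleGraph (Fin k)) (W : USq → USq → ℝ) :
    homDensity F W = (k.factorial : ℝ) *
      ∫ v in sortedTuples k, graphProb (fun i j => W (v i) (v j)) F := by
  rw [homDensity, ← integral_indicator (measurableSet_sortedTuples k)]
  congr 1
  refine integral_congr_ae (ae_of_all _ fun v => ?_)
  simp only
  rw [Finset.prod_mul_distrib]
  by_cases hv : v ∈ sortedTuples k
  · have hone : ∏ e ∈ Finset.univ.filter (fun p : Fin k × Fin k => p.1 < p.2),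
        (if ((v e.1).1 : ℝ) ≤ ((v e.2).1 : ℝ) then (1:ℝ) else 0) = 1 :=
      Finset.prod_eq_one fun e he => if_pos (hv (Finset.mem_filter.1 he).2.le)
    rw [Set.indicator_of_mem hv, hone, mul_one]
    rfl
  · rw [Set.indicator_of_notMem hv]
    have : ∃ i j : Fin k, i < j ∧ ¬ ((v i).1 : ℝ) ≤ ((v j).1 : ℝ) := by
      by_contra hc
      push Not at hc
      refine hv fun i j hij => ?_
      rcases hij.eq_or_lt with rfl | h
      · exact le_rfl
      · exact hc i j h
    obtain ⟨i, j, hij, hlt⟩ := this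
    have hzero : ∏ e ∈ Finset.univ.filter (fun p : Fin k × Fin k => p.1 < p.2),
        (if ((v e.1).1 : ℝ) ≤ ((v e.2).1 : ℝ) then (1:ℝ) else 0) = 0 :=
      Finset.prod_eq_zero (i := (i, j)) (by simp [hij]) (if_neg hlt)
    rw [hzero, mul_zero]

lemma measurable_graphProb {k : ℕ} (F : SimpleGraph (Fin k)) {W : USq → USq → ℝ}
    (hW : IsOrderon W) :
    Measurable fun v : Fin k → USq => graphProb (fun i j => W (v i) (v j)) F := by
  have h : ∀ i j : Fin k, Measurable fun v : Fin k → USq => W (v i) (v j) := by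
    intro i j
    have h1 : Measurable fun v : Fin k → USq => (v i, v j) := by fun_prop
    exact hW.1.comp h1
  refine Finset.measurable_fun_prod _ fun e _ => ?_
  by_cases he : F.Adj e.1 e.2
  · simp only [he, if_true]; exact h _ _
  · simp only [he, if_false]; exact (h _ _).const_sub 1

lemma integrable_graphProb {k : ℕ} (F : SimpleGraph (Fin k)) {W : USq → USq → ℝ}
    (hW : IsOrderon W) :
    Integrable fun v : Fin k → USq => graphProb (fun i j => W (v i) (v j)) F := by
  refine Integrable.of_bound (measurable_graphProb F hW).aestronglyMeasurable 1
    (ae_of_all _ fun v => ?_)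
  rw [Real.norm_eq_abs, abs_of_nonneg (graphProb_nonneg (fun i j => hW.2.1 _ _) F)]
  exact graphProb_le_one (fun i j => hW.2.1 _ _) F

lemma sum_homDensity {k : ℕ} {W : USq → USq → ℝ} (hW : IsOrderon W) :
    ∑ F : SimpleGraph (Fin k), homDensity F W = 1 := by
  simp only [homDensity_eq]
  rw [← Finset.mul_sum, ← integral_finsetSum _ fun F _ => (integrable_graphProb F hW).integrableOn]
  simp only [sum_graphProb]
  rw [factorial_mul_setIntegral_sortedTuples (fun _ => 1) (integrable_const _) (fun _ _ => rfl)]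
  simp

/-- Most of the mass of the sampled graph is on graphs with a sorted sample on which a
functional of small mean is small. -/
lemma sum_homDensity_bad_le {k : ℕ} {W : USq → USq → ℝ} (hW : IsOrderon W)
    (A : (Fin k → USq) → ℝ) (hA0 : ∀ v, 0 ≤ A v) (hA : Integrable A volume)
    (hsymm : ∀ (σ : Equiv.Perm (Fin k)) v, A (v ∘ σ) = A v) (t : ℝ) (ht : 0 ≤ t) :
    ∑ F ∈ Finset.univ.filter (fun F : SimpleGraph (Fin k) =>
      ¬ ∃ v ∈ sortedTuples k, A v + t * c4 (fun i j => W (v i) (v j)) F ≤ 1),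
      homDensity F W ≤ (∫ v, A v) + t * (2 * (k:ℝ) ^ 3) := by
  have hS := measurableSet_sortedTuples k
  simp only [homDensity_eq]
  rw [← Finset.mul_sum, ← integral_finsetSum _ fun F _ => (integrable_graphProb F hW).integrableOn]
  have hH : Integrable (fun v => A v + t * (2 * (k:ℝ) ^ 3)) (volume : Measure (Fin k → USq)) :=
    hA.add (integrable_const _)
  have e : (∫ v, A v) + t * (2 * (k:ℝ) ^ 3) =
      ∫ v : Fin k → USq, (A v + t * (2 * (k:ℝ) ^ 3)) := by
    rw [integral_add hA (integrable_const _)]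
    simp
  rw [e, ← factorial_mul_setIntegral_sortedTuples _ hH (fun σ v => by rw [hsymm])]
  refine mul_le_mul_of_nonneg_left ?_ (by positivity)
  refine setIntegral_mono_on (integrable_finsetSum _ fun F _ =>
    (integrable_graphProb F hW).integrableOn) hH.integrableOn hS fun v hv => ?_
  have hp : ∀ i j, W (v i) (v j) ∈ Set.Icc (0:ℝ) 1 := fun i j => hW.2.1 _ _
  calc _ ≤ ∑ F ∈ Finset.univ.filter (fun F : SimpleGraph (Fin k) =>
        ¬ ∃ v ∈ sortedTuples k, A v + t * c4 (fun i j => W (v i) (v j)) F ≤ 1),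
        (A v * graphProb (fun i j => W (v i) (v j)) F +
          t * (graphProb (fun i j => W (v i) (v j)) F * c4 (fun i j => W (v i) (v j)) F)) := by
        refine Finset.sum_le_sum fun F hF => ?_
        have h1 := (Finset.mem_filter.1 hF).2
        push Not at h1
        nlinarith [h1 v hv, graphProb_nonneg hp F]
    _ ≤ ∑ F, (A v * graphProb (fun i j => W (v i) (v j)) F +
          t * (graphProb (fun i j => W (v i) (v j)) F * c4 (fun i j => W (v i) (v j)) F)) := by
        refine Finset.sum_le_sum_of_subset_of_nonneg (Finset.subset_univ _) fun F _ _ => ?_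
        have h1 := graphProb_nonneg hp F
        have h2 := c4_nonneg (fun i j => W (v i) (v j)) F
        have h3 := hA0 v
        positivity
    _ ≤ _ := by
        rw [Finset.sum_add_distrib, ← Finset.mul_sum, ← Finset.mul_sum, sum_graphProb, mul_one]
        gcongr
        exact sum_graphProb_mul_c4_le (fun i j => hW.2.2 _ _) hp

/-- Grid cells of the points of a sample. -/
def sampleCells {k : ℕ} (N : ℕ) [NeZero N] (v : Fin k → USq) (r : Fin k) : Fin N × Fin N :=
  cellIdx N (v r)

lemma measurable_sampleCells {k : ℕ} (N : ℕ) [NeZero N] :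
    Measurable (sampleCells N : (Fin k → USq) → Fin k → Fin N × Fin N) :=
  measurable_pi_lambda _ fun j => (measurable_cellIdx N).comp (measurable_pi_apply j)

lemma integrable_comp_sampleCells {k : ℕ} (N : ℕ) [NeZero N]
    (g : (Fin k → Fin N × Fin N) → ℝ) :
    Integrable fun v : Fin k → USq => g (sampleCells N v) := by
  have : IsProbabilityMeasure (Measure.map (sampleCells N : (Fin k → USq) → _) volume) :=
    Measure.isProbabilityMeasure_map (measurable_sampleCells N).aemeasurable
  exact (Integrable.of_finite (f := g)).comp_measurable (measurable_sampleCells N)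

/-- The squared discrepancy of class frequencies in a sample. -/
def freqDev {k : ℕ} {V α : Type} [Fintype V] [Fintype α] (P : V → α) (c : Fin k → V) : ℝ :=
  ∑ a, (((Finset.univ.filter fun r => P (c r) = a).card : ℝ) -
    k * (Finset.univ.filter fun x => P x = a).card / Fintype.card V) ^ 2

lemma integral_freqDev_le {k N : ℕ} [NeZero N] {α : Type} [Fintype α] (P : Fin N × Fin N → α) :
    ∫ v : Fin k → USq, freqDev P (sampleCells N v) ≤ k := by
  have hN : (0:ℝ) < (N:ℝ) ^ 2 := by
    have : (0:ℝ) < N := Nat.cast_pos.2 (NeZero.pos N)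
    positivity
  have hcard : (Fintype.card (Fin N × Fin N) : ℝ) = (N:ℝ) ^ 2 := by simp [sq]
  set μ : α → ℝ := fun a => (Finset.univ.filter fun x => P x = a).card / (N:ℝ) ^ 2 with hμ
  set f : α → Fin N × Fin N → ℝ := fun a x => (if P x = a then 1 else 0) - μ a with hf
  have hcnt : ∀ a, ∑ x, (if P x = a then (1:ℝ) else 0) = (N:ℝ) ^ 2 * μ a := by
    intro a
    rw [Finset.sum_boole, hμ, mul_div_cancel₀ _ hN.ne']
  have hf0 : ∀ a, ∑ x, f a x = 0 := by
    intro a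
    rw [hf, Finset.sum_sub_distrib, hcnt, Finset.sum_const, Finset.card_univ, nsmul_eq_mul, hcard]
    ring
  have hexp : ∀ v : Fin k → USq, freqDev P (sampleCells N v) =
      ∑ a, ∑ i, ∑ j, f a (sampleCells N v i) * f a (sampleCells N v j) := by
    intro v
    refine Finset.sum_congr rfl fun a _ => ?_
    rw [← Finset.sum_mul_sum, ← sq]
    congr 1
    rw [hf, Finset.sum_sub_distrib, Finset.sum_boole, Finset.sum_const, Finset.card_univ,
      nsmul_eq_mul, hcard, Fintype.card_fin, hμ]
    ring
  have hInt : ∀ a i j, Integrable fun v : Fin k → USq =>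
      f a (sampleCells N v i) * f a (sampleCells N v j) := fun a i j =>
    integrable_comp_sampleCells N fun c => f a (c i) * f a (c j)
  have hoff : ∀ a, ∀ i j : Fin k, i ≠ j →
      ∫ v : Fin k → USq, f a (sampleCells N v i) * f a (sampleCells N v j) = 0 := by
    intro a i j hij
    have hι : Function.Injective ![i, j] := by
      intro x y hxy
      fin_cases x <;> fin_cases y <;> simp_all [eq_comm]
    have h := integral_comp_cells N ![i, j] hι fun y => ∏ l, f a (y l)
    rw [← Fintype.sum_pow, hf0] at h
    simpa [Fin.prod_univ_two, sampleCells] using h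
  have hdiag : ∀ a, ∀ i : Fin k,
      ∫ v : Fin k → USq, f a (sampleCells N v i) * f a (sampleCells N v i) ≤ μ a := by
    intro a i
    have hι : Function.Injective ![i] := Function.injective_of_subsingleton _
    have h := integral_comp_cells N ![i] hι fun y => f a (y 0) * f a (y 0)
    have h2 : ∑ y : Fin 1 → Fin N × Fin N, f a (y 0) * f a (y 0) = ∑ x, f a x * f a x :=
      Fintype.sum_equiv (Equiv.funUnique (Fin 1) (Fin N × Fin N)) _ _ fun y => rfl
    have h3 : ∑ x, f a x * f a x = (N:ℝ) ^ 2 * μ a - (N:ℝ) ^ 2 * μ a ^ 2 := by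
      have : ∀ x, f a x * f a x =
          (if P x = a then (1:ℝ) else 0) - μ a * (if P x = a then (1:ℝ) else 0) - μ a * f a x := by
        intro x
        simp only [hf]
        split_ifs <;> ring
      simp only [this]
      rw [Finset.sum_sub_distrib, Finset.sum_sub_distrib, ← Finset.mul_sum, ← Finset.mul_sum, hf0,
        hcnt]
      ring
    rw [h2, h3] at h
    have h4 : ∫ v : Fin k → USq, f a (sampleCells N v i) * f a (sampleCells N v i) =
        μ a - μ a ^ 2 := by
      refine Eq.trans (by simpa [sampleCells] using h) ?_
      rw [← mul_sub, inv_mul_cancel_left₀ hN.ne']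
    rw [h4]
    nlinarith [sq_nonneg (μ a)]
  have hμ1 : ∑ a, μ a = 1 := by
    have h1 : ∑ a, (N:ℝ) ^ 2 * μ a = (N:ℝ) ^ 2 := by
      simp only [← hcnt]
      rw [Finset.sum_comm]
      simp [sq]
    rw [← Finset.mul_sum] at h1
    exact mul_left_cancel₀ hN.ne' (h1.trans (mul_one _).symm)
  simp only [hexp]
  rw [integral_finsetSum _ fun a _ => integrable_finsetSum _ fun i _ =>
    integrable_finsetSum _ fun j _ => hInt a i j]
  calc _ ≤ ∑ a, k * μ a := by
        refine Finset.sum_le_sum fun a _ => ?_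
        rw [integral_finsetSum _ fun i _ => integrable_finsetSum _ fun j _ => hInt a i j]
        calc _ ≤ ∑ i : Fin k, μ a := by
              refine Finset.sum_le_sum fun i _ => ?_
              rw [integral_finsetSum _ fun j _ => hInt a i j, Finset.sum_eq_single i]
              · exact hdiag a i
              · exact fun j _ hj => hoff a i j hj.symm
              · exact fun h => absurd (Finset.mem_univ _) h
          _ = _ := by simp
    _ = k := by rw [← Finset.mul_sum, hμ1, mul_one]

lemma card_not_injective_le {k : ℕ} (hk : 6 ≤ k) :
    ((Finset.univ.filter fun ι : Fin 6 → Fin k => ¬ Function.Injective ι).card : ℝ) ≤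
      15 * (k:ℝ) ^ 5 := by
  have h1 := Finset.card_filter_add_card_filter_not (s := (Finset.univ : Finset (Fin 6 → Fin k)))
    (fun ι => Function.Injective ι)
  have h2 : (Finset.univ.filter fun ι : Fin 6 → Fin k => Function.Injective ι).card =
      k.descFactorial 6 := by
    rw [← Fintype.card_subtype, Fintype.card_congr (Equiv.subtypeInjectiveEquivEmbedding _ _),
      Fintype.card_embedding_eq]
    simp
  rw [h2, Finset.card_univ, Fintype.card_fun, Fintype.card_fin, Fintype.card_fin] at h1
  have h3 : (k.descFactorial 6 : ℝ) =
      (k - 5) * ((k - 4) * ((k - 3) * ((k - 2) * ((k - 1) * k)))) := by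
    obtain ⟨z, rfl⟩ := Nat.exists_eq_add_of_le hk
    have e : ∀ i ≤ 6, 6 + z - i = (6 - i) + z := by intro i hi; omega
    simp only [Nat.descFactorial_succ, Nat.descFactorial_zero]
    rw [e 5 (by norm_num), e 4 (by norm_num), e 3 (by norm_num), e 2 (by norm_num),
      e 1 (by norm_num), e 0 (by norm_num)]
    push_cast
    ring
  have h4 : (k.descFactorial 6 : ℝ) +
      ((Finset.univ.filter fun ι : Fin 6 → Fin k => ¬ Function.Injective ι).card : ℝ) =
      (k:ℝ) ^ 6 := by exact_mod_cast h1
  have hk' : (6:ℝ) ≤ k := by exact_mod_cast hk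
  obtain ⟨z, hz⟩ : ∃ z : ℝ, (k:ℝ) = 6 + z := ⟨k - 6, by ring⟩
  have hz0 : 0 ≤ z := by linarith
  have h5 : (k - 5) * ((k - 4) * ((k - 3) * ((k - 2) * ((k - 1) * (k:ℝ))))) =
      (k:ℝ) ^ 6 - 15 * (k:ℝ) ^ 5 + ((k:ℝ) ^ 3 * (285 + 85 * z) + k * (1524 + 274 * z)) := by
    rw [hz]; ring
  have h6 : 0 ≤ (k:ℝ) ^ 3 * (285 + 85 * z) + k * (1524 + 274 * z) := by positivity
  linarith

lemma integral_cyc6_le {k N : ℕ} [NeZero N] (hk : 6 ≤ k) (R : Fin N × Fin N → Fin N × Fin N → ℝ)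
    {B X : ℝ} (hB : ∀ x y, |R x y| ≤ B) (hX : 0 ≤ X) (hR : cyc6 R ≤ ((N:ℝ) ^ 2) ^ 6 * X) :
    ∫ v : Fin k → USq, cyc6 (fun i j => R (sampleCells N v i) (sampleCells N v j)) ≤
      (k:ℝ) ^ 6 * X + 15 * (k:ℝ) ^ 5 * B ^ 6 := by
  have hN : (0:ℝ) < (N:ℝ) ^ 2 := by
    have : (0:ℝ) < N := Nat.cast_pos.2 (NeZero.pos N)
    positivity
  have hB0 : 0 ≤ B := (abs_nonneg _).trans (hB 0 0)
  unfold cyc6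
  rw [integral_finsetSum _ fun ι _ => integrable_comp_sampleCells N fun c =>
    R (c (ι 0)) (c (ι 1)) * R (c (ι 1)) (c (ι 2)) * R (c (ι 2)) (c (ι 3)) *
      R (c (ι 3)) (c (ι 4)) * R (c (ι 4)) (c (ι 5)) * R (c (ι 5)) (c (ι 0))]
  calc _ ≤ ∑ ι : Fin 6 → Fin k, (X + if ¬ Function.Injective ι then B ^ 6 else 0) := by
        refine Finset.sum_le_sum fun ι _ => ?_
        by_cases hι : Function.Injective ι
        · rw [if_neg (not_not.2 hι), add_zero]
          have h := integral_comp_cells N ι hι fun y => R (y 0) (y 1) * R (y 1) (y 2) *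
            R (y 2) (y 3) * R (y 3) (y 4) * R (y 4) (y 5) * R (y 5) (y 0)
          refine (le_of_eq h).trans ?_
          rw [inv_mul_le_iff₀ (by positivity)]
          exact hR
        · rw [if_pos hι]
          have h : ∀ v : Fin k → USq, R (sampleCells N v (ι 0)) (sampleCells N v (ι 1)) *
              R (sampleCells N v (ι 1)) (sampleCells N v (ι 2)) *
              R (sampleCells N v (ι 2)) (sampleCells N v (ι 3)) *
              R (sampleCells N v (ι 3)) (sampleCells N v (ι 4)) *
              R (sampleCells N v (ι 4)) (sampleCells N v (ι 5)) *
              R (sampleCells N v (ι 5)) (sampleCells N v (ι 0)) ≤ B ^ 6 := by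
            intro v
            refine (le_abs_self _).trans ?_
            simp only [abs_mul]
            have e : B ^ 6 = B * B * B * B * B * B := by ring
            rw [e]
            gcongr <;> exact hB _ _
          calc _ ≤ ∫ v : Fin k → USq, B ^ 6 := by
                refine integral_mono (integrable_comp_sampleCells N fun c =>
                  R (c (ι 0)) (c (ι 1)) * R (c (ι 1)) (c (ι 2)) * R (c (ι 2)) (c (ι 3)) *
                  R (c (ι 3)) (c (ι 4)) * R (c (ι 4)) (c (ι 5)) * R (c (ι 5)) (c (ι 0)))
                  (integrable_const _) h
            _ ≤ X + B ^ 6 := by simpa using hX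
    _ = (k:ℝ) ^ 6 * X + (Finset.univ.filter fun ι : Fin 6 → Fin k =>
          ¬ Function.Injective ι).card * B ^ 6 := by
        rw [Finset.sum_add_distrib, ← Finset.sum_filter, Finset.sum_const, Finset.sum_const]
        simp
    _ ≤ _ := by
        have := card_not_injective_le hk
        gcongr

/-- The total deviation of `W` from its grid approximation along a sample. -/
def gridDev {k N : ℕ} [NeZero N] (W : USq → USq → ℝ) (w : Fin N × Fin N → Fin N × Fin N → ℝ)
    (v : Fin k → USq) : ℝ :=
  ∑ i, ∑ j, if i = j then 0 else |W (v i) (v j) - w (cellIdx N (v i)) (cellIdx N (v j))|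

lemma integrable_gridDev_term {k N : ℕ} [NeZero N] {W : USq → USq → ℝ} (hW : IsOrderon W)
    (w : Fin N × Fin N → Fin N × Fin N → ℝ) (i j : Fin k) :
    Integrable fun v : Fin k → USq => if i = j then 0 else
      |W (v i) (v j) - w (cellIdx N (v i)) (cellIdx N (v j))| := by
  split_ifs with h
  · exact integrable_zero _ _ _
  · have h1 : Measurable fun v : Fin k → USq => (v i, v j) := by fun_prop
    have h2 : Measurable fun v : Fin k → USq => W (v i) (v j) := hW.1.comp h1
    have h3 := integrable_comp_sampleCells N fun c : Fin k → _ => w (c i) (c j)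
    have h4 : Integrable fun v : Fin k → USq => W (v i) (v j) := by
      refine Integrable.of_bound h2.aestronglyMeasurable 1 (ae_of_all _ fun v => ?_)
      rw [Real.norm_eq_abs, abs_le]
      have := hW.2.1 (v i) (v j)
      constructor <;> linarith [this.1, this.2]
    exact (h4.sub h3).abs

lemma integral_gridDev_le {k N : ℕ} [NeZero N] {W : USq → USq → ℝ} (hW : IsOrderon W)
    {w : Fin N × Fin N → Fin N × Fin N → ℝ} {η : ℝ}
    (hη : ∫ p : USq × USq, |W p.1 p.2 - w (cellIdx N p.1) (cellIdx N p.2)| ≤ η) :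
    ∫ v : Fin k → USq, gridDev W w v ≤ (k:ℝ) ^ 2 * η := by
  have hη0 : 0 ≤ η := (integral_nonneg fun _ => abs_nonneg _).trans hη
  unfold gridDev
  rw [integral_finsetSum _ fun i _ => integrable_finsetSum _ fun j _ =>
    integrable_gridDev_term hW w i j]
  calc _ ≤ ∑ i : Fin k, ∑ j : Fin k, η := by
        refine Finset.sum_le_sum fun i _ => ?_
        rw [integral_finsetSum _ fun j _ => integrable_gridDev_term hW w i j]
        refine Finset.sum_le_sum fun j _ => ?_
        by_cases hij : i = j
        · simpa [hij] using hη0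
        · simp only [hij, if_false]
          refine le_of_eq_of_le ?_ hη
          rw [← (measurePreserving_pair hij).map_eq, integral_map (by fun_prop)]
          have hw' : Measurable fun p : USq × USq => w (cellIdx N p.1) (cellIdx N p.2) := by
            have h1 : Measurable fun p : USq × USq => (cellIdx N p.1, cellIdx N p.2) :=
              ((measurable_cellIdx N).comp measurable_fst).prodMk
                ((measurable_cellIdx N).comp measurable_snd)
            exact (measurable_of_finite (Function.uncurry w)).comp h1
          exact (hW.1.sub hw').abs.aestronglyMeasurable
    _ = _ := by simp; ring

lemma abs_bilin_le_of_abs_le {ι : Type} [Fintype ι] (M : ι → ι → ℝ) (a b : ι → ℝ)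
    (ha : ∀ i, |a i| ≤ 1) (hb : ∀ i, |b i| ≤ 1) :
    |∑ i, ∑ j, a i * b j * M i j| ≤ ∑ i, ∑ j, |M i j| := by
  refine (Finset.abs_sum_le_sum_abs _ _).trans (Finset.sum_le_sum fun i _ => ?_)
  refine (Finset.abs_sum_le_sum_abs _ _).trans (Finset.sum_le_sum fun j _ => ?_)
  rw [abs_mul, abs_mul]
  have : |a i| * |b j| ≤ 1 := mul_le_one₀ (ha i) (abs_nonneg _) (hb j)
  exact mul_le_of_le_one_left (abs_nonneg _) this

lemma abs_bilin_edge_sub_le {k N : ℕ} [NeZero N] {W : USq → USq → ℝ}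
    {w R D : Fin N × Fin N → Fin N × Fin N → ℝ} {δ : ℝ} (hδ : 0 ≤ δ)
    (hw : ∀ x y, 0 ≤ w x y ∧ w x y ≤ 1) (hR : ∀ x y, R x y = R y x)
    (hD : ∀ x y, |w x y - R x y - D x y| ≤ δ) (hk1 : 1 ≤ k * δ) (hk4 : 32 ≤ k * δ ^ 4)
    {v : Fin k → USq} {F : SimpleGraph (Fin k)}
    (hc4 : c4 (fun i j => W (v i) (v j)) F ≤ 32 * (k:ℝ) ^ 3)
    (hcyc : cyc6 (fun i j => R (sampleCells N v i) (sampleCells N v j)) ≤ 32 * (k:ℝ) ^ 6 * δ ^ 6)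
    (hgrid : gridDev W w v ≤ (k:ℝ) ^ 2 * δ) {a b : Fin k → ℝ} (ha : ∀ i, |a i| ≤ 1)
    (hb : ∀ i, |b i| ≤ 1) :
    |∑ i, ∑ j, a i * b j * ((if F.Adj i j then 1 else 0) -
      D (sampleCells N v i) (sampleCells N v j))| ≤ 6 * (k:ℝ) ^ 2 * δ := by
  set c := sampleCells N v with hc
  have hk0 : (0:ℝ) ≤ k := Nat.cast_nonneg k
  have h1 : |∑ i, ∑ j, a i * b j * edgeDev (fun i j => W (v i) (v j)) F i j| ≤ (k:ℝ) ^ 2 * δ := by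
    rw [← pow_le_pow_iff_left₀ (abs_nonneg _) (by positivity) (by norm_num : (4:ℕ) ≠ 0),
      Even.pow_abs (by decide)]
    calc _ ≤ (k:ℝ) ^ 4 * c4 (fun i j => W (v i) (v j)) F :=
          bilin_edgeDev_pow_four_le _ F a b ha hb
      _ ≤ (k:ℝ) ^ 4 * (32 * (k:ℝ) ^ 3) := by gcongr
      _ = (k:ℝ) ^ 7 * 32 := by ring
      _ ≤ (k:ℝ) ^ 7 * (k * δ ^ 4) := by gcongr
      _ = _ := by ring
  have h2 : |∑ i, ∑ j, a i * b j * R (c i) (c j)| ≤ 2 * ((k:ℝ) ^ 2 * δ) := by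
    rw [← pow_le_pow_iff_left₀ (abs_nonneg _) (by positivity) (by norm_num : (6:ℕ) ≠ 0),
      Even.pow_abs (by decide)]
    calc _ ≤ ((Fintype.card (Fin k) : ℕ) : ℝ) ^ 6 * cyc6 (fun i j => R (c i) (c j)) :=
          bilin_pow_six_le (fun i j => R (c i) (c j)) (fun i j => hR _ _) a b ha hb
      _ ≤ (k:ℝ) ^ 6 * (32 * (k:ℝ) ^ 6 * δ ^ 6) := by
          rw [Fintype.card_fin]
          gcongr
      _ ≤ (k:ℝ) ^ 6 * (64 * (k:ℝ) ^ 6 * δ ^ 6) := by gcongr; norm_num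
      _ = _ := by ring
  have h3 := (abs_bilin_le_of_abs_le (fun i j => if i = j then (0:ℝ) else
    W (v i) (v j) - w (c i) (c j)) a b ha hb).trans (le_trans (le_of_eq ?_) hgrid)
  swap
  · unfold gridDev
    refine Finset.sum_congr rfl fun i _ => Finset.sum_congr rfl fun j _ => ?_
    split_ifs
    · simp
    · rfl
  have h4 : |∑ i, ∑ j, a i * b j * (w (c i) (c j) - R (c i) (c j) - D (c i) (c j))| ≤
      (k:ℝ) ^ 2 * δ := by
    refine (abs_bilin_le_of_abs_le (fun i j => w (c i) (c j) - R (c i) (c j) - D (c i) (c j))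
      a b ha hb).trans ?_
    calc _ ≤ ∑ i : Fin k, ∑ j : Fin k, δ :=
          Finset.sum_le_sum fun i _ => Finset.sum_le_sum fun j _ => hD _ _
      _ = _ := by simp; ring
  have h5 : |∑ i, ∑ j, a i * b j * (if i = j then w (c i) (c j) else 0)| ≤ (k:ℝ) ^ 2 * δ := by
    refine (abs_bilin_le_of_abs_le (fun i j => if i = j then w (c i) (c j) else 0)
      a b ha hb).trans ?_
    calc _ ≤ ∑ i : Fin k, ∑ j : Fin k, (if i = j then (1:ℝ) else 0) := by
          refine Finset.sum_le_sum fun i _ => Finset.sum_le_sum fun j _ => ?_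
          split_ifs
          · rw [abs_of_nonneg (hw _ _).1]; exact (hw _ _).2
          · simp
      _ = k * 1 := by simp
      _ ≤ k * (k * δ) := by gcongr
      _ = _ := by ring
  have e : ∑ i, ∑ j, a i * b j * ((if F.Adj i j then 1 else 0) - D (c i) (c j)) =
      ∑ i, ∑ j, a i * b j * edgeDev (fun i j => W (v i) (v j)) F i j +
      ∑ i, ∑ j, a i * b j * R (c i) (c j) +
      ∑ i, ∑ j, a i * b j * (if i = j then (0:ℝ) else W (v i) (v j) - w (c i) (c j)) +
      ∑ i, ∑ j, a i * b j * (w (c i) (c j) - R (c i) (c j) - D (c i) (c j)) -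
      ∑ i, ∑ j, a i * b j * (if i = j then w (c i) (c j) else 0) := by
    simp only [← Finset.sum_add_distrib, ← Finset.sum_sub_distrib]
    refine Finset.sum_congr rfl fun i _ => Finset.sum_congr rfl fun j _ => ?_
    by_cases hij : i = j
    · subst hij
      simp only [edgeDev_self, SimpleGraph.irrefl, if_true, if_false]
      ring
    · simp only [edgeDev, hij, if_false]
      ring
  rw [e]
  rw [abs_le] at h1 h2 h3 h4 h5 ⊢
  constructor <;> linarith [h1.1, h1.2, h2.1, h2.2, h3.1, h3.2, h4.1, h4.2, h5.1, h5.2]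

/-- The total discrepancy of class frequencies in a sample. -/
def freqGap {k : ℕ} {V α : Type} [Fintype V] [Fintype α] (P : V → α) (c : Fin k → V) : ℝ :=
  ∑ a, |((Finset.univ.filter fun r => P (c r) = a).card : ℝ) -
    k * (Finset.univ.filter fun x => P x = a).card / Fintype.card V|

lemma freqGap_le {k : ℕ} {V α : Type} [Fintype V] [Fintype α] (P : V → α) (c : Fin k → V)
    {s : ℝ} (hs : 0 ≤ s) (h : Fintype.card α * freqDev P c ≤ s ^ 2) : freqGap P c ≤ s := by
  refine (pow_le_pow_iff_left₀ (Finset.sum_nonneg fun a _ => abs_nonneg _) hs two_ne_zero).1 ?_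
  have h1 := sq_sum_le_card_mul_sum_sq (s := (Finset.univ : Finset α))
    (f := fun a => |((Finset.univ.filter fun r => P (c r) = a).card : ℝ) -
      k * (Finset.univ.filter fun x => P x = a).card / Fintype.card V|)
  simp only [sq_abs] at h1
  exact h1.trans h

lemma freqDev_comp_perm {k : ℕ} {V α : Type} [Fintype V] [Fintype α] (P : V → α) (c : Fin k → V)
    (σ : Equiv.Perm (Fin k)) : freqDev P (c ∘ σ) = freqDev P c := by
  refine Finset.sum_congr rfl fun a _ => ?_
  congr 3
  exact Finset.card_equiv σ fun i => by simp

lemma cyc6_comp_perm {k : ℕ} (M : Fin k → Fin k → ℝ) (σ : Equiv.Perm (Fin k)) :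
    cyc6 (fun i j => M (σ i) (σ j)) = cyc6 M :=
  Fintype.sum_equiv (Equiv.arrowCongr (Equiv.refl _) σ) _ _ fun _ => rfl

lemma gridDev_comp_perm {k N : ℕ} [NeZero N] (W : USq → USq → ℝ)
    (w : Fin N × Fin N → Fin N × Fin N → ℝ) (v : Fin k → USq) (σ : Equiv.Perm (Fin k)) :
    gridDev W w (v ∘ σ) = gridDev W w v := by
  unfold gridDev
  refine Fintype.sum_equiv σ _ _ fun i => Fintype.sum_equiv σ _ _ fun j => ?_
  simp

/-- The class of a grid cell: a coarse position together with a part. -/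
def cellClass {N L : ℕ} {β : Type} (hNL : N / L * L = N) (h : Fin N × Fin N → β)
    (x : Fin N × Fin N) : Fin L × β :=
  (⟨(x.1 : ℕ) / (N / L), by
    have := x.1.2
    exact Nat.div_lt_of_lt_mul (by rwa [hNL])⟩, h x)

/-- Outside a small set of graphs, a sample reveals an approximate block structure of the
orderon. -/
lemma exists_structured_samples {W : USq → USq → ℝ} (hW : IsOrderon W) {k N L : ℕ} [NeZero N]
    (hL : 1 ≤ L) (hNL : N / L * L = N) {δ : ℝ} (hδ : 0 ≤ δ) (hδL : δ ^ 6 = ((L:ℝ) ^ 4)⁻¹)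
    (hδ1 : 1 / (L:ℝ) ≤ δ)
    (hk : 1000 * (L:ℝ) ^ 28 * (8 * (L:ℝ) ^ 5) ^ (L ^ 2) ≤ k)
    (w : Fin N × Fin N → Fin N × Fin N → ℝ) (hws : ∀ x y, w x y = w y x)
    (hw : ∀ x y, 0 ≤ w x y ∧ w x y ≤ 1)
    (hWw : ∫ p : USq × USq, |W p.1 p.2 - w (cellIdx N p.1) (cellIdx N p.2)| ≤ 1 / (16 * L)) :
    ∃ (β : Type) (_ : Fintype β) (h : Fin N × Fin N → β) (D : β → β → ℝ)
      (R : Fin N × Fin N → Fin N × Fin N → ℝ),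
      (∀ x y, R x y = R y x) ∧ (∀ x y, |w x y - R x y - D (h x) (h y)| ≤ 1 / (L:ℝ)) ∧
      (∀ x y, |D (h x) (h y)| ≤ 4 * (L:ℝ) ^ 4) ∧
      cyc6 R ≤ ((N:ℝ) ^ 2) ^ 6 * δ ^ 6 ∧
      ∃ Good : SimpleGraph (Fin k) → Prop,
        ∑ F ∈ Finset.univ.filter (fun F => ¬ Good F), homDensity F W ≤ 1 / 4 ∧
        ∀ F, Good F → ∃ c : Fin k → Fin N × Fin N,
          (∀ r s, r ≤ s → (c r).1 ≤ (c s).1) ∧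
          freqGap (cellClass hNL h) c ≤ 1 / (6 * (L:ℝ) ^ 6) * k ∧
          ∀ a b : Fin k → ℝ, (∀ i, |a i| ≤ 1) → (∀ i, |b i| ≤ 1) →
            |∑ i, ∑ j, a i * b j * ((if F.Adj i j then 1 else 0) - D (h (c i)) (h (c j)))| ≤
              6 * (k:ℝ) ^ 2 * δ := by
  obtain ⟨β, _, h, D, R, hβ, hR, hRb, hD, hcyc⟩ := exists_regularity w hws hw L hL
  have hL0 : (0:ℝ) < L := by exact_mod_cast hL
  have hL1 : (1:ℝ) ≤ L := by exact_mod_cast hL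
  have hcard : (Fintype.card (Fin N × Fin N) : ℝ) = (N:ℝ) ^ 2 := by simp [sq]
  rw [hcard, ← hδL] at hcyc
  have hq1 : (1:ℝ) ≤ (8 * (L:ℝ) ^ 5) ^ (L ^ 2) := by
    refine one_le_pow₀ ?_
    have : (1:ℝ) ≤ (L:ℝ) ^ 5 := one_le_pow₀ hL1
    linarith
  set q : ℝ := (8 * (L:ℝ) ^ 5) ^ (L ^ 2) with hq
  have hk28 : 1000 * (L:ℝ) ^ 28 ≤ k := by
    refine le_trans ?_ hk
    exact le_mul_of_one_le_right (by positivity) hq1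
  have hk1000 : (1000:ℝ) ≤ k := by
    refine le_trans ?_ hk28
    have : (1:ℝ) ≤ (L:ℝ) ^ 28 := one_le_pow₀ hL1
    linarith
  have hk6 : 6 ≤ k := by
    have : ((6:ℕ):ℝ) ≤ k := by
      push_cast
      linarith
    exact_mod_cast this
  have hk0 : (0:ℝ) < k := by linarith
  have hδ0 : 0 < δ := lt_of_lt_of_le (by positivity) hδ1
  have hLδ : 1 ≤ L * δ := by
    rw [div_le_iff₀ hL0] at hδ1
    linarith
  have hk1 : 1 ≤ k * δ := by
    have : (L:ℝ) ≤ k := by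
      refine le_trans ?_ hk28
      have : (L:ℝ) ^ 1 ≤ (L:ℝ) ^ 28 := pow_le_pow_right₀ hL1 (by norm_num)
      linarith
    nlinarith
  have hk4 : 32 ≤ k * δ ^ 4 := by
    have h1 : 32 * (L:ℝ) ^ 4 ≤ k := by
      refine le_trans ?_ hk28
      have : (L:ℝ) ^ 4 ≤ (L:ℝ) ^ 28 := pow_le_pow_right₀ hL1 (by norm_num)
      have : (0:ℝ) < (L:ℝ) ^ 28 := by positivity
      linarith
    have h2 : 1 ≤ (L * δ) ^ 4 := one_le_pow₀ hLδ
    have h3 : 0 < δ ^ 4 := by positivity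
    calc (32:ℝ) ≤ 32 * (L * δ) ^ 4 := by linarith
      _ = 32 * (L:ℝ) ^ 4 * δ ^ 4 := by ring
      _ ≤ _ := by gcongr
  have hB6 : 15 * (k:ℝ) ^ 5 * (2 * (L:ℝ) ^ 4) ^ 6 ≤ (k:ℝ) ^ 6 * δ ^ 6 := by
    rw [hδL]
    have : 15 * (k:ℝ) ^ 5 * (2 * (L:ℝ) ^ 4) ^ 6 =
        (k:ℝ) ^ 5 * (960 * (L:ℝ) ^ 28) * ((L:ℝ) ^ 4)⁻¹ := by
      field_simp
      ring
    rw [this]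
    have h1 : 960 * (L:ℝ) ^ 28 ≤ k := by
      refine le_trans ?_ hk28
      gcongr
      norm_num
    calc _ ≤ (k:ℝ) ^ 5 * k * ((L:ℝ) ^ 4)⁻¹ := by gcongr
      _ = _ := by ring
  have hDb : ∀ x y, |D (h x) (h y)| ≤ 4 * (L:ℝ) ^ 4 := by
    intro x y
    have h1 := abs_le.1 (hD x y)
    have h2 := abs_le.1 (hRb x y)
    have h3 := hw x y
    have h4 : (1:ℝ) ≤ (L:ℝ) ^ 4 := one_le_pow₀ hL1
    have h5 : 1 / (L:ℝ) ≤ 1 := by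
      rw [div_le_one hL0]; exact hL1
    rw [abs_le]
    constructor <;> linarith [h1.1, h1.2, h2.1, h2.2, h3.1, h3.2]
  refine ⟨β, inferInstance, h, D, R, hR, hD, hDb, hcyc, ?_⟩
  set P := cellClass hNL h with hP
  set A : (Fin k → USq) → ℝ := fun v =>
    (16 * (k:ℝ))⁻¹ * freqDev P (sampleCells N v) +
    (32 * (k:ℝ) ^ 6 * δ ^ 6)⁻¹ *
      cyc6 (fun i j => R (sampleCells N v i) (sampleCells N v j)) +
    ((k:ℝ) ^ 2 * δ)⁻¹ * gridDev W w v with hA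
  have hfreq0 : ∀ v : Fin k → USq, 0 ≤ freqDev P (sampleCells N v) := fun v =>
    Finset.sum_nonneg fun a _ => sq_nonneg _
  have hcyc0 : ∀ v : Fin k → USq,
      0 ≤ cyc6 (fun i j => R (sampleCells N v i) (sampleCells N v j)) := fun v =>
    cyc6_nonneg _ fun i j => hR _ _
  have hgrid0 : ∀ v : Fin k → USq, 0 ≤ gridDev W w v := by
    intro v
    refine Finset.sum_nonneg fun i _ => Finset.sum_nonneg fun j _ => ?_
    split_ifs
    · exact le_rfl
    · exact abs_nonneg _
  have hA0 : ∀ v, 0 ≤ A v := by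
    intro v
    have h1 := hfreq0 v
    have h2 := hcyc0 v
    have h3 := hgrid0 v
    positivity
  have hi1 : Integrable fun v : Fin k → USq => freqDev P (sampleCells N v) :=
    integrable_comp_sampleCells N (freqDev P)
  have hi2 : Integrable fun v : Fin k → USq =>
      cyc6 (fun i j => R (sampleCells N v i) (sampleCells N v j)) :=
    integrable_comp_sampleCells N fun c => cyc6 (fun i j => R (c i) (c j))
  have hi3 : Integrable fun v : Fin k → USq => gridDev W w v :=
    integrable_finsetSum _ fun i _ => integrable_finsetSum _ fun j _ =>
      integrable_gridDev_term hW w i j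
  have hi12 : Integrable fun v : Fin k → USq =>
      (16 * (k:ℝ))⁻¹ * freqDev P (sampleCells N v) +
      (32 * (k:ℝ) ^ 6 * δ ^ 6)⁻¹ *
        cyc6 (fun i j => R (sampleCells N v i) (sampleCells N v j)) :=
    (hi1.const_mul _).add (hi2.const_mul _)
  have hAi : Integrable A := hi12.add (hi3.const_mul _)
  have hAsymm : ∀ (σ : Equiv.Perm (Fin k)) v, A (v ∘ σ) = A v := by
    intro σ v
    have h1 : freqDev P (sampleCells N (v ∘ σ)) = freqDev P (sampleCells N v) :=
      freqDev_comp_perm P (sampleCells N v) σ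
    have h2 : cyc6 (fun i j => R (sampleCells N (v ∘ σ) i) (sampleCells N (v ∘ σ) j)) =
        cyc6 (fun i j => R (sampleCells N v i) (sampleCells N v j)) :=
      cyc6_comp_perm (fun i j => R (sampleCells N v i) (sampleCells N v j)) σ
    simp only [hA]
    rw [h1, h2, gridDev_comp_perm]
  have hAint : ∫ v, A v ≤ 1 / 16 + 1 / 16 + 1 / 16 := by
    have e : ∫ v, A v = (16 * (k:ℝ))⁻¹ * (∫ v : Fin k → USq, freqDev P (sampleCells N v)) +
        (32 * (k:ℝ) ^ 6 * δ ^ 6)⁻¹ *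
          (∫ v : Fin k → USq, cyc6 (fun i j => R (sampleCells N v i) (sampleCells N v j))) +
        ((k:ℝ) ^ 2 * δ)⁻¹ * ∫ v : Fin k → USq, gridDev W w v := by
      rw [← integral_const_mul, ← integral_const_mul, ← integral_const_mul,
        ← integral_add (hi1.const_mul _) (hi2.const_mul _),
        ← integral_add hi12 (hi3.const_mul _)]
    rw [e]
    refine add_le_add (add_le_add ?_ ?_) ?_
    · rw [inv_mul_le_iff₀ (by positivity)]
      linarith [integral_freqDev_le (k := k) P]
    · rw [inv_mul_le_iff₀ (by positivity)]
      refine (integral_cyc6_le hk6 R hRb (by positivity) hcyc).trans ?_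
      linarith
    · rw [inv_mul_le_iff₀ (by positivity)]
      refine (integral_gridDev_le hW hWw).trans ?_
      have : 1 / (16 * (L:ℝ)) = 1 / (L:ℝ) * (1 / 16) := by field_simp
      rw [this, ← mul_assoc]
      gcongr
  refine ⟨fun F => ∃ v ∈ sortedTuples k,
    A v + (32 * (k:ℝ) ^ 3)⁻¹ * c4 (fun i j => W (v i) (v j)) F ≤ 1, ?_, ?_⟩
  · refine (sum_homDensity_bad_le hW A hA0 hAi hAsymm (32 * (k:ℝ) ^ 3)⁻¹ (by positivity)).trans ?_
    have : (32 * (k:ℝ) ^ 3)⁻¹ * (2 * (k:ℝ) ^ 3) = 1 / 16 := by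
      field_simp
      norm_num
    rw [this]
    linarith
  · rintro F ⟨v, hv, hle⟩
    have hc0 := c4_nonneg (fun i j => W (v i) (v j)) F
    have h1 : 0 ≤ (16 * (k:ℝ))⁻¹ * freqDev P (sampleCells N v) :=
      mul_nonneg (by positivity) (hfreq0 v)
    have h2 : 0 ≤ (32 * (k:ℝ) ^ 6 * δ ^ 6)⁻¹ *
        cyc6 (fun i j => R (sampleCells N v i) (sampleCells N v j)) :=
      mul_nonneg (by positivity) (hcyc0 v)
    have h3 : 0 ≤ ((k:ℝ) ^ 2 * δ)⁻¹ * gridDev W w v := mul_nonneg (by positivity) (hgrid0 v)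
    have h4 : 0 ≤ (32 * (k:ℝ) ^ 3)⁻¹ * c4 (fun i j => W (v i) (v j)) F :=
      mul_nonneg (by positivity) hc0
    simp only [hA] at hle
    have g1 : (16 * (k:ℝ))⁻¹ * freqDev P (sampleCells N v) ≤ 1 := by linarith
    have g2 : (32 * (k:ℝ) ^ 6 * δ ^ 6)⁻¹ *
        cyc6 (fun i j => R (sampleCells N v i) (sampleCells N v j)) ≤ 1 := by linarith
    have g3 : ((k:ℝ) ^ 2 * δ)⁻¹ * gridDev W w v ≤ 1 := by linarith
    have g4 : (32 * (k:ℝ) ^ 3)⁻¹ * c4 (fun i j => W (v i) (v j)) F ≤ 1 := by linarith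
    rw [inv_mul_le_iff₀ (by positivity), mul_one] at g1 g2 g3 g4
    refine ⟨sampleCells N v, ?_, ?_, ?_⟩
    · intro r s hrs
      show min ⌊(N:ℝ) * (v r).1⌋₊ (N - 1) ≤ min ⌊(N:ℝ) * (v s).1⌋₊ (N - 1)
      have h5 : ((v r).1 : ℝ) ≤ (v s).1 := hv hrs
      exact min_le_min_right _ (Nat.floor_le_floor (by gcongr))
    · refine freqGap_le _ _ (by positivity) ?_
      have hα : (Fintype.card (Fin L × β) : ℝ) ≤ L * q := by
        rw [Fintype.card_prod, Fintype.card_fin, Nat.cast_mul]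
        gcongr
      calc _ ≤ (L * q) * (16 * (k:ℝ)) := by
            refine mul_le_mul hα g1 (hfreq0 v) (by positivity)
        _ ≤ _ := by
            have e : (1 / (6 * (L:ℝ) ^ 6) * k) ^ 2 = k * k / (36 * (L:ℝ) ^ 12) := by
              field_simp
              ring
            rw [e, le_div_iff₀ (by positivity)]
            have : 576 * (L:ℝ) ^ 13 * q ≤ k := by
              refine le_trans ?_ hk
              have : (L:ℝ) ^ 13 ≤ (L:ℝ) ^ 28 := pow_le_pow_right₀ hL1 (by norm_num)
              gcongr
              linarith
            nlinarith
    · intro a b ha hb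
      exact abs_bilin_edge_sub_le (D := fun x y => D (h x) (h y)) hδ hw hR
        (fun x y => (hD x y).trans hδ1) hk1 hk4 g4 g2 g3 ha hb

lemma integral_comp_cellIdx (N : ℕ) [NeZero N] (ν : Measure USq) [IsFiniteMeasure ν]
    (g : Fin N × Fin N → ℝ) :
    ∫ u, g (cellIdx N u) ∂ν = ∑ x, ν.real (cellIdx N ⁻¹' {x}) * g x := by
  have h1 := measurable_cellIdx N
  rw [← integral_map (f := g) h1.aemeasurable (measurable_of_finite g).aestronglyMeasurable,
    integral_fintype Integrable.of_finite]
  refine Finset.sum_congr rfl fun x _ => ?_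
  rw [smul_eq_mul, map_measureReal_apply h1 (measurableSet_singleton x)]

lemma measurable_comp_cellIdx_pair (N : ℕ) [NeZero N] (g : Fin N × Fin N → Fin N × Fin N → ℝ) :
    Measurable fun p : USq × USq => g (cellIdx N p.1) (cellIdx N p.2) := by
  have h1 : Measurable fun p : USq × USq => (cellIdx N p.1, cellIdx N p.2) :=
    ((measurable_cellIdx N).comp measurable_fst).prodMk
      ((measurable_cellIdx N).comp measurable_snd)
  exact (measurable_of_finite (Function.uncurry g)).comp h1

lemma integrable_comp_cellIdx_pair (N : ℕ) [NeZero N] (g : Fin N × Fin N → Fin N × Fin N → ℝ)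
    (μ : Measure (USq × USq)) [IsFiniteMeasure μ] :
    Integrable (fun p : USq × USq => g (cellIdx N p.1) (cellIdx N p.2)) μ := by
  refine Integrable.of_bound (measurable_comp_cellIdx_pair N g).aestronglyMeasurable
    (∑ x, ∑ y, |g x y|) (ae_of_all _ fun p => ?_)
  rw [Real.norm_eq_abs]
  calc |g (cellIdx N p.1) (cellIdx N p.2)| ≤ ∑ y, |g (cellIdx N p.1) y| :=
        Finset.single_le_sum (f := fun y => |g (cellIdx N p.1) y|) (fun y _ => abs_nonneg _)
          (Finset.mem_univ _)
    _ ≤ _ := Finset.single_le_sum (f := fun x => ∑ y, |g x y|)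
          (fun x _ => Finset.sum_nonneg fun y _ => abs_nonneg _) (Finset.mem_univ _)

lemma setIntegral_prod_comp_cellIdx (N : ℕ) [NeZero N] (g : Fin N × Fin N → Fin N × Fin N → ℝ)
    (S T : Set USq) :
    ∫ p in S ×ˢ T, g (cellIdx N p.1) (cellIdx N p.2) =
      ∑ x, ∑ y, (volume.restrict S).real (cellIdx N ⁻¹' {x}) *
        (volume.restrict T).real (cellIdx N ⁻¹' {y}) * g x y := by
  rw [Measure.volume_eq_prod, ← Measure.prod_restrict,
    integral_prod _ (integrable_comp_cellIdx_pair N g _)]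
  simp only [integral_comp_cellIdx N (volume.restrict T)]
  rw [integral_comp_cellIdx N (volume.restrict S) fun x =>
    ∑ y, (volume.restrict T).real (cellIdx N ⁻¹' {y}) * g x y]
  refine Finset.sum_congr rfl fun x _ => ?_
  rw [Finset.mul_sum]
  refine Finset.sum_congr rfl fun y _ => ?_
  ring

lemma IsOrderon.integrable {W : USq → USq → ℝ} (hW : IsOrderon W) :
    Integrable fun p : USq × USq => W p.1 p.2 := by
  refine Integrable.of_bound hW.1.aestronglyMeasurable 1 (ae_of_all _ fun p => ?_)
  rw [Real.norm_eq_abs, abs_le]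
  have := hW.2.1 p.1 p.2
  constructor <;> linarith [this.1, this.2]

/-- The cut norm between grid-permuted orderons is controlled by grid approximations. -/
lemma cutNorm_gridPerm_le {W U : USq → USq → ℝ} (hW : IsOrderon W) (hU : IsOrderon U)
    {N : ℕ} [NeZero N] {w u : Fin N × Fin N → Fin N × Fin N → ℝ} {η Z : ℝ}
    (hWw : ∫ p : USq × USq, |W p.1 p.2 - w (cellIdx N p.1) (cellIdx N p.2)| ≤ η)
    (hUu : ∫ p : USq × USq, |U p.1 p.2 - u (cellIdx N p.1) (cellIdx N p.2)| ≤ η)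
    (σ : Equiv.Perm (Fin N × Fin N))
    (hZ : ∀ s t : Fin N × Fin N → ℝ, (∀ x, |s x| ≤ 1) → (∀ x, |t x| ≤ 1) →
      |∑ x, ∑ y, s x * t y * (w x y - u (σ x) (σ y))| ≤ ((N:ℝ) ^ 2) ^ 2 * Z) :
    cutNorm (fun p q => W p q - U (gridPerm σ p) (gridPerm σ q)) ≤ 2 * η + Z := by
  have hN : (0:ℝ) < (N:ℝ) ^ 2 := by
    have : (0:ℝ) < N := Nat.cast_pos.2 (NeZero.pos N)
    positivity
  set f := gridPerm σ with hf
  have hmp : MeasurePreserving (fun p : USq × USq => (f p.1, f p.2)) volume volume :=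
    (measurePreserving_gridPerm σ).prod (measurePreserving_gridPerm σ)
  have hiW : Integrable fun p : USq × USq => W p.1 p.2 - w (cellIdx N p.1) (cellIdx N p.2) :=
    hW.integrable.sub (integrable_comp_cellIdx_pair N w _)
  have hiU : Integrable fun p : USq × USq => U p.1 p.2 - u (cellIdx N p.1) (cellIdx N p.2) :=
    hU.integrable.sub (integrable_comp_cellIdx_pair N u _)
  have hiUf : Integrable fun p : USq × USq =>
      U (f p.1) (f p.2) - u (cellIdx N (f p.1)) (cellIdx N (f p.2)) :=
    hmp.integrable_comp_of_integrable hiU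
  have hUf : ∫ p : USq × USq,
      |U (f p.1) (f p.2) - u (cellIdx N (f p.1)) (cellIdx N (f p.2))| ≤ η := by
    refine le_of_eq_of_le ?_ hUu
    conv_rhs => rw [← hmp.map_eq]
    rw [integral_map hmp.measurable.aemeasurable]
    rw [hmp.map_eq]
    exact hiU.abs.aestronglyMeasurable
  have hcell : ∀ᵐ p : USq × USq, cellIdx N (f p.1) = σ (cellIdx N p.1) ∧
      cellIdx N (f p.2) = σ (cellIdx N p.2) := by
    have h1 : ∀ᵐ p : USq × USq, ((p.1.1 : ℝ) < 1 ∧ (p.1.2 : ℝ) < 1) :=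
      Measure.quasiMeasurePreserving_fst.ae ae_lt_one
    have h2 : ∀ᵐ p : USq × USq, ((p.2.1 : ℝ) < 1 ∧ (p.2.2 : ℝ) < 1) :=
      Measure.quasiMeasurePreserving_snd.ae ae_lt_one
    filter_upwards [h1, h2] with p hp1 hp2
    exact ⟨cellIdx_gridPerm σ _ hp1, cellIdx_gridPerm σ _ hp2⟩
  refine csSup_le ⟨_, ∅, ∅, MeasurableSet.empty, MeasurableSet.empty, rfl⟩ ?_
  rintro _ ⟨S, T, hS, hT, rfl⟩
  have e : ∫ p in S ×ˢ T, (W p.1 p.2 - U (f p.1) (f p.2)) =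
      (∫ p in S ×ˢ T, (W p.1 p.2 - w (cellIdx N p.1) (cellIdx N p.2))) -
      (∫ p in S ×ˢ T, (U (f p.1) (f p.2) - u (cellIdx N (f p.1)) (cellIdx N (f p.2)))) +
      ∫ p in S ×ˢ T, (w (cellIdx N p.1) (cellIdx N p.2) -
        u (σ (cellIdx N p.1)) (σ (cellIdx N p.2))) := by
    rw [← integral_sub hiW.integrableOn hiUf.integrableOn]
    have hi3 : Integrable fun p : USq × USq => (W p.1 p.2 - w (cellIdx N p.1) (cellIdx N p.2)) -
        (U (f p.1) (f p.2) - u (cellIdx N (f p.1)) (cellIdx N (f p.2))) := hiW.sub hiUf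
    rw [← integral_add hi3.integrableOn
      (integrable_comp_cellIdx_pair N (fun x y => w x y - u (σ x) (σ y)) _)]
    refine integral_congr_ae ?_
    filter_upwards [ae_restrict_of_ae hcell] with p hp
    rw [hp.1, hp.2]
    ring
  have hset : ∀ g : USq × USq → ℝ, Integrable g → |∫ p in S ×ˢ T, g p| ≤ ∫ p, |g p| := fun g hg =>
    (abs_integral_le_integral_abs).trans
      (setIntegral_le_integral hg.abs (ae_of_all _ fun p => abs_nonneg _))
  have h1 := (hset _ hiW).trans hWw
  have h2 := (hset _ hiUf).trans hUf
  have h3 : |∫ p in S ×ˢ T, (w (cellIdx N p.1) (cellIdx N p.2) -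
        u (σ (cellIdx N p.1)) (σ (cellIdx N p.2)))| ≤ Z := by
    rw [setIntegral_prod_comp_cellIdx N (fun x y => w x y - u (σ x) (σ y))]
    have hmass : ∀ (S : Set USq) x,
        |(N:ℝ) ^ 2 * (volume.restrict S).real (cellIdx N ⁻¹' {x})| ≤ 1 := by
      intro S x
      rw [abs_of_nonneg (by positivity)]
      have : (volume.restrict S).real (cellIdx N ⁻¹' {x}) ≤ ((N:ℝ) ^ 2)⁻¹ := by
        rw [← volume_real_cellIdx_preimage N x]
        exact ENNReal.toReal_mono (measure_ne_top _ _) (Measure.restrict_apply_le _ _)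
      calc _ ≤ (N:ℝ) ^ 2 * ((N:ℝ) ^ 2)⁻¹ := by gcongr
        _ = 1 := mul_inv_cancel₀ hN.ne'
    have h := hZ _ _ (hmass S) (hmass T)
    have e2 : ∑ x, ∑ y, (N:ℝ) ^ 2 * (volume.restrict S).real (cellIdx N ⁻¹' {x}) *
        ((N:ℝ) ^ 2 * (volume.restrict T).real (cellIdx N ⁻¹' {y})) * (w x y - u (σ x) (σ y)) =
        ((N:ℝ) ^ 2) ^ 2 * ∑ x, ∑ y, (volume.restrict S).real (cellIdx N ⁻¹' {x}) *
          (volume.restrict T).real (cellIdx N ⁻¹' {y}) * (w x y - u (σ x) (σ y)) := by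
      simp only [Finset.mul_sum]
      refine Finset.sum_congr rfl fun x _ => Finset.sum_congr rfl fun y _ => ?_
      ring
    rw [e2, abs_mul, abs_of_pos (by positivity)] at h
    exact le_of_mul_le_mul_left h (by positivity)
  show |∫ p in S ×ˢ T, (W p.1 p.2 - U (f p.1) (f p.2))| ≤ _
  rw [e]
  rw [abs_le] at h1 h2 h3 ⊢
  constructor <;> linarith [h1.1, h1.2, h2.1, h2.2, h3.1, h3.2]

/-- A bilinear bound for a small matrix passes to a blow-up, up to exceptional rows and
columns. -/
lemma abs_bilin_blowup_le {V ι : Type} [Fintype V] [Fintype ι] {E : V → V → ℝ} {e : ι → ι → ℝ}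
    {ρ : V → Option ι} (hE : ∀ x y r s, ρ x = some r → ρ y = some s → E x y = e r s) {B : ℝ}
    (hB : ∀ x y, |E x y| ≤ B) {m : ℕ}
    (hm : ∀ r, (Finset.univ.filter fun x => ρ x = some r).card ≤ m) {X : ℝ}
    (he : ∀ a b : ι → ℝ, (∀ i, |a i| ≤ 1) → (∀ i, |b i| ≤ 1) →
      |∑ i, ∑ j, a i * b j * e i j| ≤ X)
    (s t : V → ℝ) (hs : ∀ x, |s x| ≤ 1) (ht : ∀ x, |t x| ≤ 1) :
    |∑ x, ∑ y, s x * t y * E x y| ≤ (m:ℝ) ^ 2 * X +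
      2 * ((Finset.univ.filter fun x => ρ x = none).card * Fintype.card V * B) := by
  have hsplit : ∀ u : V → ℝ, ∀ x, u x =
      (∑ r, if ρ x = some r then u x else 0) + if ρ x = none then u x else 0 := by
    intro u x
    cases h : ρ x with
    | none => simp
    | some r => simp
  set A : (V → ℝ) → ι → ℝ := fun u r => ∑ x, if ρ x = some r then u x else 0 with hA
  have hAb : ∀ u : V → ℝ, (∀ x, |u x| ≤ 1) → ∀ r, |A u r| ≤ m := by
    intro u hu r
    calc |A u r| ≤ ∑ x, |if ρ x = some r then u x else 0| := Finset.abs_sum_le_sum_abs _ _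
      _ ≤ ∑ x, if ρ x = some r then (1:ℝ) else 0 := by
          refine Finset.sum_le_sum fun x _ => ?_
          split_ifs
          · exact hu x
          · simp
      _ = (Finset.univ.filter fun x => ρ x = some r).card := by rw [Finset.sum_boole]
      _ ≤ m := by exact_mod_cast hm r
  have hAm : ∀ u : V → ℝ, (∀ x, |u x| ≤ 1) → ∀ r, A u r = m * (A u r / m) ∧ |A u r / m| ≤ 1 := by
    intro u hu r
    have h := hAb u hu r
    rcases Nat.eq_zero_or_pos m with h0 | h0
    · rw [h0, Nat.cast_zero] at h ⊢
      rw [abs_nonpos_iff.1 h]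
      simp
    · have h0' : (0:ℝ) < m := by exact_mod_cast h0
      refine ⟨by field_simp, ?_⟩
      rw [abs_div, abs_of_pos h0', div_le_one h0']
      exact h
  have hmain : |∑ x, ∑ y, (∑ r, if ρ x = some r then s x else 0) *
      (∑ q, if ρ y = some q then t y else 0) * E x y| ≤ (m:ℝ) ^ 2 * X := by
    have e1 : ∑ x, ∑ y, (∑ r, if ρ x = some r then s x else 0) *
        (∑ q, if ρ y = some q then t y else 0) * E x y =
        ∑ r, ∑ q, A s r * A t q * e r q := by
      calc _ = ∑ x, ∑ y, ∑ r, ∑ q, (if ρ x = some r then s x else 0) *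
            (if ρ y = some q then t y else 0) * e r q := by
            refine Finset.sum_congr rfl fun x _ => Finset.sum_congr rfl fun y _ => ?_
            rw [Finset.sum_mul_sum, Finset.sum_mul]
            refine Finset.sum_congr rfl fun r _ => ?_
            rw [Finset.sum_mul]
            refine Finset.sum_congr rfl fun q _ => ?_
            by_cases h1 : ρ x = some r
            · by_cases h2 : ρ y = some q
              · rw [hE x y r q h1 h2]
              · simp [h2]
            · simp [h1]
        _ = ∑ x, ∑ r, ∑ y, ∑ q, (if ρ x = some r then s x else 0) *
            (if ρ y = some q then t y else 0) * e r q :=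
            Finset.sum_congr rfl fun x _ => Finset.sum_comm
        _ = ∑ r, ∑ x, ∑ y, ∑ q, (if ρ x = some r then s x else 0) *
            (if ρ y = some q then t y else 0) * e r q := Finset.sum_comm
        _ = ∑ r, ∑ x, ∑ q, ∑ y, (if ρ x = some r then s x else 0) *
            (if ρ y = some q then t y else 0) * e r q :=
            Finset.sum_congr rfl fun r _ => Finset.sum_congr rfl fun x _ => Finset.sum_comm
        _ = ∑ r, ∑ q, ∑ x, ∑ y, (if ρ x = some r then s x else 0) *
            (if ρ y = some q then t y else 0) * e r q :=
            Finset.sum_congr rfl fun r _ => Finset.sum_comm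
        _ = _ := by
            refine Finset.sum_congr rfl fun r _ => Finset.sum_congr rfl fun q _ => ?_
            rw [hA, Finset.sum_mul_sum, Finset.sum_mul]
            refine Finset.sum_congr rfl fun x _ => ?_
            rw [Finset.sum_mul]
    have e2 : ∑ r, ∑ q, A s r * A t q * e r q =
        (m:ℝ) ^ 2 * ∑ r, ∑ q, (A s r / m) * (A t q / m) * e r q := by
      simp only [Finset.mul_sum]
      refine Finset.sum_congr rfl fun r _ => Finset.sum_congr rfl fun q _ => ?_
      conv_lhs => rw [(hAm s hs r).1, (hAm t ht q).1]
      ring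
    rw [e1, e2, abs_mul, abs_of_nonneg (by positivity)]
    exact mul_le_mul_of_nonneg_left
      (he _ _ (fun r => (hAm s hs r).2) fun q => (hAm t ht q).2) (by positivity)
  have hle1 : ∀ u : V → ℝ, (∀ x, |u x| ≤ 1) → ∀ x,
      |∑ r, if ρ x = some r then u x else 0| ≤ 1 := by
    intro u hu x
    cases h : ρ x with
    | none => simp
    | some r => simpa using hu x
  have hle0 : ∀ u : V → ℝ, (∀ x, |u x| ≤ 1) → ∀ x,
      |if ρ x = none then u x else 0| ≤ if ρ x = none then 1 else 0 := by
    intro u hu x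
    split_ifs
    · exact hu x
    · simp
  set n0 : ℝ := ((Finset.univ.filter fun x => ρ x = none).card : ℝ)
  have hcount : ∑ x, (if ρ x = none then (1:ℝ) else 0) = n0 := by rw [Finset.sum_boole]
  have hmid : |∑ x, ∑ y, (∑ r, if ρ x = some r then s x else 0) *
      (if ρ y = none then t y else 0) * E x y| ≤ n0 * Fintype.card V * B := by
    refine (Finset.abs_sum_le_sum_abs _ _).trans ?_
    calc _ ≤ ∑ x : V, ∑ y, 1 * (if ρ y = none then 1 else 0) * B := by
          refine Finset.sum_le_sum fun x _ => (Finset.abs_sum_le_sum_abs _ _).trans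
            (Finset.sum_le_sum fun y _ => ?_)
          rw [abs_mul, abs_mul]
          have h1 := hle1 s hs x
          have h2 := hle0 t ht y
          have h3 := hB x y
          gcongr
      _ = _ := by
          simp only [one_mul, ← Finset.sum_mul, hcount]
          rw [Finset.sum_const, Finset.card_univ, nsmul_eq_mul]
          ring
  have hlast : |∑ x, ∑ y, (if ρ x = none then s x else 0) * t y * E x y| ≤
      n0 * Fintype.card V * B := by
    refine (Finset.abs_sum_le_sum_abs _ _).trans ?_
    calc _ ≤ ∑ x : V, ∑ y : V, (if ρ x = none then 1 else 0) * 1 * B := by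
          refine Finset.sum_le_sum fun x _ => (Finset.abs_sum_le_sum_abs _ _).trans
            (Finset.sum_le_sum fun y _ => ?_)
          rw [abs_mul, abs_mul]
          have h1 := ht y
          have h2 := hle0 s hs x
          have h3 := hB x y
          gcongr
      _ = _ := by
          simp only [mul_one, Finset.sum_const, Finset.card_univ, nsmul_eq_mul, ← Finset.sum_mul,
            ← Finset.mul_sum, hcount]
          ring
  have etot : ∑ x, ∑ y, s x * t y * E x y =
      ∑ x, ∑ y, (∑ r, if ρ x = some r then s x else 0) *
        (∑ q, if ρ y = some q then t y else 0) * E x y +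
      ∑ x, ∑ y, (∑ r, if ρ x = some r then s x else 0) *
        (if ρ y = none then t y else 0) * E x y +
      ∑ x, ∑ y, (if ρ x = none then s x else 0) * t y * E x y := by
    simp only [← Finset.sum_add_distrib]
    refine Finset.sum_congr rfl fun x _ => Finset.sum_congr rfl fun y _ => ?_
    conv_lhs => rw [hsplit s x]
    have h := hsplit t y
    set q1 := ∑ q, if ρ y = some q then t y else 0
    rw [add_mul, add_mul]
    congr 1
    rw [← add_mul, ← mul_add, ← h]
  rw [etot]
  rw [abs_le] at hmain hmid hlast ⊢
  constructor <;> linarith [hmain.1, hmain.2, hmid.1, hmid.2, hlast.1, hlast.2]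

lemma homDensity_nonneg {k : ℕ} (F : SimpleGraph (Fin k)) {W : USq → USq → ℝ}
    (hW : IsOrderon W) : 0 ≤ homDensity F W := by
  rw [homDensity_eq]
  exact mul_nonneg (Nat.cast_nonneg _)
    (integral_nonneg fun v => graphProb_nonneg (fun i j => hW.2.1 _ _) F)

lemma card_simpleGraph_mul_le {k : ℕ} (hk : 2 ≤ k) :
    (Fintype.card (SimpleGraph (Fin k)) : ℝ) * (2:ℝ) ^ (-((k:ℝ) ^ 2)) ≤ 1 / 4 := by
  set E := Finset.univ.filter (fun e : Fin k × Fin k => e.1 < e.2) with hE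
  have h1 : (Fintype.card (SimpleGraph (Fin k)) : ℝ) * (1 / 2) ^ E.card = 1 := by
    have : ∀ F : SimpleGraph (Fin k), graphProb (fun _ _ => (1 / 2 : ℝ)) F =
        (1 / 2 : ℝ) ^ E.card := by
      intro F
      rw [← Finset.prod_const]
      refine Finset.prod_congr rfl fun e _ => ?_
      split_ifs <;> norm_num
    have h := sum_graphProb (fun _ _ : Fin k => (1 / 2 : ℝ))
    simpa only [this, Finset.sum_const, Finset.card_univ, nsmul_eq_mul] using h
  have h2 : E.card + k ≤ k ^ 2 := by
    have h3 : E ⊆ (Finset.univ : Finset (Fin k)).offDiag := by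
      intro e he
      simpa using (Finset.mem_filter.1 he).2.ne
    have h4 := Finset.card_le_card h3
    rw [Finset.offDiag_card, Finset.card_univ, Fintype.card_fin] at h4
    have : k ≤ k * k := Nat.le_mul_self k
    rw [sq]
    omega
  have h5 : (2:ℝ) ^ (-((k:ℝ) ^ 2)) = (1 / 2) ^ (k ^ 2) := by
    rw [Real.rpow_neg (by norm_num), one_div, inv_pow]
    congr 1
    exact_mod_cast Real.rpow_natCast 2 (k ^ 2)
  have h6 : (1 / 2 : ℝ) ^ (k ^ 2) ≤ (1 / 2) ^ E.card * (1 / 2) ^ 2 := by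
    rw [← pow_add]
    exact pow_le_pow_of_le_one (by norm_num) (by norm_num) (by omega)
  rw [h5]
  calc _ ≤ (Fintype.card (SimpleGraph (Fin k)) : ℝ) * ((1 / 2) ^ E.card * (1 / 2) ^ 2) := by
        gcongr
    _ = 1 / 4 := by rw [← mul_assoc, h1]; norm_num

/-- Two orderons with close densities have a common typical graph. -/
lemma exists_common_graph {k : ℕ} (hk : 2 ≤ k) {W U : USq → USq → ℝ} (hW : IsOrderon W)
    (hWU : ∀ F : SimpleGraph (Fin k),
      |homDensity F W - homDensity F U| ≤ (2:ℝ) ^ (-((k:ℝ) ^ 2)))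
    {A B : SimpleGraph (Fin k) → Prop}
    (hA : ∑ F ∈ Finset.univ.filter (fun F => ¬ A F), homDensity F W ≤ 1 / 4)
    (hB : ∑ F ∈ Finset.univ.filter (fun F => ¬ B F), homDensity F U ≤ 1 / 4) :
    ∃ F, A F ∧ B F := by
  by_contra hc
  push Not at hc
  have h1 := sum_homDensity (k := k) hW
  have h2 : ∑ F ∈ Finset.univ.filter (fun F => ¬ B F), homDensity F W ≤ 1 / 4 + 1 / 4 := by
    calc _ ≤ ∑ F ∈ Finset.univ.filter (fun F => ¬ B F),
          (homDensity F U + (2:ℝ) ^ (-((k:ℝ) ^ 2))) :=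
          Finset.sum_le_sum fun F _ => by linarith [(abs_le.1 (hWU F)).2]
      _ = ∑ F ∈ Finset.univ.filter (fun F => ¬ B F), homDensity F U +
          (Finset.univ.filter (fun F => ¬ B F)).card * (2:ℝ) ^ (-((k:ℝ) ^ 2)) := by
          rw [Finset.sum_add_distrib, Finset.sum_const, nsmul_eq_mul]
      _ ≤ 1 / 4 + Fintype.card (SimpleGraph (Fin k)) * (2:ℝ) ^ (-((k:ℝ) ^ 2)) := by
          refine add_le_add hB ?_
          gcongr
          exact Finset.card_le_univ _
      _ ≤ _ := by linarith [card_simpleGraph_mul_le hk]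
  have h3 : ∑ F : SimpleGraph (Fin k), homDensity F W ≤
      ∑ F ∈ Finset.univ.filter (fun F => ¬ A F), homDensity F W +
      ∑ F ∈ Finset.univ.filter (fun F => ¬ B F), homDensity F W := by
    rw [Finset.sum_filter, Finset.sum_filter, ← Finset.sum_add_distrib]
    refine Finset.sum_le_sum fun F _ => ?_
    have h0 := homDensity_nonneg F hW
    by_cases h : A F
    · simp [h, hc F h]
    · rw [if_pos h]
      split_ifs <;> linarith
  linarith

lemma shiftOf_nonneg (f : USq → USq) : 0 ≤ shiftOf f :=
  Real.iSup_nonneg fun _ => abs_nonneg _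

lemma cutNorm_nonneg (W : USq → USq → ℝ) : 0 ≤ cutNorm W := by
  refine Real.sSup_nonneg ?_
  rintro _ ⟨S, T, _, _, rfl⟩
  exact abs_nonneg _

lemma csDist_le {W U : USq → USq → ℝ} {f : USq → USq} (hf : IsMPB f) :
    csDist W U ≤ shiftOf f + cutNorm (fun u v => W u v - U (f u) (f v)) := by
  refine csInf_le ⟨0, ?_⟩ ⟨f, hf, rfl⟩
  rintro _ ⟨g, _, rfl⟩
  exact add_nonneg (shiftOf_nonneg g) (cutNorm_nonneg _)

lemma csDist_le_one {W U : USq → USq → ℝ} (hW : IsOrderon W) (hU : IsOrderon U) :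
    csDist W U ≤ 1 := by
  have hid : IsMPB id := ⟨MeasurePreserving.id _, id, MeasurePreserving.id _, fun _ => rfl,
    fun _ => rfl⟩
  refine (csDist_le hid).trans ?_
  have h1 : shiftOf id = 0 := by simp [shiftOf]
  rw [h1, zero_add]
  refine csSup_le ⟨_, ∅, ∅, MeasurableSet.empty, MeasurableSet.empty, rfl⟩ ?_
  rintro _ ⟨S, T, hS, hT, rfl⟩
  have h2 := norm_setIntegral_le_of_norm_le_const (μ := (volume : Measure (USq × USq)))
    (s := S ×ˢ T) (f := fun p => W p.1 p.2 - U (id p.1) (id p.2)) (C := 1)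
    (measure_lt_top _ _) (fun p _ => by
      rw [Real.norm_eq_abs, abs_le]
      have h3 := hW.2.1 p.1 p.2
      have h4 := hU.2.1 p.1 p.2
      constructor <;> simp only [id] <;> linarith [h3.1, h3.2, h4.1, h4.2])
  refine h2.trans ?_
  rw [one_mul]
  exact measureReal_le_one

lemma card_filter_fst_lt {N b : ℕ} (hb : b ≤ N) :
    (Finset.univ.filter fun x : Fin N × Fin N => (x.1 : ℕ) < b).card = b * N := by
  have h1 : (Finset.univ.filter fun x : Fin N × Fin N => (x.1 : ℕ) < b) =
      (Finset.univ.filter fun i : Fin N => (i : ℕ) < b) ×ˢ Finset.univ := by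
    ext x
    simp
  have h2 : (Finset.univ.filter fun i : Fin N => (i : ℕ) < b).card = b := by
    rw [← Finset.card_map Fin.valEmbedding]
    have : (Finset.univ.filter fun i : Fin N => (i : ℕ) < b).map Fin.valEmbedding =
        Finset.range b := by
      ext i
      simp only [Finset.mem_map, Finset.mem_filter, Finset.mem_univ, true_and, Finset.mem_range,
        Fin.valEmbedding_apply]
      constructor
      · rintro ⟨j, hj, rfl⟩
        exact hj
      · intro hi
        exact ⟨⟨i, by omega⟩, hi, rfl⟩
    rw [this, Finset.card_range]
  rw [h1, Finset.card_product, h2, Finset.card_univ, Fintype.card_fin]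

lemma abs_bilin_cyc6_le {V : Type} [Fintype V] {R : V → V → ℝ} (hR : ∀ x y, R x y = R y x) {δ : ℝ}
    (hδ : 0 ≤ δ) (hc : cyc6 R ≤ (Fintype.card V : ℝ) ^ 6 * δ ^ 6) {s t : V → ℝ}
    (hs : ∀ x, |s x| ≤ 1) (ht : ∀ x, |t x| ≤ 1) :
    |∑ x, ∑ y, s x * t y * R x y| ≤ (Fintype.card V : ℝ) ^ 2 * δ := by
  rw [← pow_le_pow_iff_left₀ (abs_nonneg _) (by positivity) (by norm_num : (6:ℕ) ≠ 0),
    Even.pow_abs (by decide)]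
  calc _ ≤ (Fintype.card V : ℝ) ^ 6 * cyc6 R := bilin_pow_six_le R hR s t hs ht
    _ ≤ (Fintype.card V : ℝ) ^ 6 * ((Fintype.card V : ℝ) ^ 6 * δ ^ 6) := by gcongr
    _ = _ := by ring

lemma abs_bilin_approx_le {V β : Type} [Fintype V] {w R : V → V → ℝ} {h : V → β} {D : β → β → ℝ}
    (hR : ∀ x y, R x y = R y x) {δ : ℝ} (hδ : 0 ≤ δ)
    (hc : cyc6 R ≤ (Fintype.card V : ℝ) ^ 6 * δ ^ 6)
    (hD : ∀ x y, |w x y - R x y - D (h x) (h y)| ≤ δ) {s t : V → ℝ}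
    (hs : ∀ x, |s x| ≤ 1) (ht : ∀ x, |t x| ≤ 1) :
    |∑ x, ∑ y, s x * t y * (w x y - D (h x) (h y))| ≤ 2 * (Fintype.card V : ℝ) ^ 2 * δ := by
  have h1 := abs_bilin_cyc6_le hR hδ hc hs ht
  have h2 : |∑ x, ∑ y, s x * t y * (w x y - R x y - D (h x) (h y))| ≤
      (Fintype.card V : ℝ) ^ 2 * δ := by
    refine (abs_bilin_le_of_abs_le (fun x y => w x y - R x y - D (h x) (h y)) s t hs ht).trans ?_
    calc _ ≤ ∑ x : V, ∑ y : V, δ :=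
          Finset.sum_le_sum fun x _ => Finset.sum_le_sum fun y _ => hD x y
      _ = _ := by
          simp only [Finset.sum_const, Finset.card_univ, nsmul_eq_mul]
          ring
  have e : ∑ x, ∑ y, s x * t y * (w x y - D (h x) (h y)) =
      ∑ x, ∑ y, s x * t y * R x y +
      ∑ x, ∑ y, s x * t y * (w x y - R x y - D (h x) (h y)) := by
    simp only [← Finset.sum_add_distrib]
    refine Finset.sum_congr rfl fun x _ => Finset.sum_congr rfl fun y _ => ?_
    ring
  rw [e]
  refine (abs_add_le _ _).trans ?_
  linarith

set_option maxHeartbeats 1000000 in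
lemma csDist_le_of_density_close {k L : ℕ} (hL : 1 ≤ L) {δ : ℝ} (hδ : 0 ≤ δ)
    (hδL : δ ^ 6 = ((L:ℝ) ^ 4)⁻¹) (hδ1 : 1 / (L:ℝ) ≤ δ) (hk2 : 2 ≤ k)
    (hk : 1000 * (L:ℝ) ^ 28 * (8 * (L:ℝ) ^ 5) ^ (L ^ 2) ≤ k)
    {W U : USq → USq → ℝ} (hW : IsOrderon W) (hU : IsOrderon U)
    (hWU : ∀ F : SimpleGraph (Fin k),
      |homDensity F W - homDensity F U| ≤ (2:ℝ) ^ (-((k:ℝ) ^ 2))) :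
    csDist W U ≤ 41 * δ := by
  have hL0 : (0:ℝ) < L := by exact_mod_cast hL
  have hL1 : (1:ℝ) ≤ L := by exact_mod_cast hL
  obtain ⟨N₁, hN₁⟩ := exists_grid_approx W hW (1 / (16 * L)) (by positivity)
  obtain ⟨N₂, hN₂⟩ := exists_grid_approx U hU (1 / (16 * L)) (by positivity)
  obtain ⟨M, hM⟩ : ∃ M, M = N₁ + N₂ + 1 := ⟨_, rfl⟩
  obtain ⟨N, hN⟩ : ∃ N, N = k * L ^ 5 * M * L := ⟨_, rfl⟩
  have hkL : 1 ≤ k * L ^ 5 := Nat.mul_pos (by omega) (Nat.pow_pos hL)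
  have hMN : M ≤ N := by
    rw [hN]
    calc M = 1 * M * 1 := by ring
      _ ≤ k * L ^ 5 * M * L := by gcongr
  have : NeZero N := ⟨by omega⟩
  have hNdiv : N / L = k * L ^ 5 * M := by
    rw [hN, Nat.mul_div_cancel _ hL]
  have hNL : N / L * L = N := by rw [hNdiv, hN]
  have hNL0 : 0 < N / L := by
    rw [hNdiv]
    exact Nat.mul_pos hkL (by omega)
  obtain ⟨w, hws, hw, hWw⟩ := hN₁ N ‹_› (by omega)
  obtain ⟨u, hus, hu, hUu⟩ := hN₂ N ‹_› (by omega)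
  obtain ⟨β, _, h, D, R, hR, hD, hDb, hcyc, GW, hGW, hGW'⟩ :=
    exists_structured_samples hW hL hNL hδ hδL hδ1 hk w hws hw hWw
  obtain ⟨β', _, h', D', R', hR', hD', hDb', hcyc', GU, hGU, hGU'⟩ :=
    exists_structured_samples hU hL hNL hδ hδL hδ1 hk u hus hu hUu
  obtain ⟨F, hFW, hFU⟩ := exists_common_graph hk2 hW hWU hGW hGU
  obtain ⟨c, hcm, hcf, hcb⟩ := hGW' F hFW
  obtain ⟨c', hcm', hcf', hcb'⟩ := hGU' F hFU
  have hcard : (Fintype.card (Fin N × Fin N) : ℝ) = (N:ℝ) ^ 2 := by simp [sq]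
  have hcardN : Fintype.card (Fin N × Fin N) = N ^ 2 := by simp [sq]
  have hNr : (N:ℝ) = (N / L : ℕ) * L := by exact_mod_cast hNL.symm
  have hN0 : (0:ℝ) < N := by exact_mod_cast NeZero.pos N
  obtain ⟨m, hm⟩ : ∃ m, m = N * L * M * (L ^ 5 - 1) := ⟨_, rfl⟩
  have hL5 : 1 ≤ L ^ 5 := Nat.one_le_pow _ _ hL
  have hmk : (m:ℝ) * k = (N:ℝ) ^ 2 - (N:ℝ) ^ 2 / (L:ℝ) ^ 5 := by
    rw [hm]
    push_cast [Nat.cast_sub hL5]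
    have : (N:ℝ) = k * L ^ 5 * M * L := by rw [hN]; push_cast; ring
    field_simp
    rw [this]
    ring
  have hmkN : m * k ≤ N ^ 2 := by
    have : (m:ℝ) * k ≤ (N:ℝ) ^ 2 := by
      rw [hmk]
      have : 0 ≤ (N:ℝ) ^ 2 / (L:ℝ) ^ 5 := by positivity
      linarith
    exact_mod_cast this
  have hposL : ∀ x : Fin N × Fin N, (x.1 : ℕ) / (N / L) < L := by
    intro x
    have := x.1.2
    exact Nat.div_lt_of_lt_mul (by rwa [hNL])
  obtain ⟨σ, ρ, hρ, hρm, hρ0, hσ⟩ := exists_class_matching (V := Fin N × Fin N)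
    (cellClass hNL h) (cellClass hNL h') (fun a => (a.1 : ℕ)) (fun a => (a.1 : ℕ))
    (fun x => (x.1 : ℕ) / (N / L)) (fun x => rfl) (fun x => rfl) (k := k) (m := m) (L := L)
    hL (by omega) hposL (by
      intro a ha
      simp only [Nat.div_lt_iff_lt_mul hNL0]
      have hb : a * (N / L) ≤ N := by
        calc a * (N / L) ≤ L * (N / L) := by gcongr
          _ = N := by rw [mul_comm, hNL]
      rw [hcard, card_filter_fst_lt hb]
      push_cast
      field_simp
      rw [mul_assoc, ← hNr])
    (fun r => cellClass hNL h (c r)) (fun r => cellClass hNL h' (c' r))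
    (fun r s hrs => Nat.div_le_div_right (hcm r s hrs))
    (fun r s hrs => Nat.div_le_div_right (hcm' r s hrs))
    (fun r => hposL _) (fun r => hposL _) (by rw [hcardN]; exact hmkN) (1 / (6 * (L:ℝ) ^ 6))
    hcf hcf' (by
      rw [hcard, hmk]
      apply le_of_eq
      field_simp
      ring)
  have hshift : shiftOf (gridPerm σ) ≤ 2 / L := by
    refine shiftOf_gridPerm_le σ _ fun x => ?_
    have e : 2 / (L:ℝ) * N = 2 * (N / L : ℕ) := by
      rw [hNr]
      field_simp
    rw [e]
    have h1 := (hσ x).1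
    have h2 := (hσ x).2
    have a1 := Nat.div_add_mod (x.1 : ℕ) (N / L)
    have a2 := Nat.mod_lt (x.1 : ℕ) hNL0
    have b1 := Nat.div_add_mod ((σ x).1 : ℕ) (N / L)
    have b2 := Nat.mod_lt ((σ x).1 : ℕ) hNL0
    have c1 := Nat.mul_le_mul_left (N / L) h1
    have c2 := Nat.mul_le_mul_left (N / L) h2
    rw [mul_add, mul_one] at c1 c2
    have g1 : (x.1 : ℕ) ≤ (σ x).1 + 2 * (N / L) := by omega
    have g2 : ((σ x).1 : ℕ) ≤ x.1 + 2 * (N / L) := by omega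
    have g1' : ((x.1 : ℕ) : ℝ) ≤ ((σ x).1 : ℕ) + 2 * (N / L : ℕ) := by exact_mod_cast g1
    have g2' : (((σ x).1 : ℕ) : ℝ) ≤ (x.1 : ℕ) + 2 * (N / L : ℕ) := by exact_mod_cast g2
    rw [abs_le]
    constructor <;> linarith
  have hcut : cutNorm (fun p q => W p q - U (gridPerm σ p) (gridPerm σ q)) ≤
      2 * (1 / (16 * L)) + 38 * δ := by
    refine cutNorm_gridPerm_le hW hU hWw hUu σ fun s t hs ht => ?_
    rw [← hcard] at hcyc hcyc' ⊢
    have k1 := abs_bilin_approx_le hR hδ hcyc (fun x y => (hD x y).trans hδ1) hs ht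
    have k2 := abs_bilin_approx_le hR' hδ hcyc' (fun x y => (hD' x y).trans hδ1)
      (s := s ∘ σ.symm) (t := t ∘ σ.symm) (fun x => hs _) (fun x => ht _)
    have e2 : ∑ x, ∑ y, (s ∘ σ.symm) x * (t ∘ σ.symm) y * (u x y - D' (h' x) (h' y)) =
        ∑ x, ∑ y, s x * t y * (u (σ x) (σ y) - D' (h' (σ x)) (h' (σ y))) := by
      refine (Fintype.sum_equiv σ _ _ fun x => Fintype.sum_equiv σ _ _ fun y => ?_).symm
      simp
    rw [e2] at k2
    have k3 := abs_bilin_blowup_le (ρ := ρ)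
      (E := fun x y => D (h x) (h y) - D' (h' (σ x)) (h' (σ y)))
      (e := fun r q => D (h (c r)) (h (c q)) - D' (h' (c' r)) (h' (c' q)))
      (fun x y r q hx hy => by
        have p1 := hρ x r hx
        have p2 := hρ y q hy
        have q1 : h x = h (c r) := congrArg Prod.snd p1.1
        have q2 : h y = h (c q) := congrArg Prod.snd p2.1
        have q3 : h' (σ x) = h' (c' r) := congrArg Prod.snd p1.2
        have q4 : h' (σ y) = h' (c' q) := congrArg Prod.snd p2.2
        simp only [q1, q2, q3, q4]) (B := 8 * (L:ℝ) ^ 4)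
      (fun x y => by
        have p1 := abs_le.1 (hDb x y)
        have p2 := abs_le.1 (hDb' (σ x) (σ y))
        rw [abs_le]
        constructor <;> linarith [p1.1, p1.2, p2.1, p2.2])
      (m := m) (fun r => by convert hρm r) (X := 12 * (k:ℝ) ^ 2 * δ)
      (fun a b ha hb => by
        have p1 := abs_le.1 (hcb a b ha hb)
        have p2 := abs_le.1 (hcb' a b ha hb)
        have e : ∑ i, ∑ j, a i * b j * (D (h (c i)) (h (c j)) - D' (h' (c' i)) (h' (c' j))) =
            ∑ i, ∑ j, a i * b j * ((if F.Adj i j then 1 else 0) - D' (h' (c' i)) (h' (c' j))) -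
            ∑ i, ∑ j, a i * b j * ((if F.Adj i j then 1 else 0) - D (h (c i)) (h (c j))) := by
          simp only [← Finset.sum_sub_distrib]
          refine Finset.sum_congr rfl fun i _ => Finset.sum_congr rfl fun j _ => ?_
          ring
        rw [e, abs_le]
        constructor <;> linarith [p1.1, p1.2, p2.1, p2.2]) s t hs ht
    have k4 : (m:ℝ) ^ 2 * (12 * (k:ℝ) ^ 2 * δ) ≤
        12 * ((Fintype.card (Fin N × Fin N) : ℝ) ^ 2 * δ) := by
      have : ((m:ℝ) * k) ^ 2 ≤ ((N:ℝ) ^ 2) ^ 2 := by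
        have : (m:ℝ) * k ≤ (N:ℝ) ^ 2 := by exact_mod_cast hmkN
        gcongr
      rw [hcard]
      nlinarith
    have k5 : 2 * (((Finset.univ.filter fun x => ρ x = none).card : ℝ) *
        Fintype.card (Fin N × Fin N) * (8 * (L:ℝ) ^ 4)) ≤
        22 * ((Fintype.card (Fin N × Fin N) : ℝ) ^ 2 * δ) := by
      rw [hmk] at hρ0
      rw [hcard] at hρ0 ⊢
      have r1 : ((Finset.univ.filter fun x => ρ x = none).card : ℝ) * (L:ℝ) ^ 4 ≤
          (N:ℝ) ^ 2 * (4 / 3 * (1 / (L:ℝ))) := by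
        calc _ ≤ ((N:ℝ) ^ 2 - ((N:ℝ) ^ 2 - (N:ℝ) ^ 2 / (L:ℝ) ^ 5) +
              2 * (1 / (6 * (L:ℝ) ^ 6)) * (N:ℝ) ^ 2) * (L:ℝ) ^ 4 := by gcongr
          _ = (N:ℝ) ^ 2 * (1 / (L:ℝ) + 1 / 3 * (1 / (L:ℝ)) * (1 / (L:ℝ))) := by
              field_simp
              ring
          _ ≤ _ := by
              gcongr
              have : 1 / (L:ℝ) ≤ 1 := by rw [div_le_one hL0]; exact hL1
              have : 0 < 1 / (L:ℝ) := by positivity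
              nlinarith
      calc _ = 16 * (N:ℝ) ^ 2 *
            (((Finset.univ.filter fun x => ρ x = none).card : ℝ) * (L:ℝ) ^ 4) := by ring
        _ ≤ 16 * (N:ℝ) ^ 2 * ((N:ℝ) ^ 2 * (4 / 3 * δ)) := by
            exact mul_le_mul_of_nonneg_left (r1.trans (by gcongr)) (by positivity)
        _ ≤ _ := by
            have : 0 ≤ ((N:ℝ) ^ 2) ^ 2 * δ := by positivity
            nlinarith
    have e : ∑ x, ∑ y, s x * t y * (w x y - u (σ x) (σ y)) =
        ∑ x, ∑ y, s x * t y * (w x y - D (h x) (h y)) -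
        ∑ x, ∑ y, s x * t y * (u (σ x) (σ y) - D' (h' (σ x)) (h' (σ y))) +
        ∑ x, ∑ y, s x * t y * (D (h x) (h y) - D' (h' (σ x)) (h' (σ y))) := by
      simp only [← Finset.sum_sub_distrib, ← Finset.sum_add_distrib]
      refine Finset.sum_congr rfl fun x _ => Finset.sum_congr rfl fun y _ => ?_
      ring
    rw [e]
    rw [abs_le] at k1 k2 k3 ⊢
    constructor <;> linarith [k1.1, k1.2, k2.1, k2.2, k3.1, k3.2]
  refine (csDist_le (isMPB_gridPerm σ)).trans ((add_le_add hshift hcut).trans ?_)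
  have e1 : 2 / (L:ℝ) = 2 * (1 / (L:ℝ)) := by ring
  have e2 : 1 / (16 * (L:ℝ)) = 1 / 16 * (1 / (L:ℝ)) := by ring
  rw [e1, e2]
  linarith

lemma sample_size_le {k L : ℕ} (hL : 1 ≤ L) (h1 : 1 ≤ Real.log (Real.log k))
    (hL2 : 64 * (L:ℝ) ^ 2 * Real.log (Real.log k) ≤ Real.log k) :
    1000 * (L:ℝ) ^ 28 * (8 * (L:ℝ) ^ 5) ^ (L ^ 2) ≤ k := by
  have hL1 : (1:ℝ) ≤ L := by exact_mod_cast hL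
  have hy : 0 < Real.log k := by
    by_contra hc
    have : 64 * (L:ℝ) ^ 2 * Real.log (Real.log k) > 0 := by positivity
    linarith
  have hk0 : (0:ℝ) < k := by
    rcases Nat.eq_zero_or_pos k with rfl | h
    · simp at hy
    · exact_mod_cast h
  have h8 : Real.log (8 * L) ≤ 1 / 2 * Real.log (Real.log k) := by
    have : (8 * (L:ℝ)) ^ 2 ≤ Real.log k := by nlinarith [sq_nonneg (L:ℝ)]
    have h2 := Real.log_le_log (by positivity) this
    rw [Real.log_pow] at h2
    push_cast at h2
    linarith
  have h9 : 1000 * (L:ℝ) ^ 28 * (8 * (L:ℝ) ^ 5) ^ (L ^ 2) ≤ (8 * (L:ℝ)) ^ (33 * L ^ 2) := by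
    calc _ ≤ (8 * (L:ℝ)) ^ 28 * ((8 * (L:ℝ)) ^ 5) ^ (L ^ 2) := by
          rw [mul_pow 8 (L:ℝ) 28, mul_pow 8 (L:ℝ) 5]
          gcongr <;> norm_num
      _ = (8 * (L:ℝ)) ^ (28 + 5 * L ^ 2) := by rw [← pow_mul, ← pow_add]
      _ ≤ _ := by
          apply pow_le_pow_right₀ (by linarith)
          have : 1 ≤ L ^ 2 := Nat.one_le_pow _ _ hL
          omega
  refine h9.trans ?_
  rw [← Real.log_le_log_iff (by positivity) hk0, Real.log_pow]
  push_cast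
  have : 0 ≤ (L:ℝ) ^ 2 * Real.log (Real.log k) := by positivity
  calc 33 * (L:ℝ) ^ 2 * Real.log (8 * L) ≤
      33 * (L:ℝ) ^ 2 * (1 / 2 * Real.log (Real.log k)) := by gcongr
    _ ≤ _ := by linarith

lemma csDist_le_of_small {k : ℕ} (h1 : 1 ≤ Real.log (Real.log k))
    (hx : 64 * Real.log (Real.log k) ≤ Real.log k) {W U : USq → USq → ℝ}
    (hW : IsOrderon W) (hU : IsOrderon U)
    (hWU : ∀ F : SimpleGraph (Fin k),
      |homDensity F W - homDensity F U| ≤ (2:ℝ) ^ (-((k:ℝ) ^ 2))) :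
    csDist W U ≤ 656 * (Real.log (Real.log k) / Real.log k) ^ ((1:ℝ) / 3) := by
  set x := Real.log (Real.log k) / Real.log k with hxdef
  have hy : 0 < Real.log k := by linarith
  have hx0 : 0 < x := by positivity
  have hk2 : 2 ≤ k := by
    by_contra hc
    interval_cases k <;> simp at hy
  obtain ⟨z, hz⟩ : ∃ z, z = Real.sqrt (Real.log k / Real.log (Real.log k)) / 8 := ⟨_, rfl⟩
  have hz2 : 64 * z ^ 2 = Real.log k / Real.log (Real.log k) := by
    rw [hz, div_pow, Real.sq_sqrt (by positivity)]
    ring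
  have hz0 : 0 ≤ z := by rw [hz]; positivity
  have hzx : z ^ 2 * x = 1 / 64 := by
    have : 64 * z ^ 2 * x = 1 := by
      rw [hz2, hxdef]
      field_simp
    linarith
  have hz1 : 1 ≤ z := by
    have : (1:ℝ) ≤ z ^ 2 := by
      have : 64 ≤ 64 * z ^ 2 := by rw [hz2, le_div_iff₀ (by linarith)]; exact hx
      linarith
    nlinarith
  obtain ⟨L, hL⟩ : ∃ L, L = ⌊z⌋₊ := ⟨_, rfl⟩
  have hL1 : 1 ≤ L := by rw [hL]; exact Nat.le_floor (by simpa using hz1)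
  have hLz : (L:ℝ) ≤ z := by rw [hL]; exact Nat.floor_le hz0
  have hLz' : z ≤ 2 * L := by
    have h3 : z < L + 1 := by rw [hL]; exact Nat.lt_floor_add_one z
    have h4 : (1:ℝ) ≤ L := by exact_mod_cast hL1
    linarith
  have hL0 : (0:ℝ) < L := by exact_mod_cast hL1
  obtain ⟨δ, hδ⟩ : ∃ δ : ℝ, δ = (L:ℝ) ^ (-(2 / 3) : ℝ) := ⟨_, rfl⟩
  have hδ0 : 0 < δ := by rw [hδ]; positivity
  have hδL : δ ^ 6 = ((L:ℝ) ^ 4)⁻¹ := by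
    rw [hδ, ← Real.rpow_natCast, ← Real.rpow_mul hL0.le, ← Real.rpow_natCast,
      ← Real.rpow_neg hL0.le]
    norm_num
  have hδ1 : 1 / (L:ℝ) ≤ δ := by
    rw [hδ, one_div, ← Real.rpow_neg_one]
    exact Real.rpow_le_rpow_of_exponent_le (by exact_mod_cast hL1) (by norm_num)
  have hsize := sample_size_le hL1 h1 (by
    have : (L:ℝ) ^ 2 ≤ z ^ 2 := by gcongr
    have h5 : 64 * (L:ℝ) ^ 2 ≤ Real.log k / Real.log (Real.log k) := by linarith
    rwa [le_div_iff₀ (by linarith)] at h5)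
  refine (csDist_le_of_density_close hL1 hδ0.le hδL hδ1 hk2 hsize hW hU hWU).trans ?_
  have hδx : δ ≤ 16 * x ^ ((1:ℝ) / 3) := by
    rw [← pow_le_pow_iff_left₀ hδ0.le (by positivity) (by norm_num : (6:ℕ) ≠ 0), hδL, mul_pow,
      ← Real.rpow_natCast (x ^ ((1:ℝ) / 3)), ← Real.rpow_mul hx0.le]
    norm_num
    rw [inv_le_iff_one_le_mul₀ (by positivity)]
    have h6 : 1 / 256 ≤ (L:ℝ) ^ 2 * x := by
      have : z ^ 2 * x ≤ (2 * (L:ℝ)) ^ 2 * x := by gcongr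
      linarith
    have h7 : (1 / 256 : ℝ) ^ 2 ≤ ((L:ℝ) ^ 2 * x) ^ 2 := by gcongr
    nlinarith
  linarith

/-- Inverse counting lemma: there is `C > 0` such that for all `k ≥ 3`, if all
`k`-vertex ordered subgraph densities of `W` and `U` differ by at most `2^{-k²}`,
then `d△(W,U) ≤ 2C·(log log k / log k)^{1/3}`. -/
theorem inverse_counting_lemma :
    ∃ C : ℝ, 0 < C ∧ ∀ k : ℕ, 3 ≤ k → ∀ W U : USq → USq → ℝ,
      IsOrderon W → IsOrderon U →
      (∀ F : SimpleGraph (Fin k),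
        |homDensity F W - homDensity F U| ≤ (2:ℝ) ^ (-((k:ℝ)^2))) →
      csDist W U ≤ 2 * C * ((Real.log (Real.log k) / Real.log k) ^ ((1:ℝ)/3)) := by
  obtain ⟨c, hc⟩ : ∃ c, c = Real.log (Real.log 3) / Real.exp 1 := ⟨_, rfl⟩
  have hl3 : 1 < Real.log 3 := by
    rw [Real.lt_log_iff_exp_lt (by norm_num)]
    exact Real.exp_one_lt_three
  have hc0 : 0 < c := by
    rw [hc]
    exact div_pos (Real.log_pos hl3) (Real.exp_pos 1)
  have hcc : 0 < c ^ ((1:ℝ) / 3) := by positivity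
  refine ⟨328 + (c ^ ((1:ℝ) / 3))⁻¹, by positivity, fun k hk W U hW hU hWU => ?_⟩
  have hk3 : (3:ℝ) ≤ k := by exact_mod_cast hk
  have hlk : Real.log 3 ≤ Real.log k := Real.log_le_log (by norm_num) hk3
  have hy : 0 < Real.log k := by linarith
  have hll : Real.log (Real.log 3) ≤ Real.log (Real.log k) :=
    Real.log_le_log (by linarith) hlk
  have hll0 : 0 < Real.log (Real.log k) := (Real.log_pos hl3).trans_le hll
  set x := Real.log (Real.log k) / Real.log k with hx
  have hx0 : 0 < x := by positivity
  have hxp : 0 < x ^ ((1:ℝ) / 3) := by positivity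
  have hsplit : 2 * (328 + (c ^ ((1:ℝ) / 3))⁻¹) * x ^ ((1:ℝ) / 3) =
      656 * x ^ ((1:ℝ) / 3) + 2 * ((c ^ ((1:ℝ) / 3))⁻¹ * x ^ ((1:ℝ) / 3)) := by ring
  have hpos : 0 < (c ^ ((1:ℝ) / 3))⁻¹ * x ^ ((1:ℝ) / 3) := by positivity
  rw [hsplit]
  rcases le_or_gt 1 (Real.log (Real.log k)) with h1 | h1
  · rcases le_or_gt (64 * Real.log (Real.log k)) (Real.log k) with h2 | h2
    · linarith [csDist_le_of_small h1 h2 hW hU hWU]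
    · have h3 : (1:ℝ) / 64 ≤ x := by
        rw [hx, div_le_div_iff₀ (by norm_num) hy]
        linarith
      have h4 : ((1:ℝ) / 64) ^ ((1:ℝ) / 3) ≤ x ^ ((1:ℝ) / 3) := by gcongr
      have h5 : ((1:ℝ) / 64) ^ ((1:ℝ) / 3) = 1 / 4 := by
        rw [show (1:ℝ) / 64 = (1 / 4) ^ (3:ℝ) by norm_num, ← Real.rpow_mul (by norm_num)]
        norm_num
      linarith [csDist_le_one hW hU]
  · have h2 : Real.log k ≤ Real.exp 1 := by
      rw [← Real.log_le_iff_le_exp hy]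
      exact h1.le
    have h3 : c ≤ x := by
      rw [hc, hx]
      gcongr
    have h4 : c ^ ((1:ℝ) / 3) ≤ x ^ ((1:ℝ) / 3) := by gcongr
    have h5 : 1 ≤ (c ^ ((1:ℝ) / 3))⁻¹ * x ^ ((1:ℝ) / 3) := by
      rw [inv_mul_eq_div, one_le_div hcc]
      exact h4
    linarith [csDist_le_one hW hU]
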